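/- (Fried–Goldman: the Auslander conjecture in dimension three.) Let Γ be a subgroup of the group Aff(ℝ³) of affine transformations of ℝ³ whose action on ℝ³ is properly discontinuous and has compact quotient Γ\ℝ³. Then Γ is virtually polycyclic. -/

import Mathlib

/-- A group is virtually polycyclic if it has a finite-index subgroup which is
solvable and all of whose subgroups are finitely generated. -/
def IsVirtuallyPolycyclic (G : Type*) [Group G] : Prop :=
  ∃ H : Subgroup G, H.index ≠ 0 ∧ IsSolvable H ∧ ∀ K : Subgroup H, K.FG

/-- The orbit equivalence relation of a subgroup `Γ` of the group of affine
self-equivalences of `ℝ³`; its quotient is the orbit space `Γ \ ℝ³`. -/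
def affineOrbitSetoid (Γ : Subgroup ((Fin 3 → ℝ) ≃ᵃ[ℝ] (Fin 3 → ℝ))) :
    Setoid (Fin 3 → ℝ) where
  r x y := ∃ γ ∈ Γ, γ x = y
  iseqv := by
    constructor
    · exact fun x => ⟨1, Γ.one_mem, rfl⟩
    · rintro x y ⟨γ, hγ, rfl⟩
      exact ⟨γ⁻¹, Γ.inv_mem hγ, γ.symm_apply_apply x⟩
    · rintro x y z ⟨γ, hγ, rfl⟩ ⟨δ, hδ, rfl⟩
      exact ⟨δ * γ, Γ.mul_mem hδ hγ, rfl⟩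

section Part1
open Matrix

namespace FG3

set_option linter.unusedSectionVars false

/-! ### Irreducibility of function algebras on groups -/

section Irr
variable {G : Type} [Group G]

/-- right translation as a ring hom on an invariant subalgebra -/
def rtr (P : Subalgebra ℝ (G → ℝ))
    (htr : ∀ f ∈ P, ∀ h : G, (fun g => f (g * h)) ∈ P) (h : G) : P →+* P where
  toFun f := ⟨fun g => f.1 (g * h), htr _ f.2 h⟩
  map_one' := rfl
  map_mul' _ _ := rfl
  map_zero' := rfl
  map_add' _ _ := rfl

/-- ideal of functions vanishing on a set -/
def vanIdeal (P : Subalgebra ℝ (G → ℝ)) (S : Set G) : Ideal P where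
  carrier := {f | ∀ g ∈ S, f.1 g = 0}
  add_mem' := by
    intro a b ha hb g hg
    have h1 := ha g hg
    have h2 := hb g hg
    simp [h1, h2]
  zero_mem' := by intro g _; rfl
  smul_mem' := by
    intro c a ha g hg
    have h1 := ha g hg
    simp [h1]

theorem mem_vanIdeal {P : Subalgebra ℝ (G → ℝ)} {S : Set G} {f : P} :
    f ∈ vanIdeal P S ↔ ∀ g ∈ S, f.1 g = 0 := Iff.rfl

theorem finiteIndex_of_map {H K : Subgroup G} [H.FiniteIndex] {S : Type*} (f : G → S)
    (hfin : (f '' (H : Set G)).Finite)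
    (hK : ∀ a ∈ H, ∀ b ∈ H, f a = f b → a⁻¹ * b ∈ K) : K.FiniteIndex := by
  have h1 : (K.subgroupOf H).FiniteIndex := by
    rw [Subgroup.finiteIndex_iff_finite_quotient]
    have : Finite (f '' (H : Set G)) := hfin
    apply Finite.of_injective
      (fun x : H ⧸ (K.subgroupOf H) =>
        (⟨f (Quotient.out x : H), ⟨_, (Quotient.out x : H).2, rfl⟩⟩ : f '' (H : Set G)))
    intro x y hxy
    have := congrArg Subtype.val hxy
    have h2 := hK _ (Quotient.out x).2 _ (Quotient.out y).2 this
    rw [← QuotientGroup.out_eq' x, ← QuotientGroup.out_eq' y]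
    rw [QuotientGroup.eq]
    exact h2
  have h2 : K.relIndex H ≠ 0 := h1.index_ne_zero
  have h3 : H.index ≠ 0 := Subgroup.FiniteIndex.index_ne_zero
  have h4 := Subgroup.relIndex_mul_index (inf_le_right : K ⊓ H ≤ H)
  rw [Subgroup.inf_relIndex_right] at h4
  have h5 : (K ⊓ H).index ≠ 0 := by rw [← h4]; exact mul_ne_zero h2 h3
  have : (K ⊓ H).FiniteIndex := ⟨h5⟩
  exact Subgroup.finiteIndex_of_le (inf_le_left : K ⊓ H ≤ K)

theorem exists_irr (P : Subalgebra ℝ (G → ℝ)) (hfg : P.FG)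
    (htr : ∀ f ∈ P, ∀ h : G, (fun g => f (g * h)) ∈ P) :
    ∃ H : Subgroup G, H.FiniteIndex ∧ ∀ f₁ ∈ P, ∀ f₂ ∈ P,
      (∀ g ∈ H, f₁ g * f₂ g = 0) → (∀ g ∈ H, f₁ g = 0) ∨ (∀ g ∈ H, f₂ g = 0) := by
  have hN : IsNoetherianRing P := isNoetherianRing_of_fg hfg
  have hmax := set_has_maximal_iff_noetherian.mpr hN
    {I | ∃ H : Subgroup G, H.FiniteIndex ∧ I = vanIdeal P (H : Set G)}
    ⟨_, ⊤, inferInstance, rfl⟩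
  obtain ⟨_, ⟨H, hH, rfl⟩, hm⟩ := hmax
  have hdense : ∀ K : Subgroup G, K.FiniteIndex → K ≤ H →
      vanIdeal P (K : Set G) = vanIdeal P (H : Set G) := by
    intro K hK hKH
    have hle : vanIdeal P (H : Set G) ≤ vanIdeal P (K : Set G) := fun f hf g hg => hf g (hKH hg)
    by_contra hne
    exact hm _ ⟨K, hK, rfl⟩ (lt_of_le_of_ne hle (Ne.symm hne))
  refine ⟨H, hH, ?_⟩
  let ev : P →+* ℝ := (Pi.evalRingHom (fun _ : G => ℝ) 1).comp P.val.toRingHom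
  have hev : ∀ f : P, ev f = f.1 1 := fun f => rfl
  have hm1 : (RingHom.ker ev).IsPrime := RingHom.ker_isPrime ev
  have hle1 : vanIdeal P (H : Set G) ≤ RingHom.ker ev := by
    intro f hf
    rw [RingHom.mem_ker, hev]
    exact hf 1 H.one_mem
  obtain ⟨p, hp, hp1⟩ := Ideal.exists_minimalPrimes_le hle1
  let r := rtr P htr
  have hrr : ∀ a b : G, ∀ f : P, r a (r b f) = r (a * b) f := by
    intro a b f; apply Subtype.ext; funext g
    change f.1 (g * a * b) = f.1 (g * (a * b)); rw [mul_assoc]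
  have hr1 : ∀ f : P, r 1 f = f := by
    intro f; apply Subtype.ext; funext g
    change f.1 (g * 1) = f.1 g; rw [mul_one]
  have hrI : ∀ h ∈ H, ∀ f ∈ vanIdeal P (H : Set G), r h f ∈ vanIdeal P (H : Set G) := by
    intro h hh f hf g hg
    exact hf (g * h) (H.mul_mem hg hh)
  have hprime : p.IsPrime := hp.1.1
  have hmin : ∀ h ∈ H, p.comap (r h) ∈ (vanIdeal P (H : Set G)).minimalPrimes := by
    intro h hh
    refine ⟨⟨Ideal.comap_isPrime _ _, fun f hf => hp.1.2 (hrI h hh f hf)⟩, ?_⟩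
    rintro q ⟨hq, hq2⟩ hqle f hf
    have h3 : q.comap (r h⁻¹) ≤ p := by
      intro f hf
      have := hqle hf
      rw [Ideal.mem_comap, hrr] at this
      simpa [hr1] using this
    have h4 := hp.2 ⟨Ideal.comap_isPrime (r h⁻¹) q,
      fun f hf => hq2 (hrI _ (H.inv_mem hh) f hf)⟩ h3
    have h5 := h4 hf
    rw [Ideal.mem_comap, hrr] at h5
    simpa [hr1] using h5
  let K : Subgroup G :=
    { carrier := {h | h ∈ H ∧ p.comap (r h) = p}
      one_mem' := ⟨H.one_mem, by ext f; rw [Ideal.mem_comap, hr1]⟩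
      mul_mem' := by
        rintro a b ⟨ha, ha'⟩ ⟨hb, hb'⟩
        refine ⟨H.mul_mem ha hb, ?_⟩
        ext f
        rw [Ideal.mem_comap, ← hrr, ← Ideal.mem_comap, ha', ← Ideal.mem_comap, hb']
      inv_mem' := by
        rintro a ⟨ha, ha'⟩
        refine ⟨H.inv_mem ha, ?_⟩
        ext f
        rw [Ideal.mem_comap]
        conv_lhs => rw [← ha', Ideal.mem_comap, hrr]
        simp [hr1] }
  have hKfi : K.FiniteIndex := by
    refine finiteIndex_of_map (H := H) (fun h => p.comap (r h⁻¹)) ?_ ?_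
    · refine ((vanIdeal P (H : Set G)).finite_minimalPrimes_of_isNoetherianRing).subset ?_
      rintro _ ⟨h, hh, rfl⟩
      exact hmin _ (H.inv_mem hh)
    · intro a ha b hb hab
      refine ⟨H.mul_mem (H.inv_mem ha) hb, ?_⟩
      ext f
      rw [Ideal.mem_comap, ← hrr, ← Ideal.mem_comap]
      have : p.comap (r a⁻¹) = p.comap (r b⁻¹) := hab
      rw [this, Ideal.mem_comap, hrr]
      simp [hr1]
  have hpI : p ≤ vanIdeal P (H : Set G) := by
    rw [← hdense K hKfi (fun x hx => hx.1)]
    intro f hf g hg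
    have h1 : r g f ∈ p := by
      rw [← Ideal.mem_comap, hg.2]; exact hf
    have h2 := hp1 h1
    rw [RingHom.mem_ker, hev] at h2
    have : f.1 (1 * g) = 0 := h2
    simpa using this
  have hIp : vanIdeal P (H : Set G) = p := le_antisymm hp.1.2 hpI
  intro f₁ h₁ f₂ h₂ hprod
  have hmem : (⟨f₁, h₁⟩ * ⟨f₂, h₂⟩ : P) ∈ p := by
    rw [← hIp]; exact hprod
  rcases hprime.mem_or_mem hmem with h | h
  · left; rw [← hIp] at h; exact h
  · right; rw [← hIp] at h; exact h

end Irr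

/-! ### Affine crystallographic data -/

abbrev V3 := Fin 3 → ℝ
abbrev M3 := Matrix (Fin 3) (Fin 3) ℝ

theorem mulVec_bound (M : M3) : ∃ C : ℝ, 0 ≤ C ∧ ∀ x : V3, ‖M *ᵥ x‖ ≤ C * ‖x‖ :=
  ⟨‖(Matrix.mulVecLin M).toContinuousLinearMap‖, norm_nonneg _,
    fun x => (Matrix.mulVecLin M).toContinuousLinearMap.le_opNorm x⟩

structure Crys (G : Type) [Group G] where
  L : G →* M3
  b : G → V3
  b_mul : ∀ g h, b (g * h) = L g *ᵥ b h + b g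
  faithful : ∀ g, L g = 1 → b g = 0 → g = 1
  proper : ∀ R : ℝ, {g | ∃ x : V3, ‖x‖ ≤ R ∧ ‖L g *ᵥ x + b g‖ ≤ R}.Finite
  cocompact : ∃ R : ℝ, ∀ x : V3, ∃ g, ‖L g *ᵥ x + b g‖ ≤ R

namespace Crys
variable {G : Type} [Group G] (c : Crys G)

def act (g : G) (x : V3) : V3 := c.L g *ᵥ x + c.b g

theorem act_def (g : G) (x : V3) : c.act g x = c.L g *ᵥ x + c.b g := rfl

theorem b_one : c.b 1 = 0 := by
  have h := c.b_mul 1 1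
  rw [mul_one, map_one, Matrix.one_mulVec] at h
  simpa using h

theorem act_one (x : V3) : c.act 1 x = x := by simp [act, c.b_one]

theorem act_mul (g h : G) (x : V3) : c.act (g * h) x = c.act g (c.act h x) := by
  simp only [act, c.b_mul, map_mul, Matrix.mulVec_add, Matrix.mulVec_mulVec, add_assoc]

theorem act_inv_act (g : G) (x : V3) : c.act g⁻¹ (c.act g x) = x := by
  rw [← act_mul, inv_mul_cancel, act_one]

theorem act_act_inv (g : G) (x : V3) : c.act g (c.act g⁻¹ x) = x := by
  rw [← act_mul, mul_inv_cancel, act_one]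

theorem L_inv_mul (g : G) : c.L g⁻¹ * c.L g = 1 := by rw [← map_mul, inv_mul_cancel, map_one]
theorem L_mul_inv (g : G) : c.L g * c.L g⁻¹ = 1 := by rw [← map_mul, mul_inv_cancel, map_one]

theorem b_inv (g : G) : c.b g⁻¹ = -(c.L g⁻¹ *ᵥ c.b g) := by
  have h := c.b_mul g⁻¹ g
  rw [inv_mul_cancel, b_one] at h
  exact eq_neg_of_add_eq_zero_right h.symm

theorem det_ne (g : G) : (c.L g).det ≠ 0 := by
  intro h
  have := congrArg Matrix.det (c.L_mul_inv g)
  rw [Matrix.det_mul, h] at this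
  simp at this

theorem continuous_act (g : G) : Continuous (c.act g) := by
  unfold act
  fun_prop

/-- the generating functions -/
def gens : Set (G → ℝ) :=
  (Set.range fun p : Fin 3 × Fin 3 => fun g => c.L g p.1 p.2) ∪
  (Set.range fun i : Fin 3 => fun g => c.b g i) ∪
  (Set.range fun p : Fin 3 × Fin 3 => fun g => c.L g⁻¹ p.1 p.2) ∪
  (Set.range fun i : Fin 3 => fun g => c.b g⁻¹ i)

theorem gens_finite : c.gens.Finite :=
  (((Set.finite_range _).union (Set.finite_range _)).union (Set.finite_range _)).union
    (Set.finite_range _)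

def Pol : Subalgebra ℝ (G → ℝ) := Algebra.adjoin ℝ c.gens

theorem Pol_fg : c.Pol.FG := by
  refine ⟨c.gens_finite.toFinset, ?_⟩
  simp [Pol]

theorem pol_L (i j : Fin 3) : (fun g => c.L g i j) ∈ c.Pol :=
  Algebra.subset_adjoin (Or.inl (Or.inl (Or.inl ⟨(i, j), rfl⟩)))
theorem pol_b (i : Fin 3) : (fun g => c.b g i) ∈ c.Pol :=
  Algebra.subset_adjoin (Or.inl (Or.inl (Or.inr ⟨i, rfl⟩)))
theorem pol_Li (i j : Fin 3) : (fun g => c.L g⁻¹ i j) ∈ c.Pol :=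
  Algebra.subset_adjoin (Or.inl (Or.inr ⟨(i, j), rfl⟩))
theorem pol_bi (i : Fin 3) : (fun g => c.b g⁻¹ i) ∈ c.Pol :=
  Algebra.subset_adjoin (Or.inr ⟨i, rfl⟩)

theorem pol_const (r : ℝ) : (fun _ : G => r) ∈ c.Pol := c.Pol.algebraMap_mem r
theorem pol_add {f₁ f₂ : G → ℝ} (h₁ : f₁ ∈ c.Pol) (h₂ : f₂ ∈ c.Pol) :
    (fun g => f₁ g + f₂ g) ∈ c.Pol := c.Pol.add_mem h₁ h₂
theorem pol_sub {f₁ f₂ : G → ℝ} (h₁ : f₁ ∈ c.Pol) (h₂ : f₂ ∈ c.Pol) :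
    (fun g => f₁ g - f₂ g) ∈ c.Pol := c.Pol.sub_mem h₁ h₂
theorem pol_neg {f₁ : G → ℝ} (h₁ : f₁ ∈ c.Pol) :
    (fun g => - f₁ g) ∈ c.Pol := c.Pol.neg_mem h₁
theorem pol_mul {f₁ f₂ : G → ℝ} (h₁ : f₁ ∈ c.Pol) (h₂ : f₂ ∈ c.Pol) :
    (fun g => f₁ g * f₂ g) ∈ c.Pol := c.Pol.mul_mem h₁ h₂
theorem pol_sum {ι : Type*} (s : Finset ι) {f : ι → G → ℝ} (h : ∀ i, f i ∈ c.Pol) :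
    (fun g => ∑ i ∈ s, f i g) ∈ c.Pol := by
  have : (fun g => ∑ i ∈ s, f i g) = ∑ i ∈ s, f i := by
    funext g; simp
  rw [this]
  exact c.Pol.sum_mem (fun i _ => h i)

def IsPolMap (φ : G → G) : Prop := ∀ f ∈ c.Pol, (fun g => f (φ g)) ∈ c.Pol

theorem isPolMap_of_gens {φ : G → G} (h1 : ∀ i j, (fun g => c.L (φ g) i j) ∈ c.Pol)
    (h2 : ∀ i, (fun g => c.b (φ g) i) ∈ c.Pol)
    (h3 : ∀ i j, (fun g => c.L (φ g)⁻¹ i j) ∈ c.Pol)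
    (h4 : ∀ i, (fun g => c.b (φ g)⁻¹ i) ∈ c.Pol) : c.IsPolMap φ := by
  intro f hf
  induction hf using Algebra.adjoin_induction with
  | mem x hx =>
    rcases hx with ((⟨p, rfl⟩ | ⟨p, rfl⟩) | ⟨p, rfl⟩) | ⟨p, rfl⟩
    · exact h1 _ _
    · exact h2 _
    · exact h3 _ _
    · exact h4 _
  | algebraMap r => exact c.pol_const r
  | add x y _ _ hx hy => exact c.pol_add hx hy
  | mul x y _ _ hx hy => exact c.pol_mul hx hy

theorem isPolMap_id : c.IsPolMap (fun g => g) := fun _ hf => hf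
theorem isPolMap_const (h : G) : c.IsPolMap (fun _ => h) := fun _ _ => c.pol_const _
theorem isPolMap_inv {φ : G → G} (h : c.IsPolMap φ) : c.IsPolMap (fun g => (φ g)⁻¹) := by
  apply c.isPolMap_of_gens
  · intro i j; exact h _ (c.pol_Li i j)
  · intro i; exact h _ (c.pol_bi i)
  · intro i j; simp only [inv_inv]; exact h _ (c.pol_L i j)
  · intro i; simp only [inv_inv]; exact h _ (c.pol_b i)

theorem isPolMap_mul {φ ψ : G → G} (h : c.IsPolMap φ) (h' : c.IsPolMap ψ) :
    c.IsPolMap (fun g => φ g * ψ g) := by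
  apply c.isPolMap_of_gens
  · intro i j
    simp only [map_mul, Matrix.mul_apply]
    exact c.pol_sum _ fun k => c.pol_mul (h _ (c.pol_L i k)) (h' _ (c.pol_L k j))
  · intro i
    simp only [c.b_mul, Pi.add_apply, Matrix.mulVec, dotProduct]
    exact c.pol_add (c.pol_sum _ fun k => c.pol_mul (h _ (c.pol_L i k)) (h' _ (c.pol_b k)))
      (h _ (c.pol_b i))
  · intro i j
    simp only [_root_.mul_inv_rev, map_mul, Matrix.mul_apply]
    exact c.pol_sum _ fun k => c.pol_mul (h' _ (c.pol_Li i k)) (h _ (c.pol_Li k j))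
  · intro i
    simp only [_root_.mul_inv_rev, c.b_mul, Pi.add_apply, Matrix.mulVec, dotProduct]
    exact c.pol_add (c.pol_sum _ fun k => c.pol_mul (h' _ (c.pol_Li i k)) (h _ (c.pol_bi k)))
      (h' _ (c.pol_bi i))

theorem isPolMap_comm (h : G) : c.IsPolMap (fun g => g * h * g⁻¹ * h⁻¹) :=
  c.isPolMap_mul (c.isPolMap_mul (c.isPolMap_mul c.isPolMap_id (c.isPolMap_const h))
    (c.isPolMap_inv c.isPolMap_id)) (c.isPolMap_const _)

/-- irreducibility -/
def Irr : Prop := ∀ f₁ ∈ c.Pol, ∀ f₂ ∈ c.Pol, (∀ g, f₁ g * f₂ g = 0) →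
  (∀ g, f₁ g = 0) ∨ (∀ g, f₂ g = 0)

variable {c}

theorem Irr.prod (hI : c.Irr) {ι : Type*} (s : Finset ι) (f : ι → G → ℝ)
    (hf : ∀ i ∈ s, f i ∈ c.Pol) (h : ∀ g, ∏ i ∈ s, f i g = 0) : ∃ i ∈ s, ∀ g, f i g = 0 := by
  classical
  induction s using Finset.induction_on with
  | empty => simp at h
  | insert a s ha ih =>
    have hp : (fun g => ∏ i ∈ s, f i g) ∈ c.Pol := by
      have : (fun g => ∏ i ∈ s, f i g) = ∏ i ∈ s, f i := by funext g; simp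
      rw [this]
      exact c.Pol.prod_mem fun i hi => hf i (Finset.mem_insert_of_mem hi)
    rcases hI (f a) (hf a (Finset.mem_insert_self _ _)) _ hp (fun g => by
      have := h g; rwa [Finset.prod_insert ha] at this) with h1 | h1
    · exact ⟨a, Finset.mem_insert_self _ _, h1⟩
    · obtain ⟨i, hi, hi2⟩ := ih (fun i hi => hf i (Finset.mem_insert_of_mem hi)) h1
      exact ⟨i, Finset.mem_insert_of_mem hi, hi2⟩

/-- A finite cover of `G` by zero sets has a full member. -/
theorem Irr.cover (hI : c.Irr) {ι : Type*} {s : Set ι} (hs : s.Finite) (F : ι → Set (G → ℝ))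
    (hF : ∀ i ∈ s, ∀ f ∈ F i, f ∈ c.Pol) (h : ∀ g, ∃ i ∈ s, ∀ f ∈ F i, f g = 0) :
    ∃ i ∈ s, ∀ f ∈ F i, ∀ g, f g = 0 := by
  by_contra hcon
  push Not at hcon
  choose! f hf g hg using hcon
  obtain ⟨i, hi, hi2⟩ := hI.prod hs.toFinset f
    (fun i hi => hF i (by simpa using hi) _ (hf i (by simpa using hi)))
    (fun g => by
      obtain ⟨i, hi, hi2⟩ := h g
      exact Finset.prod_eq_zero (i := i) (by simpa using hi) (hi2 _ (hf i hi)))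
  exact hg i (by simpa using hi) (hi2 _)

/-- a polynomial function with values in a finite set whenever another one is nonzero -/
theorem Irr.finite_values (hI : c.Irr) {f d : G → ℝ} (hf : f ∈ c.Pol) (hd : d ∈ c.Pol)
    {T : Set ℝ} (hT : T.Finite) (h : ∀ g, d g ≠ 0 → f g ∈ T) :
    (∀ g, d g = 0) ∨ ∃ r ∈ T, ∀ g, f g = r := by
  have h1 := hI.cover (ι := Option ℝ) (s := insert none (some '' T))
    ((hT.image some).insert none)
    (fun o => match o with | none => {d} | some r => {fun g => f g - r}) (by
      rintro (_ | r) _ f' hf'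
      · rw [Set.mem_singleton_iff.mp hf']; exact hd
      · rw [Set.mem_singleton_iff.mp hf']; exact c.pol_sub hf (c.pol_const r)) (by
      intro g
      by_cases hg : d g = 0
      · refine ⟨none, Set.mem_insert _ _, ?_⟩
        intro f' hf'
        rw [Set.mem_singleton_iff.mp hf']; exact hg
      · refine ⟨some (f g), Set.mem_insert_of_mem _ ⟨_, h g hg, rfl⟩, ?_⟩
        intro f' hf'
        rw [Set.mem_singleton_iff.mp hf']; simp)
  obtain ⟨i, hi, hi2⟩ := h1
  rcases i with _ | r
  · left; exact hi2 d rfl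
  · right
    refine ⟨r, ?_, fun g => ?_⟩
    · simpa using hi
    · have := hi2 (fun g => f g - r) rfl g
      exact sub_eq_zero.mp this

theorem Irr.finite_values' (hI : c.Irr) {f : G → ℝ} (hf : f ∈ c.Pol)
    {T : Set ℝ} (hT : T.Finite) (h : ∀ g, f g ∈ T) : ∀ g, f g = f 1 := by
  rcases hI.finite_values hf (c.pol_const 1) hT (fun g _ => h g) with h1 | ⟨r, _, h2⟩
  · simpa using h1 1
  · intro g; rw [h2, h2]

variable (c)

/-- Noetherian property for common zeros. -/
theorem noe_family {ι : Type*} (F : ι → G → ℝ) (hF : ∀ i, F i ∈ c.Pol) :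
    ∃ s : Finset ι, ∀ g, (∀ i ∈ s, F i g = 0) → ∀ i, F i g = 0 := by
  have hN : IsNoetherianRing c.Pol := isNoetherianRing_of_fg c.Pol_fg
  let F' : ι → c.Pol := fun i => ⟨F i, hF i⟩
  have hfg : (Ideal.span (Set.range F')).FG := IsNoetherian.noetherian _
  obtain ⟨t, ht, hts⟩ := Submodule.fg_span_iff_fg_span_finset_subset _ |>.mp hfg
  classical
  by_cases hne : Nonempty ι
  swap
  · exact ⟨∅, fun g _ i => absurd ⟨i⟩ hne⟩
  choose! k hk using ht
  refine ⟨t.image k, fun g hg i => ?_⟩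
  have h1 : F' i ∈ Ideal.span (t : Set c.Pol) := by
    have : F' i ∈ Ideal.span (Set.range F') := Ideal.subset_span ⟨i, rfl⟩
    rw [Ideal.span, hts] at this
    exact this
  have h2 : Ideal.span (t : Set c.Pol) ≤ vanIdeal c.Pol {g} := by
    rw [Ideal.span_le]
    intro f hf g' hg'
    rw [Set.mem_singleton_iff.mp hg', ← hk hf]
    exact hg _ (Finset.mem_image_of_mem _ hf)
  exact h2 h1 g rfl

theorem fg_group (c : Crys G) : Group.FG G := by
  obtain ⟨R, hR⟩ := c.cocompact
  let S := {g | ∃ x : V3, ‖x‖ ≤ R + 1 ∧ ‖c.act g x‖ ≤ R + 1}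
  have hS : S.Finite := c.proper (R + 1)
  let H := Subgroup.closure S
  suffices H = ⊤ by
    rw [Group.fg_iff]
    exact ⟨S, this, hS⟩
  by_contra hne
  obtain ⟨g₀, hg₀⟩ : ∃ g, g ∉ H := by
    by_contra hcon
    push Not at hcon
    exact hne ((Subgroup.eq_top_iff' H).mpr hcon)
  let W : G → Set V3 := fun g => {x | ‖c.act g x‖ < R + 1}
  have hW : ∀ g, IsOpen (W g) := fun g =>
    isOpen_lt (c.continuous_act g).norm continuous_const
  let U1 : Set V3 := ⋃ g ∈ H, W g
  let U2 : Set V3 := ⋃ g ∉ H, W g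
  have hU1 : IsOpen U1 := isOpen_biUnion fun g _ => hW g
  have hU2 : IsOpen U2 := isOpen_iUnion fun g => isOpen_iUnion fun _ => hW g
  have hcov : ∀ x, x ∈ U1 ∨ x ∈ U2 := by
    intro x
    obtain ⟨g, hg⟩ := hR x
    have hx : x ∈ W g := by
      change ‖c.act g x‖ < R + 1
      exact lt_of_le_of_lt hg (by linarith)
    by_cases h : g ∈ H
    · left; exact Set.mem_biUnion h hx
    · right; exact Set.mem_iUnion.mpr ⟨g, Set.mem_iUnion.mpr ⟨h, hx⟩⟩
  have hdisj : ∀ x, x ∈ U1 → x ∈ U2 → False := by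
    intro x h1 h2
    obtain ⟨h, hh, hx⟩ := Set.mem_iUnion₂.mp h1
    obtain ⟨g, hg, hx'⟩ := Set.mem_iUnion₂.mp h2
    have : g * h⁻¹ ∈ S := by
      refine ⟨c.act h x, le_of_lt hx, ?_⟩
      rw [c.act_mul, c.act_inv_act]; exact le_of_lt hx'
    apply hg
    have h3 := H.mul_mem (Subgroup.subset_closure this) hh
    simpa using h3
  have hR0 : 0 < R + 1 := by
    obtain ⟨g, hg⟩ := hR 0
    have := norm_nonneg (c.L g *ᵥ (0 : V3) + c.b g)
    linarith
  have hcl : IsClopen U1 := by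
    refine ⟨?_, hU1⟩
    have : U1 = U2ᶜ := by
      ext x
      constructor
      · intro h h'; exact hdisj x h h'
      · intro h; exact (hcov x).resolve_right h
    rw [this]; exact hU2.isClosed_compl
  have h01 : (0 : V3) ∈ U1 := by
    refine Set.mem_biUnion H.one_mem ?_
    change ‖c.act 1 0‖ < R + 1
    rw [c.act_one]; simpa using hR0
  have huniv := hcl.eq_univ ⟨_, h01⟩
  refine hdisj (c.act g₀⁻¹ 0) (huniv ▸ Set.mem_univ _) ?_
  refine Set.mem_iUnion.mpr ⟨g₀, Set.mem_iUnion.mpr ⟨hg₀, ?_⟩⟩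
  change ‖c.act g₀ _‖ < R + 1
  rw [c.act_act_inv]; simpa using hR0

theorem act_bound (g : G) (R : ℝ) : ∃ R', ∀ x : V3, ‖x‖ ≤ R → ‖c.act g x‖ ≤ R' := by
  obtain ⟨C, hC, h⟩ := mulVec_bound (c.L g)
  refine ⟨C * R + ‖c.b g‖, fun x hx => ?_⟩
  exact (norm_add_le _ _).trans (add_le_add ((h x).trans (mul_le_mul_of_nonneg_left hx hC)) le_rfl)

/-- restriction to a finite index subgroup -/
def restrict (H : Subgroup G) [H.FiniteIndex] : Crys H where
  L := c.L.comp H.subtype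
  b := fun h => c.b h
  b_mul := fun g h => c.b_mul g h
  faithful := fun g h1 h2 => Subtype.ext (c.faithful g h1 h2)
  proper := fun R => by
    have h := (c.proper R).preimage (f := fun h : H => (h : G)) Subtype.val_injective.injOn
    exact h
  cocompact := by
    obtain ⟨R, hR⟩ := c.cocompact
    have : Finite (G ⧸ H) := Subgroup.finite_quotient_of_finiteIndex
    choose B hB using fun q : G ⧸ H => c.act_bound (Quotient.out q)⁻¹ R
    obtain ⟨M, hM⟩ := (Set.finite_range B).bddAbove
    refine ⟨M, fun x => ?_⟩
    obtain ⟨g, hg⟩ := hR x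
    refine ⟨⟨(Quotient.out (g : G ⧸ H))⁻¹ * g, ?_⟩, ?_⟩
    · rw [← QuotientGroup.eq]
      exact QuotientGroup.out_eq' _
    · change ‖c.act ((Quotient.out (g : G ⧸ H))⁻¹ * g) x‖ ≤ M
      rw [c.act_mul]
      exact (hB (g : G ⧸ H) _ hg).trans (hM ⟨_, rfl⟩)

theorem restrict_pol (H : Subgroup G) [H.FiniteIndex] {f : H → ℝ} (hf : f ∈ (c.restrict H).Pol) :
    ∃ f' ∈ c.Pol, ∀ h : H, f' h = f h := by
  induction hf using Algebra.adjoin_induction with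
  | mem x hx =>
    rcases hx with ((⟨p, rfl⟩ | ⟨p, rfl⟩) | ⟨p, rfl⟩) | ⟨p, rfl⟩
    · exact ⟨_, c.pol_L p.1 p.2, fun _ => rfl⟩
    · exact ⟨_, c.pol_b p, fun _ => rfl⟩
    · exact ⟨_, c.pol_Li p.1 p.2, fun _ => rfl⟩
    · exact ⟨_, c.pol_bi p, fun _ => rfl⟩
  | algebraMap r => exact ⟨_, c.pol_const r, fun _ => rfl⟩
  | add x y _ _ hx hy =>
    obtain ⟨f1, h1, h1'⟩ := hx
    obtain ⟨f2, h2, h2'⟩ := hy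
    exact ⟨_, c.pol_add h1 h2, fun h => by simp [h1', h2']⟩
  | mul x y _ _ hx hy =>
    obtain ⟨f1, h1, h1'⟩ := hx
    obtain ⟨f2, h2, h2'⟩ := hy
    exact ⟨_, c.pol_mul h1 h2, fun h => by simp [h1', h2']⟩

theorem exists_irr_restrict : ∃ (H : Subgroup G) (_ : H.FiniteIndex), (c.restrict H).Irr := by
  obtain ⟨H, hH, h⟩ := exists_irr c.Pol c.Pol_fg (fun f hf h =>
    c.isPolMap_mul c.isPolMap_id (c.isPolMap_const h) f hf)
  refine ⟨H, hH, ?_⟩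
  intro f₁ h₁ f₂ h₂ hf
  obtain ⟨f1, h1, h1'⟩ := c.restrict_pol H h₁
  obtain ⟨f2, h2, h2'⟩ := c.restrict_pol H h₂
  rcases h f1 h1 f2 h2 (fun g hg => by
    have := hf ⟨g, hg⟩
    rwa [← h1', ← h2'] at this) with h3 | h3
  · left; intro g; rw [← h1']; exact h3 g g.2
  · right; intro g; rw [← h2']; exact h3 g g.2

/-- conjugation by a linear map -/
def conj (P Q : M3) (hPQ : P * Q = 1) : Crys G where
  L := { toFun := fun g => P * c.L g * Q
         map_one' := by rw [map_one, mul_one, hPQ]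
         map_mul' := fun g h => by
           have hQP : Q * P = 1 := mul_eq_one_comm.mp hPQ
           rw [map_mul]
           calc P * (c.L g * c.L h) * Q = P * c.L g * 1 * c.L h * Q := by noncomm_ring
             _ = P * c.L g * (Q * P) * c.L h * Q := by rw [hQP]
             _ = _ := by noncomm_ring }
  b := fun g => P *ᵥ c.b g
  b_mul := fun g h => by
    have hQP : Q * P = 1 := mul_eq_one_comm.mp hPQ
    change _ = (P * c.L g * Q) *ᵥ (P *ᵥ c.b h) + P *ᵥ c.b g
    rw [c.b_mul, Matrix.mulVec_add, Matrix.mulVec_mulVec, Matrix.mulVec_mulVec, mul_assoc _ Q P,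
      hQP, mul_one]
  faithful := fun g h1 h2 => by
    have hQP : Q * P = 1 := mul_eq_one_comm.mp hPQ
    apply c.faithful
    · have h3 : P * c.L g * Q = 1 := h1
      calc c.L g = (Q * P) * c.L g * (Q * P) := by rw [hQP]; simp
        _ = Q * (P * c.L g * Q) * P := by noncomm_ring
        _ = 1 := by rw [h3, mul_one, hQP]
    · have h3 : P *ᵥ c.b g = 0 := h2
      have := congrArg (fun v => Q *ᵥ v) h3
      simpa [Matrix.mulVec_mulVec, hQP] using this
  proper := fun R => by
    have hQP : Q * P = 1 := mul_eq_one_comm.mp hPQ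
    obtain ⟨C, hC, h⟩ := mulVec_bound Q
    refine (c.proper (C * R)).subset ?_
    rintro g ⟨x, hx, hgx⟩
    refine ⟨Q *ᵥ x, (h x).trans (mul_le_mul_of_nonneg_left hx hC), ?_⟩
    have e : c.L g *ᵥ Q *ᵥ x + c.b g = Q *ᵥ ((P * c.L g * Q) *ᵥ x + P *ᵥ c.b g) := by
      rw [Matrix.mulVec_add, Matrix.mulVec_mulVec, Matrix.mulVec_mulVec, Matrix.mulVec_mulVec, hQP,
        ← mul_assoc, ← mul_assoc, hQP, one_mul, Matrix.one_mulVec]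
    rw [e]
    exact (h _).trans (mul_le_mul_of_nonneg_left hgx hC)
  cocompact := by
    have hQP : Q * P = 1 := mul_eq_one_comm.mp hPQ
    obtain ⟨R, hR⟩ := c.cocompact
    obtain ⟨C, hC, h⟩ := mulVec_bound P
    refine ⟨C * R, fun x => ?_⟩
    obtain ⟨g, hg⟩ := hR (Q *ᵥ x)
    refine ⟨g, ?_⟩
    have e : (P * c.L g * Q) *ᵥ x + P *ᵥ c.b g = P *ᵥ (c.L g *ᵥ Q *ᵥ x + c.b g) := by
      rw [Matrix.mulVec_add, Matrix.mulVec_mulVec, Matrix.mulVec_mulVec, mul_assoc]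
    change ‖(P * c.L g * Q) *ᵥ x + P *ᵥ c.b g‖ ≤ _
    rw [e]
    exact (h _).trans (mul_le_mul_of_nonneg_left hg hC)

theorem conj_pol (P Q : M3) (hPQ : P * Q = 1) : (c.conj P Q hPQ).Pol ≤ c.Pol := by
  apply Algebra.adjoin_le
  intro f hf
  have hL : ∀ φ : G → G, c.IsPolMap φ → ∀ i j, (fun g => (P * c.L (φ g) * Q) i j) ∈ c.Pol := by
    intro φ hφ i j
    simp only [Matrix.mul_apply]
    exact c.pol_sum _ fun k => c.pol_mul (c.pol_sum _ fun l => c.pol_mul (c.pol_const _)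
      (hφ _ (c.pol_L l k))) (c.pol_const _)
  have hb : ∀ φ : G → G, c.IsPolMap φ → ∀ i, (fun g => (P *ᵥ c.b (φ g)) i) ∈ c.Pol := by
    intro φ hφ i
    simp only [Matrix.mulVec, dotProduct]
    exact c.pol_sum _ fun k => c.pol_mul (c.pol_const _) (hφ _ (c.pol_b k))
  rcases hf with ((⟨p, rfl⟩ | ⟨p, rfl⟩) | ⟨p, rfl⟩) | ⟨p, rfl⟩
  · exact hL _ c.isPolMap_id _ _
  · exact hb _ c.isPolMap_id _
  · exact hL _ (c.isPolMap_inv c.isPolMap_id) _ _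
  · exact hb _ (c.isPolMap_inv c.isPolMap_id) _

theorem conj_irr (P Q : M3) (hPQ : P * Q = 1) (h : c.Irr) : (c.conj P Q hPQ).Irr :=
  fun f₁ h₁ f₂ h₂ hf => h f₁ (c.conj_pol P Q hPQ h₁) f₂ (c.conj_pol P Q hPQ h₂) hf

@[simp] theorem conj_L (P Q : M3) (hPQ : P * Q = 1) (g : G) :
    (c.conj P Q hPQ).L g = P * c.L g * Q := rfl
@[simp] theorem conj_b (P Q : M3) (hPQ : P * Q = 1) (g : G) :
    (c.conj P Q hPQ).b g = P *ᵥ c.b g := rfl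

/-- A finite set meeting every conjugacy class of elements with fixed points. -/
theorem exists_fix_finite : ∃ F : Set G, F.Finite ∧
    ∀ g p, c.act g p = p → ∃ δ, δ * g * δ⁻¹ ∈ F := by
  obtain ⟨R, hR⟩ := c.cocompact
  refine ⟨_, c.proper R, fun g p hp => ?_⟩
  obtain ⟨δ, hδ⟩ := hR p
  refine ⟨δ, c.act δ p, hδ, ?_⟩
  change ‖c.act (δ * g * δ⁻¹) (c.act δ p)‖ ≤ R
  rw [c.act_mul, c.act_inv_act, c.act_mul, hp]
  exact hδ

theorem trace_conj (δ g : G) : (c.L (δ * g * δ⁻¹)).trace = (c.L g).trace := by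
  rw [map_mul, map_mul, Matrix.trace_mul_comm, ← mul_assoc, c.L_inv_mul, one_mul]

theorem pol_trace : (fun g => (c.L g).trace) ∈ c.Pol := by
  simp only [Matrix.trace, Matrix.diag]
  exact c.pol_sum _ fun i => c.pol_L i i

theorem exists_fixed_of_det (g : G) (h : (c.L g - 1).det ≠ 0) : ∃ p, c.act g p = p := by
  have hu : IsUnit (c.L g - 1).det := isUnit_iff_ne_zero.mpr h
  refine ⟨(c.L g - 1)⁻¹ *ᵥ (-c.b g), ?_⟩
  have h1 : (c.L g - 1) *ᵥ ((c.L g - 1)⁻¹ *ᵥ (-c.b g)) = -c.b g := by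
    rw [Matrix.mulVec_mulVec, Matrix.mul_nonsing_inv _ hu, Matrix.one_mulVec]
  rw [Matrix.sub_mulVec, Matrix.one_mulVec] at h1
  rw [act_def]
  rw [sub_eq_iff_eq_add] at h1
  rw [h1]; simp

theorem pol_det_sub_one : (fun g => (c.L g - 1).det) ∈ c.Pol := by
  have h : ∀ i j, (fun g => (c.L g - 1) i j) ∈ c.Pol := fun i j => by
    simp only [Matrix.sub_apply]
    exact c.pol_sub (c.pol_L i j) (c.pol_const _)
  simp only [Matrix.det_fin_three]
  exact c.pol_sub (c.pol_add (c.pol_add (c.pol_sub (c.pol_sub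
    (c.pol_mul (c.pol_mul (h _ _) (h _ _)) (h _ _))
    (c.pol_mul (c.pol_mul (h _ _) (h _ _)) (h _ _)))
    (c.pol_mul (c.pol_mul (h _ _) (h _ _)) (h _ _)))
    (c.pol_mul (c.pol_mul (h _ _) (h _ _)) (h _ _)))
    (c.pol_mul (c.pol_mul (h _ _) (h _ _)) (h _ _)))
    (c.pol_mul (c.pol_mul (h _ _) (h _ _)) (h _ _))

theorem trace_inv_fin3 (A B : M3) (h : A * B = 1) :
    2 * (A.det * B.trace) = A.trace ^ 2 - (A * A).trace := by
  have h1 : A.adjugate = A.det • B := by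
    calc A.adjugate = A.adjugate * (A * B) := by rw [h, mul_one]
      _ = A.det • B := by rw [← mul_assoc, Matrix.adjugate_mul]; simp
  have h2 : A.adjugate.trace = A.det * B.trace := by rw [h1, Matrix.trace_smul, smul_eq_mul]
  rw [← h2, Matrix.adjugate_fin_three]
  simp [Matrix.trace, Fin.sum_univ_three, Matrix.mul_apply]
  ring

theorem det_sub_one_fin3 (A B : M3) (h : A * B = 1) :
    (A - 1).det = A.det - A.det * B.trace + A.trace - 1 := by
  have h1 := trace_inv_fin3 A B h
  have h2 : A.det * B.trace = (A.trace ^ 2 - (A * A).trace) / 2 := by linarith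
  rw [h2]
  simp [Matrix.trace, Fin.sum_univ_three, Matrix.mul_apply, Matrix.det_fin_three]
  ring

/-- every linear part has the eigenvalue one -/
theorem eig_one (hI : c.Irr) (g : G) : (c.L g - 1).det = 0 := by
  obtain ⟨F, hF, h⟩ := c.exists_fix_finite
  rcases hI.finite_values c.pol_trace c.pol_det_sub_one (hF.image fun g => (c.L g).trace)
    (fun g hg => by
      obtain ⟨p, hp⟩ := c.exists_fixed_of_det g hg
      obtain ⟨δ, hδ⟩ := h g p hp
      exact ⟨_, hδ, c.trace_conj δ g⟩) with h1 | ⟨r, _, h2⟩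
  · exact h1 g
  · have h3 : r = 3 := by rw [← h2 1]; simp
    subst h3
    have ha := h2 g
    have hb := h2 g⁻¹
    have hc := h2 (g * g)
    rw [map_mul] at hc
    have h4 := trace_inv_fin3 _ _ (c.L_mul_inv g)
    have h5 := det_sub_one_fin3 _ _ (c.L_mul_inv g)
    rw [ha, hb, hc] at h4
    rw [ha, hb] at h5
    rw [h5]; linarith

end Crys
end FG3
end Part1

section Part2
open Matrix

namespace FG3

set_option linter.unusedSectionVars false

/-! ### Groups all of whose subgroups are finitely generated -/

def NoethG (G : Type*) [Group G] : Prop := ∀ K : Subgroup G, K.FG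

theorem subgroup_fg_iff {G : Type*} [Group G] (K : Subgroup G) :
    K.FG ↔ ∃ S : Set G, S.Finite ∧ Subgroup.closure S = K := by
  constructor
  · rintro ⟨S, hS⟩; exact ⟨S, S.finite_toSet, hS⟩
  · rintro ⟨S, hS, h⟩; exact ⟨hS.toFinset, by simpa using h⟩

theorem NoethG.of_ker {C A B : Type*} [Group C] [Group A] [Group B] (f : C →* A) (φ : C →* B)
    (hf : Function.Surjective f) (hk : φ.ker ≤ f.ker) (hB : NoethG B) : NoethG A := by
  intro K
  obtain ⟨S, hS, h⟩ := (subgroup_fg_iff _).mp (hB ((K.comap f).map φ))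
  have hS' : S ⊆ φ '' (K.comap f : Set C) := by
    rw [← Subgroup.coe_map, ← h]; exact Subgroup.subset_closure
  obtain ⟨T, hT, hTS⟩ := Set.subset_image_iff.mp hS'
  obtain ⟨T', hT'T, hT'f, hT'S⟩ : ∃ T' ⊆ T, T'.Finite ∧ φ '' T' = S := by
    rw [← hTS] at hS
    obtain ⟨T', h1, h2⟩ := Set.exists_subset_bijOn T φ
    refine ⟨T', h1, ?_, ?_⟩
    · exact Set.Finite.of_finite_image (hS.subset (Set.image_mono h1)) h2.injOn
    · rw [h2.image_eq, hTS]
  rw [subgroup_fg_iff]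
  refine ⟨f '' T', hT'f.image _, le_antisymm ?_ ?_⟩
  · rw [Subgroup.closure_le]
    rintro _ ⟨t, ht, rfl⟩
    exact hT (hT'T ht)
  · intro a ha
    obtain ⟨x, rfl⟩ := hf a
    have hx : φ x ∈ (K.comap f).map φ := ⟨x, ha, rfl⟩
    rw [← h, ← hT'S, ← MonoidHom.map_closure] at hx
    obtain ⟨s, hs, hsx⟩ := hx
    have h1 : s⁻¹ * x ∈ φ.ker := by
      rw [MonoidHom.mem_ker, map_mul, map_inv, hsx, inv_mul_cancel]
    have h2 := hk h1
    rw [MonoidHom.mem_ker, map_mul, map_inv] at h2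
    have h3 : f x = f s := (inv_mul_eq_one.mp h2).symm
    rw [h3, ← MonoidHom.map_closure]
    exact ⟨s, hs, rfl⟩

theorem NoethG.of_surjective {C A : Type*} [Group C] [Group A] (f : C →* A)
    (hf : Function.Surjective f) (hC : NoethG C) : NoethG A :=
  NoethG.of_ker f (MonoidHom.id C) hf (by
    intro x hx
    rw [MonoidHom.mem_ker] at hx
    have : x = 1 := hx
    rw [this]; exact one_mem _) hC

theorem NoethG.of_injective {C B : Type*} [Group C] [Group B] (f : C →* B)
    (hf : Function.Injective f) (hB : NoethG B) : NoethG C :=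
  NoethG.of_ker (MonoidHom.id C) f (fun x => ⟨x, rfl⟩) (by
    rw [(MonoidHom.ker_eq_bot_iff f).mpr hf]; exact bot_le) hB

theorem NoethG.of_extension {G Q : Type*} [Group G] [Group Q] (f : G →* Q) (N : Subgroup G)
    (hN : f.ker ≤ N) (h1 : NoethG N) (h2 : NoethG Q) : NoethG G := by
  intro K
  obtain ⟨S, hS, h⟩ := (subgroup_fg_iff _).mp (h2 (K.map f))
  have hS' : S ⊆ f '' (K : Set G) := by
    rw [← Subgroup.coe_map, ← h]; exact Subgroup.subset_closure
  obtain ⟨T, hT, hTf, hTS⟩ : ∃ T ⊆ (K : Set G), T.Finite ∧ f '' T = S := by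
    obtain ⟨T, hT, hTS⟩ := Set.subset_image_iff.mp hS'
    rw [← hTS] at hS
    obtain ⟨T', h1, h2⟩ := Set.exists_subset_bijOn T f
    refine ⟨T', h1.trans hT, ?_, ?_⟩
    · exact Set.Finite.of_finite_image (hS.subset (Set.image_mono h1)) h2.injOn
    · rw [h2.image_eq, hTS]
  obtain ⟨S', hS'f, h'⟩ := (subgroup_fg_iff _).mp (h1 (K.subgroupOf N))
  have h'' : Subgroup.closure (N.subtype '' S') = K ⊓ N := by
    rw [← MonoidHom.map_closure, h']
    rw [Subgroup.subgroupOf_map_subtype]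
  rw [subgroup_fg_iff]
  refine ⟨T ∪ N.subtype '' S', hTf.union (hS'f.image _), le_antisymm ?_ ?_⟩
  · rw [Subgroup.closure_union, h'', sup_le_iff, Subgroup.closure_le]
    exact ⟨hT, inf_le_left⟩
  · intro x hx
    have h3 : f x ∈ K.map f := ⟨x, hx, rfl⟩
    rw [← h, ← hTS, ← MonoidHom.map_closure] at h3
    obtain ⟨s, hs, hsx⟩ := h3
    have h4 : s⁻¹ * x ∈ f.ker := by
      rw [MonoidHom.mem_ker, map_mul, map_inv, hsx, inv_mul_cancel]
    have hsK : s ∈ K := (Subgroup.closure_le K).mpr hT hs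
    have h5 : s⁻¹ * x ∈ K ⊓ N := ⟨K.mul_mem (K.inv_mem hsK) hx, hN h4⟩
    have h6 : x = s * (s⁻¹ * x) := by group
    rw [h6, Subgroup.closure_union, h'']
    exact Subgroup.mul_mem_sup hs h5

theorem NoethG.of_comm_fg {A : Type*} [Group A] (hcomm : ∀ a b : A, a * b = b * a)
    (h : Group.FG A) : NoethG A := by
  let : CommGroup A := { (inferInstance : Group A) with mul_comm := hcomm }
  intro K
  have h1 : AddGroup.FG (Additive A) := inferInstance
  have h2 : Module.Finite ℤ (Additive A) := Module.Finite.iff_addGroup_fg.mpr h1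
  have h3 : IsNoetherian ℤ (Additive A) := isNoetherian_of_isNoetherianRing_of_finite ℤ _
  have h4 := h3.noetherian (AddSubgroup.toIntSubmodule (Subgroup.toAddSubgroup K))
  rw [Submodule.fg_iff_addSubgroup_fg] at h4
  rw [Subgroup.fg_iff_add_fg]
  simpa using h4

theorem NoethG.fg {G : Type*} [Group G] (h : NoethG G) : Group.FG G := ⟨h ⊤⟩

theorem nil_noeth (G : Type*) [Group G] [Group.IsNilpotent G]
    (hZ : NoethG (Subgroup.center G))
    (hF : ∀ k, ∃ F : Set G, F.Finite ∧ ∀ g,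
      (∀ f ∈ F, g * f * g⁻¹ * f⁻¹ ∈ Subgroup.upperCentralSeries G k) →
        g ∈ Subgroup.upperCentralSeries G (k + 1)) : NoethG G := by
  revert hZ hF
  refine Group.nilpotent_center_quotient_ind (P := fun G _ _ =>
    NoethG (Subgroup.center G) → (∀ k, ∃ F : Set G, F.Finite ∧ ∀ g,
      (∀ f ∈ F, g * f * g⁻¹ * f⁻¹ ∈ Subgroup.upperCentralSeries G k) →
        g ∈ Subgroup.upperCentralSeries G (k + 1)) → NoethG G) G ?_ ?_
  · intro G _ _ _ _ K
    rw [Subsingleton.elim K ⊥]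
    exact Subgroup.FG.bot
  · intro G _ _ ih hZ hF
    have hq : NoethG (G ⧸ Subgroup.center G) := by
      apply ih
      · obtain ⟨F, hFf, hF1⟩ := hF 0
        let Q := QuotientGroup.mk' (Subgroup.center G)
        let C : Subgroup G := (Subgroup.center (G ⧸ Subgroup.center G)).comap Q
        have hC : ∀ g ∈ C, ∀ f : G, g * f * g⁻¹ * f⁻¹ ∈ Subgroup.center G := by
          intro g hg f
          have h1 : Q g ∈ Subgroup.center (G ⧸ Subgroup.center G) := hg
          have h2 := Subgroup.mem_center_iff.mp h1 (Q f)
          rw [← QuotientGroup.ker_mk' (Subgroup.center G), MonoidHom.mem_ker]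
          change Q _ = 1
          rw [map_mul, map_mul, map_mul, ← h2, map_inv, map_inv]
          group
        let φ : C →* (F → Subgroup.center G) :=
          { toFun := fun g f => ⟨g * f * (g : G)⁻¹ * (f : G)⁻¹, hC g g.2 f⟩
            map_one' := by funext f; apply Subtype.ext; simp
            map_mul' := by
              intro g h
              funext f
              apply Subtype.ext
              have hc := Subgroup.mem_center_iff.mp (hC h h.2 f)
              change (g * h : G) * f * (g * h : G)⁻¹ * (f : G)⁻¹ =
                ((g : G) * f * (g : G)⁻¹ * (f : G)⁻¹) * ((h : G) * f * (h : G)⁻¹ * (f : G)⁻¹)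
              rw [hc]
              calc (g * h : G) * f * (g * h : G)⁻¹ * (f : G)⁻¹
                  = g * ((h : G) * f * (h : G)⁻¹ * (f : G)⁻¹) * (f * (g : G)⁻¹ * (f : G)⁻¹) := by
                    group
                _ = _ := by rw [hc]; group }
        have hFfin : Finite F := hFf
        have hB : NoethG (F → Subgroup.center G) := by
          have : Group.FG (Subgroup.center G) := hZ.fg
          have h2 : Group.FG (F → Subgroup.center G) := inferInstance
          exact NoethG.of_comm_fg (fun a b => by
            funext i; exact Subtype.ext (Subgroup.mem_center_iff.mp (b i).2 (a i))) h2
        refine NoethG.of_ker (((Q.comp C.subtype)).codRestrict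
          (Subgroup.center (G ⧸ Subgroup.center G)) (fun g => g.2)) φ ?_ ?_ hB
        · rintro ⟨x, hx⟩
          obtain ⟨g, rfl⟩ := QuotientGroup.mk'_surjective _ x
          exact ⟨⟨g, hx⟩, rfl⟩
        · intro g hg
          rw [MonoidHom.mem_ker] at hg ⊢
          apply Subtype.ext
          change Q g = 1
          have h1 : (g : G) ∈ Subgroup.upperCentralSeries G 1 := by
            apply hF1
            intro f hf
            rw [Subgroup.upperCentralSeries_zero, Subgroup.mem_bot]
            have := congrArg Subtype.val (congrFun hg ⟨f, hf⟩)
            exact this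
          rw [Subgroup.upperCentralSeries_one] at h1
          rw [← MonoidHom.mem_ker]
          rw [QuotientGroup.ker_mk']
          exact h1
      · intro k
        obtain ⟨F, hFf, hF1⟩ := hF (k + 1)
        refine ⟨QuotientGroup.mk' (Subgroup.center G) '' F, hFf.image _, ?_⟩
        intro x hx
        obtain ⟨g, rfl⟩ := QuotientGroup.mk'_surjective _ x
        rw [← Subgroup.mem_comap, Subgroup.comap_upperCentralSeries_quotient_center]
        apply hF1
        intro f hf
        have := hx _ ⟨f, hf, rfl⟩
        rw [← map_inv, ← map_inv, ← map_mul, ← map_mul, ← map_mul, ← Subgroup.mem_comap,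
          Subgroup.comap_upperCentralSeries_quotient_center] at this
        exact this
    exact NoethG.of_extension (QuotientGroup.mk' (Subgroup.center G)) (Subgroup.center G)
      (by rw [QuotientGroup.ker_mk']) hZ hq

/-- A group with an injective proper homomorphism to a vector space is f.g. -/
theorem fg_of_proper_hom {A : Type*} [Group A] (hcomm : ∀ a b : A, a * b = b * a) {n : ℕ} (φ : A → (Fin n → ℝ))
    (hmul : ∀ a b, φ (a * b) = φ a + φ b) (hinj : ∀ a, φ a = 0 → a = 1)
    (hfin : ∀ R : ℝ, {a | ‖φ a‖ ≤ R}.Finite) : Group.FG A := by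
  let : CommGroup A := { (inferInstance : Group A) with mul_comm := hcomm }
  let ψ : Additive A →+ (Fin n → ℝ) := AddMonoidHom.mk' (fun a => φ a.toMul) (fun a b => hmul _ _)
  have hψ : Function.Injective ψ := by
    rw [injective_iff_map_eq_zero]
    intro a ha
    exact hinj _ ha
  let Λ : Submodule ℤ (Fin n → ℝ) := AddSubgroup.toIntSubmodule ψ.range
  have hd : DiscreteTopology Λ := by
    have hfinL : (Metric.closedBall (0 : Fin n → ℝ) 1 ∩ (Λ : Set (Fin n → ℝ))).Finite := by
      refine ((hfin 1).image φ).subset ?_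
      rintro x ⟨hx, ⟨a, rfl⟩⟩
      have hx' : ‖ψ a‖ ≤ 1 := by simpa using hx
      exact ⟨a.toMul, hx', rfl⟩
    rw [discreteTopology_iff_isOpen_singleton_zero, Metric.isOpen_singleton_iff]
    obtain ⟨ε, hε, h⟩ : ∃ ε > 0, ∀ y ∈ (Metric.closedBall (0 : Fin n → ℝ) 1 ∩
        (Λ : Set (Fin n → ℝ))) \ {0}, ε ≤ ‖y‖ := by
      have hf := hfinL.sdiff (t := {0})
      rcases ((Metric.closedBall (0 : Fin n → ℝ) 1 ∩
        (Λ : Set (Fin n → ℝ))) \ {0}).eq_empty_or_nonempty with h0 | h0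
      · exact ⟨1, one_pos, by rw [h0]; simp⟩
      · obtain ⟨y, hy, hy2⟩ := Set.exists_min_image _ (fun y => ‖y‖) hf h0
        exact ⟨‖y‖, norm_pos_iff.mpr hy.2, hy2⟩
    refine ⟨min ε 1, lt_min hε one_pos, ?_⟩
    rintro ⟨y, hy⟩ hd
    by_contra hne
    have hd' : ‖y‖ < min ε 1 := by simpa [dist_eq_norm] using hd
    have := h y ⟨⟨by simpa using (lt_of_lt_of_le hd' (min_le_right _ _)).le, hy⟩, fun h0 =>
      hne (Subtype.ext h0)⟩
    exact absurd (lt_of_lt_of_le hd' (min_le_left _ _)) (not_lt.mpr this)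
  have hfinite : Module.Finite ℤ Λ := inferInstance
  let e : Additive A →ₗ[ℤ] Λ := ψ.rangeRestrict.toIntLinearMap
  have he : Function.Injective e := by
    intro a b hab
    exact hψ (congrArg Subtype.val hab)
  have hA : Module.Finite ℤ (Additive A) := Module.Finite.of_injective e he
  have := Module.Finite.iff_addGroup_fg.mp hA
  exact GroupFG.iff_add_fg.mpr this

/-! ### Unitriangular elements -/

structure Uni (M : M3) : Prop where
  h00 : M 0 0 = 1
  h11 : M 1 1 = 1
  h22 : M 2 2 = 1
  h10 : M 1 0 = 0
  h20 : M 2 0 = 0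
  h21 : M 2 1 = 0

namespace Crys
variable {G : Type} [Group G] (c : Crys G)

section
variable {g h : G} (hg : Uni (c.L g)) (hh : Uni (c.L h))
include hg hh

theorem uni01 : c.L (g * h) 0 1 = c.L g 0 1 + c.L h 0 1 := by
  rw [map_mul, Matrix.mul_apply, Fin.sum_univ_three, hg.h00, hh.h11, hh.h21]; ring
theorem uni12 : c.L (g * h) 1 2 = c.L g 1 2 + c.L h 1 2 := by
  rw [map_mul, Matrix.mul_apply, Fin.sum_univ_three, hg.h10, hg.h11, hh.h22]; ring
theorem uni02 : c.L (g * h) 0 2 = c.L g 0 2 + c.L h 0 2 + c.L g 0 1 * c.L h 1 2 := by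
  rw [map_mul, Matrix.mul_apply, Fin.sum_univ_three, hg.h00, hh.h22]; ring
theorem unib2 : c.b (g * h) 2 = c.b g 2 + c.b h 2 := by
  rw [c.b_mul]
  simp only [Pi.add_apply, Matrix.mulVec, dotProduct, Fin.sum_univ_three, hg.h20, hg.h21, hg.h22]
  ring
theorem unib1 : c.b (g * h) 1 = c.b g 1 + c.b h 1 + c.L g 1 2 * c.b h 2 := by
  rw [c.b_mul]
  simp only [Pi.add_apply, Matrix.mulVec, dotProduct, Fin.sum_univ_three, hg.h10, hg.h11]
  ring
theorem unib0 : c.b (g * h) 0 =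
    c.b g 0 + c.b h 0 + c.L g 0 1 * c.b h 1 + c.L g 0 2 * c.b h 2 := by
  rw [c.b_mul]
  simp only [Pi.add_apply, Matrix.mulVec, dotProduct, Fin.sum_univ_three, hg.h00]
  ring
end

theorem uni_eq_one {g : G} (hg : Uni (c.L g)) (h1 : c.L g 0 1 = 0) (h2 : c.L g 0 2 = 0)
    (h3 : c.L g 1 2 = 0) (h4 : c.b g 0 = 0) (h5 : c.b g 1 = 0) (h6 : c.b g 2 = 0) : g = 1 := by
  apply c.faithful
  · ext i j
    fin_cases i <;> fin_cases j <;> simp [hg.h00, hg.h11, hg.h22, hg.h10, hg.h20, hg.h21, h1, h2, h3]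
  · ext i; fin_cases i <;> simp [h4, h5, h6]

theorem solv_endgame (U : Subgroup G) (hN : ∀ g h : G, g * h * g⁻¹ * h⁻¹ ∈ U)
    (hU : ∀ u ∈ U, Uni (c.L u)) : Group.IsSolvable G ∧ NoethG G := by
  have hnorm : U.Normal := ⟨fun n hn g => by
    have := U.mul_mem (hN g n) hn
    simpa using this⟩
  have hU' : ∀ u : U, Uni (c.L u) := fun u => hU u u.2
  -- nilpotency
  have hnil : Group.IsNilpotent U := by
    refine ⟨⟨3, ?_⟩⟩
    rw [Subgroup.eq_top_iff']
    intro x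
    rw [Subgroup.mem_upperCentralSeries_succ_iff]
    intro y
    rw [Subgroup.mem_upperCentralSeries_succ_iff]
    intro z
    rw [Subgroup.mem_upperCentralSeries_succ_iff]
    intro w
    rw [Subgroup.upperCentralSeries_zero, Subgroup.mem_bot]
    set p := x * y * x⁻¹ * y⁻¹ with hp
    set q := p * z * p⁻¹ * z⁻¹ with hq
    set r := q * w * q⁻¹ * w⁻¹ with hr
    have e1 : ((p : U) : G) * ((y : G) * x) = (x : G) * y := by rw [hp]; push_cast; group
    have hyx : Uni (c.L ((y : G) * x)) := hU' (y * x)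
    have e2 : ((q : U) : G) * ((z : G) * p) = (p : G) * z := by rw [hq]; push_cast; group
    have hzp : Uni (c.L ((z : G) * p)) := hU' (z * p)
    have e3 : ((r : U) : G) * ((w : G) * q) = (q : G) * w := by rw [hr]; push_cast; group
    have hwq : Uni (c.L ((w : G) * q)) := hU' (w * q)
    have p01 : c.L p 0 1 = 0 := by
      have h := congrArg (fun t => c.L t 0 1) e1
      rw [c.uni01 (hU' p) (hyx), c.uni01 (hU' x) (hU' y), c.uni01 (hU' y) (hU' x)] at h
      linarith
    have p12 : c.L p 1 2 = 0 := by
      have h := congrArg (fun t => c.L t 1 2) e1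
      rw [c.uni12 (hU' p) (hyx), c.uni12 (hU' x) (hU' y), c.uni12 (hU' y) (hU' x)] at h
      linarith
    have pb2 : c.b p 2 = 0 := by
      have h := congrArg (fun t => c.b t 2) e1
      rw [c.unib2 (hU' p) (hyx), c.unib2 (hU' x) (hU' y), c.unib2 (hU' y) (hU' x)] at h
      linarith
    have q01 : c.L q 0 1 = 0 := by
      have h := congrArg (fun t => c.L t 0 1) e2
      rw [c.uni01 (hU' q) (hzp), c.uni01 (hU' z) (hU' p), c.uni01 (hU' p) (hU' z)] at h
      linarith
    have q12 : c.L q 1 2 = 0 := by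
      have h := congrArg (fun t => c.L t 1 2) e2
      rw [c.uni12 (hU' q) (hzp), c.uni12 (hU' z) (hU' p), c.uni12 (hU' p) (hU' z)] at h
      linarith
    have qb2 : c.b q 2 = 0 := by
      have h := congrArg (fun t => c.b t 2) e2
      rw [c.unib2 (hU' q) (hzp), c.unib2 (hU' z) (hU' p), c.unib2 (hU' p) (hU' z)] at h
      linarith
    have q02 : c.L q 0 2 = 0 := by
      have h := congrArg (fun t => c.L t 0 2) e2
      rw [c.uni02 (hU' q) (hzp), c.uni02 (hU' z) (hU' p),
        c.uni02 (hU' p) (hU' z), c.uni12 (hU' z) (hU' p), p01, p12, q01] at h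
      linarith
    have qb1 : c.b q 1 = 0 := by
      have h := congrArg (fun t => c.b t 1) e2
      rw [c.unib1 (hU' q) (hzp), c.unib1 (hU' z) (hU' p),
        c.unib1 (hU' p) (hU' z), pb2, p12, q12] at h
      linarith
    have r01 : c.L r 0 1 = 0 := by
      have h := congrArg (fun t => c.L t 0 1) e3
      rw [c.uni01 (hU' r) (hwq), c.uni01 (hU' w) (hU' q), c.uni01 (hU' q) (hU' w)] at h
      linarith
    have r12 : c.L r 1 2 = 0 := by
      have h := congrArg (fun t => c.L t 1 2) e3
      rw [c.uni12 (hU' r) (hwq), c.uni12 (hU' w) (hU' q), c.uni12 (hU' q) (hU' w)] at h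
      linarith
    have rb2 : c.b r 2 = 0 := by
      have h := congrArg (fun t => c.b t 2) e3
      rw [c.unib2 (hU' r) (hwq), c.unib2 (hU' w) (hU' q), c.unib2 (hU' q) (hU' w)] at h
      linarith
    have r02 : c.L r 0 2 = 0 := by
      have h := congrArg (fun t => c.L t 0 2) e3
      rw [c.uni02 (hU' r) (hwq), c.uni02 (hU' w) (hU' q),
        c.uni02 (hU' q) (hU' w), q01, q12, r01] at h
      linarith
    have rb1 : c.b r 1 = 0 := by
      have h := congrArg (fun t => c.b t 1) e3
      rw [c.unib1 (hU' r) (hwq), c.unib1 (hU' w) (hU' q),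
        c.unib1 (hU' q) (hU' w), qb2, q12, r12] at h
      linarith
    have rb0 : c.b r 0 = 0 := by
      have h := congrArg (fun t => c.b t 0) e3
      rw [c.unib0 (hU' r) (hwq), c.unib0 (hU' w) (hU' q),
        c.unib0 (hU' q) (hU' w), qb2, qb1, q01, q02, r01, r02] at h
      linarith
    exact Subtype.ext (c.uni_eq_one (hU' r) r01 r02 r12 rb0 rb1 rb2)
  -- the centre
  have hZ : NoethG (Subgroup.center U) := by
    have hcomm : ∀ a b : Subgroup.center U, a * b = b * a := fun a b =>
      Subtype.ext (Subgroup.mem_center_iff.mp b.2 a)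
    apply NoethG.of_comm_fg hcomm
    let φ : Subgroup.center U → (Fin 6 → ℝ) := fun u =>
      ![c.L (u : U) 0 1, c.L (u : U) 1 2, c.b (u : U) 2,
        c.L (u : U) 0 2 - 1 / 2 * (c.L (u : U) 0 1 * c.L (u : U) 1 2),
        c.b (u : U) 1 - 1 / 2 * (c.L (u : U) 1 2 * c.b (u : U) 2),
        c.b (u : U) 0 - 1 / 2 * (c.L (u : U) 0 1 * c.b (u : U) 1 + c.L (u : U) 0 2 * c.b (u : U) 2)
          + 1 / 3 * (c.L (u : U) 0 1 * c.L (u : U) 1 2 * c.b (u : U) 2)]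
    refine fg_of_proper_hom hcomm φ ?_ ?_ ?_
    · rintro ⟨u, hu⟩ ⟨v, hv⟩
      have huv : (v : G) * u = (u : G) * v := congrArg Subtype.val (Subgroup.mem_center_iff.mp hu v)
      have r1 : c.L u 0 1 * c.L v 1 2 = c.L v 0 1 * c.L u 1 2 := by
        have h := congrArg (fun t => c.L t 0 2) huv
        beta_reduce at h
        rw [c.uni02 (hU' u) (hU' v), c.uni02 (hU' v) (hU' u)] at h
        linarith
      have r2 : c.L u 1 2 * c.b v 2 = c.L v 1 2 * c.b u 2 := by
        have h := congrArg (fun t => c.b t 1) huv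
        beta_reduce at h
        rw [c.unib1 (hU' u) (hU' v), c.unib1 (hU' v) (hU' u)] at h
        linarith
      have r3 : c.L u 0 1 * c.b v 1 + c.L u 0 2 * c.b v 2 =
          c.L v 0 1 * c.b u 1 + c.L v 0 2 * c.b u 2 := by
        have h := congrArg (fun t => c.b t 0) huv
        beta_reduce at h
        rw [c.unib0 (hU' u) (hU' v), c.unib0 (hU' v) (hU' u)] at h
        linarith
      have s1 := c.uni01 (hU' u) (hU' v)
      have s2 := c.uni12 (hU' u) (hU' v)
      have s3 := c.unib2 (hU' u) (hU' v)
      have s4 := c.uni02 (hU' u) (hU' v)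
      have s5 := c.unib1 (hU' u) (hU' v)
      have s6 := c.unib0 (hU' u) (hU' v)
      ext i
      fin_cases i
      · simp [φ, -map_mul, s1]
      · simp [φ, -map_mul, s2]
      · simp [φ, -map_mul, s3]
      · simp [φ, -map_mul, s1, s2, s4]
        linear_combination (1 / 2) * r1
      · simp [φ, -map_mul, s2, s3, s5]
        linear_combination (1 / 2) * r2
      · simp [φ, -map_mul, s1, s2, s3, s4, s5, s6]
        linear_combination (1 / 2) * r3 + (-1/6) * c.L u 0 1 * r2 - (1/3) * c.b u 2 * r1
          - (1/6) * c.b v 2 * r1 - (1/3) * c.L v 0 1 * r2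
    · rintro ⟨u, hu⟩ h
      have h0 := congrFun h 0
      have h1 := congrFun h 1
      have h2 := congrFun h 2
      have h3 := congrFun h 3
      have h4 := congrFun h 4
      have h5 := congrFun h 5
      simp [φ] at h0 h1 h2 h3 h4 h5
      rw [h0] at h3 h5
      rw [h2] at h4 h5
      have h3' : c.L u 0 2 = 0 := by linarith
      have h4' : c.b u 1 = 0 := by linarith
      have h5' : c.b u 0 = 0 := by linarith
      have := c.uni_eq_one (hU' u) h0 h3' h1 h5' h4' h2
      exact Subtype.ext (Subtype.ext this)
    · intro R
      let E : (Fin 6 → ℝ) → V3 := fun l =>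
        ![l 5 + 1 / 2 * (l 0 * (l 4 + 1 / 2 * (l 1 * l 2)) + (l 3 + 1 / 2 * (l 0 * l 1)) * l 2)
          - 1 / 3 * (l 0 * l 1 * l 2), l 4 + 1 / 2 * (l 1 * l 2), l 2]
      have hE : Continuous E := by
        refine continuous_pi fun i => ?_
        fin_cases i
        · change Continuous fun l : Fin 6 → ℝ => l 5 + 1 / 2 * (l 0 * (l 4 + 1 / 2 * (l 1 * l 2))
            + (l 3 + 1 / 2 * (l 0 * l 1)) * l 2) - 1 / 3 * (l 0 * l 1 * l 2)
          fun_prop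
        · change Continuous fun l : Fin 6 → ℝ => l 4 + 1 / 2 * (l 1 * l 2)
          fun_prop
        · change Continuous fun l : Fin 6 → ℝ => l 2
          fun_prop
      have hEφ : ∀ u, E (φ u) = c.b (u : U) := by
        intro u
        ext i
        fin_cases i
        · simp [E, φ]; ring
        · simp [E, φ]
        · simp [E, φ]
      obtain ⟨B, hB⟩ := ((isCompact_closedBall (0 : Fin 6 → ℝ) R).image hE).isBounded.exists_norm_le
      have hfin := c.proper (max B 0)
      refine Set.Finite.subset (hfin.preimage (f := fun u : Subgroup.center U => ((u : U) : G))
        (Subtype.val_injective.comp Subtype.val_injective).injOn) ?_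
      intro u hu
      refine ⟨0, by simp, ?_⟩
      rw [Matrix.mulVec_zero, zero_add]
      refine le_trans (hB _ ⟨φ u, by simpa using hu, hEφ u⟩) (le_max_left _ _)
  -- finite centralizer families
  have hF : ∀ k, ∃ F : Set U, F.Finite ∧ ∀ g,
      (∀ f ∈ F, g * f * g⁻¹ * f⁻¹ ∈ Subgroup.upperCentralSeries U k) →
        g ∈ Subgroup.upperCentralSeries U (k + 1) := by
    have key : ∀ k, ∃ 𝓕 : Set (G → ℝ), (∀ f ∈ 𝓕, f ∈ c.Pol) ∧
        ∀ u : U, u ∈ Subgroup.upperCentralSeries U k ↔ ∀ f ∈ 𝓕, f u = 0 := by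
      intro k
      induction k with
      | zero =>
        refine ⟨(Set.range fun p : Fin 3 × Fin 3 => fun g => c.L g p.1 p.2 - (1 : M3) p.1 p.2) ∪
          (Set.range fun i => fun g => c.b g i), ?_, ?_⟩
        · rintro _ (⟨p, rfl⟩ | ⟨i, rfl⟩)
          · exact c.pol_sub (c.pol_L _ _) (c.pol_const _)
          · exact c.pol_b i
        · intro u
          rw [Subgroup.upperCentralSeries_zero, Subgroup.mem_bot]
          constructor
          · rintro rfl _ (⟨p, rfl⟩ | ⟨i, rfl⟩)
            · simp
            · simp [c.b_one]
          · intro h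
            apply Subtype.ext
            apply c.faithful
            · ext i j
              exact sub_eq_zero.mp (h _ (Or.inl ⟨(i, j), rfl⟩))
            · ext i
              exact h _ (Or.inr ⟨i, rfl⟩)
      | succ k ih =>
        obtain ⟨𝓕, h1, h2⟩ := ih
        refine ⟨{f' | ∃ f ∈ 𝓕, ∃ v : U, f' = fun g => f (g * v * g⁻¹ * (v : G)⁻¹)}, ?_, ?_⟩
        · rintro _ ⟨f, hf, v, rfl⟩
          exact c.isPolMap_comm v f (h1 f hf)
        · intro u
          rw [Subgroup.mem_upperCentralSeries_succ_iff]
          constructor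
          · rintro h _ ⟨f, hf, v, rfl⟩
            exact (h2 _).mp (h v) f hf
          · intro h v
            rw [h2]
            intro f hf
            exact h _ ⟨f, hf, v, rfl⟩
    intro k
    obtain ⟨𝓕, h1, h2⟩ := key k
    obtain ⟨s, hs⟩ := c.noe_family (ι := 𝓕 × U)
      (fun p g => p.1.1 (g * p.2 * g⁻¹ * (p.2 : G)⁻¹)) (fun p => c.isPolMap_comm _ _ (h1 _ p.1.2))
    classical
    refine ⟨(s.image Prod.snd : Finset U), Finset.finite_toSet _, ?_⟩
    intro g hg
    rw [Subgroup.mem_upperCentralSeries_succ_iff]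
    intro v
    rw [h2]
    intro f hf
    refine hs g ?_ (⟨f, hf⟩, v)
    rintro ⟨f', v'⟩ hm
    have := hg v' (Finset.mem_coe.mpr (Finset.mem_image.mpr ⟨_, hm, rfl⟩))
    exact (h2 _).mp this f'.1 f'.2
  have hNU : NoethG U := nil_noeth U hZ hF
  have hsolvU : Group.IsSolvable U := inferInstance
  have hcomm : ∀ a b : G ⧸ U, a * b = b * a := by
    intro a b
    obtain ⟨g, rfl⟩ := QuotientGroup.mk'_surjective _ a
    obtain ⟨h, rfl⟩ := QuotientGroup.mk'_surjective _ b
    rw [← map_mul, ← map_mul]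
    change ((g * h : G) : G ⧸ U) = ((h * g : G) : G ⧸ U)
    rw [QuotientGroup.eq]
    have := hN h⁻¹ g⁻¹
    convert this using 1; group
  refine ⟨?_, ?_⟩
  · have hq : Group.IsSolvable (G ⧸ U) := Group.isSolvable_of_comm hcomm
    exact Group.isSolvable_of_ker_le_range U.subtype (QuotientGroup.mk' U) (by simp)
  · have hfg : Group.FG G := c.fg_group
    have hq : NoethG (G ⧸ U) := by
      have hfg' : Group.FG (G ⧸ U) := QuotientGroup.fg U
      exact NoethG.of_comm_fg hcomm hfg'
    exact NoethG.of_extension (QuotientGroup.mk' U) U (by simp) hNU hq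

end Crys
end FG3
end Part2

section Part3
open Matrix
set_option linter.all false
namespace FG3

abbrev M2 := Matrix (Fin 2) (Fin 2) ℝ

theorem par2 {v w : Fin 2 → ℝ} (hv : v ≠ 0) (h : v 0 * w 1 = v 1 * w 0) : ∃ r : ℝ, w = r • v := by
  by_cases h0 : v 0 = 0
  · have h1 : v 1 ≠ 0 := by
      intro h1; apply hv; ext i; fin_cases i <;> simp [h0, h1]
    refine ⟨w 1 / v 1, ?_⟩
    have hw : w 0 = 0 := by
      rw [h0] at h; simpa [h1] using h.symm
    ext i; fin_cases i
    · simp [h0, hw]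
    · simp; field_simp
  · refine ⟨w 0 / v 0, ?_⟩
    ext i; fin_cases i
    · simp; field_simp
    · simp; field_simp; linarith

theorem ker_par2 {n : M2} (hn : n ≠ 0) {v w : Fin 2 → ℝ} (hv : n *ᵥ v = 0) (hw : n *ᵥ w = 0) :
    v 0 * w 1 = v 1 * w 0 := by
  have h : ∀ i, n i 0 * v 0 + n i 1 * v 1 = 0 := fun i => by
    have := congrFun hv i; simpa [Matrix.mulVec, dotProduct, Fin.sum_univ_two] using this
  have h' : ∀ i, n i 0 * w 0 + n i 1 * w 1 = 0 := fun i => by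
    have := congrFun hw i; simpa [Matrix.mulVec, dotProduct, Fin.sum_univ_two] using this
  by_contra hne
  apply hn
  ext i j
  have e0 : n i 0 * (v 0 * w 1 - v 1 * w 0) = 0 := by linear_combination w 1 * h i - v 1 * h' i
  have e1 : n i 1 * (v 0 * w 1 - v 1 * w 0) = 0 := by linear_combination v 0 * h' i - w 0 * h i
  have hne' : v 0 * w 1 - v 1 * w 0 ≠ 0 := sub_ne_zero.mpr hne
  fin_cases j
  · simpa [hne'] using e0
  · simpa [hne'] using e1

theorem tr_nknk (n k ki : M2) (hk : k * ki = 1) (ht : n.trace = 0) (hd : n.det = 0)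
    (h : (n * k * n * ki).trace = 0) : n * k * n = 0 := by
  have hdet : k.det * ki.det = 1 := by rw [← det_mul, hk, det_one]
  have hkd : k.det ≠ 0 := left_ne_zero_of_mul_eq_one hdet
  have hadj : k.adjugate = k.det • ki := by
    calc k.adjugate = k.adjugate * (k * ki) := by rw [hk, mul_one]
    _ = k.det • ki := by rw [← mul_assoc, adjugate_mul, smul_mul_assoc, one_mul]
  have h2 : (n * k * n * k.adjugate).trace = 0 := by
    rw [hadj, mul_smul_comm, trace_smul, h, smul_zero]
  have e11 : n 1 1 = - n 0 0 := by
    rw [trace_fin_two] at ht; linarith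
  rw [det_fin_two, e11] at hd
  have h3 : (k * n).trace ^ 2 = 0 := by
    rw [← neg_eq_zero, ← h2]
    simp only [trace_fin_two, adjugate_fin_two, mul_apply, Fin.sum_univ_two, of_apply, cons_val_zero,
      cons_val_one, cons_val', cons_val_fin_one, e11]
    linear_combination (-(2*k 0 0 * k 1 1) + 2 * k 0 1 * k 1 0 + (k 0 0 + k 1 1) ^ 2) * hd
  have h4 : (k * n).trace = 0 := by simpa using h3
  have h5 : n * k * n = (k * n).trace • n := by
    ext i j
    simp only [trace_fin_two, mul_apply, Fin.sum_univ_two, Matrix.smul_apply, smul_eq_mul]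
    fin_cases i <;> fin_cases j <;> simp only [Fin.zero_eta, Fin.mk_one, e11]
    · linear_combination (-k 1 1) * hd
    · linear_combination (k 0 1) * hd
    · linear_combination (k 1 0) * hd
    · linear_combination (-k 0 0) * hd
  rw [h5, h4, zero_smul]

theorem not_ns {G : Type} [Group G] (A : G →* M2)
    (h : ∀ g h, (A (g * h * g⁻¹ * h⁻¹)).trace = 2) :
    (∃ v : Fin 2 → ℝ, v ≠ 0 ∧ ∀ g, ∃ r : ℝ, A g *ᵥ v = r • v) ∨
      ∀ g h, A (g * h * g⁻¹ * h⁻¹) = 1 := by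
  by_cases hc : ∀ g h, A (g * h * g⁻¹ * h⁻¹) = 1
  · exact Or.inr hc
  left
  push Not at hc
  obtain ⟨a, b, hc⟩ := hc
  set c := a * b * a⁻¹ * b⁻¹ with hcdef
  have hinv : ∀ g, A g * A g⁻¹ = 1 := fun g => by rw [← map_mul, mul_inv_cancel, map_one]
  have hdd : ∀ g, (A g).det * (A g⁻¹).det = 1 := fun g => by rw [← det_mul, hinv, det_one]
  have hcd : (A c).det = 1 := by
    rw [hcdef]; simp only [map_mul, det_mul]
    linear_combination (A b).det * (A b⁻¹).det * hdd a + hdd b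
  have hct : (A c).trace = 2 := h a b
  set n := A c - 1 with hn
  have hAc : A c = 1 + n := by rw [hn]; abel
  have hnt : n.trace = 0 := by rw [hn, trace_sub, hct]; simp
  have hnd : n.det = 0 := by
    rw [hn]; rw [det_fin_two] at hcd ⊢; rw [trace_fin_two] at hct
    simp; linear_combination hcd - hct
  have hnn : n * n = 0 := by
    have e11 : n 1 1 = - n 0 0 := by
      rw [trace_fin_two] at hnt; linarith
    rw [det_fin_two, e11] at hnd
    ext i j
    simp only [mul_apply, Fin.sum_univ_two]
    fin_cases i <;> fin_cases j <;> simp [e11]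
    · linear_combination -hnd
    · ring
    · ring
    · linear_combination -hnd
  have hne : n ≠ 0 := by rw [hn]; exact sub_ne_zero.mpr hc
  have hci : A c⁻¹ = 1 - n := by
    calc A c⁻¹ = (1 - n) * (A c * A c⁻¹) := by
          rw [← mul_assoc, hAc, sub_mul, one_mul, mul_add, hnn]; simp
    _ = 1 - n := by rw [hinv, mul_one]
  have key : ∀ k, n * A k * n = 0 := by
    intro k
    apply tr_nknk n (A k) (A k⁻¹) (hinv k) hnt hnd
    have h1 := h c k
    have h2 : A (c * k * c⁻¹ * k⁻¹) = 1 + n - A k * n * A k⁻¹ - n * A k * n * A k⁻¹ := by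
      rw [map_mul, map_mul, map_mul, hci, hAc]
      have := hinv k
      calc (1 + n) * A k * (1 - n) * A k⁻¹
          = (1 + n) * (A k * A k⁻¹) - A k * n * A k⁻¹ - n * A k * n * A k⁻¹ := by noncomm_ring
        _ = _ := by rw [this, mul_one]
    rw [h2, trace_sub, trace_sub, trace_add, hnt] at h1
    have h3 : (A k * n * A k⁻¹).trace = 0 := by
      rw [trace_mul_comm, ← mul_assoc]
      have : A k⁻¹ * A k = 1 := by rw [← map_mul, inv_mul_cancel, map_one]
      rw [this, one_mul, hnt]
    rw [h3] at h1
    simp at h1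
    linarith
  have hcol : ∃ j, n.col j ≠ 0 := by
    by_contra hcol
    push Not at hcol
    apply hne
    ext i j
    exact congrFun (hcol j) i
  obtain ⟨j, hj⟩ := hcol
  refine ⟨n.col j, hj, fun k => ?_⟩
  apply par2 hj
  apply ker_par2 hne
  · have : n.col j = n *ᵥ Pi.single j 1 := by simp
    rw [this, mulVec_mulVec, hnn, zero_mulVec]
  · have : n.col j = n *ᵥ Pi.single j 1 := by simp
    rw [this, mulVec_mulVec, mulVec_mulVec, key, zero_mulVec]


theorem solve2 (M : M2) (hd : M.det ≠ 0) (y : Fin 2 → ℝ) : ∃ x : Fin 2 → ℝ,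
    M 0 0 * x 0 + M 0 1 * x 1 = y 0 ∧ M 1 0 * x 0 + M 1 1 * x 1 = y 1 := by
  have h : M *ᵥ (M⁻¹ *ᵥ y) = y := by
    rw [mulVec_mulVec, mul_nonsing_inv _ (isUnit_iff_ne_zero.mpr hd), one_mulVec]
  refine ⟨M⁻¹ *ᵥ y, ?_, ?_⟩
  · have := congrFun h 0
    rw [Matrix.mulVec, dotProduct, Fin.sum_univ_two] at this; exact this
  · have := congrFun h 1
    rw [Matrix.mulVec, dotProduct, Fin.sum_univ_two] at this; exact this

theorem exists_basis_vec {n : ℕ} (i : Fin n) {v : Fin n → ℝ} (hv : v ≠ 0) :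
    ∃ P Q : Matrix (Fin n) (Fin n) ℝ, P * Q = 1 ∧ Q *ᵥ Pi.single i 1 = v := by
  obtain ⟨A, hA⟩ := SeparatingDual.exists_continuousLinearEquiv_apply_eq (R := ℝ)
    (x := (Pi.single i 1 : Fin n → ℝ)) (y := v) (by simp) hv
  refine ⟨LinearMap.toMatrix' A.toLinearEquiv.symm, LinearMap.toMatrix' A.toLinearEquiv, ?_, ?_⟩
  · rw [← LinearMap.toMatrix'_comp]; simp
  · rw [LinearMap.toMatrix'_mulVec]; exact hA

theorem Uni.mul {M N : M3} (hM : Uni M) (hN : Uni N) : Uni (M * N) := by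
  constructor <;> simp [mul_apply, Fin.sum_univ_three, hM.h00, hM.h11, hM.h22, hM.h10, hM.h20, hM.h21,
    hN.h00, hN.h11, hN.h22, hN.h10, hN.h20, hN.h21]

theorem Uni.inv {M N : M3} (hM : Uni M) (h : M * N = 1) : Uni N := by
  have e : ∀ i j, (M * N) i j = (1 : M3) i j := fun i j => by rw [h]
  simp only [mul_apply, Fin.sum_univ_three] at e
  have e20 := e 2 0
  have e21 := e 2 1
  have e22 := e 2 2
  have e10 := e 1 0
  have e11 := e 1 1
  have e00 := e 0 0
  simp only [hM.h00, hM.h11, hM.h22, hM.h10, hM.h20, hM.h21, one_apply] at e20 e21 e22 e10 e11 e00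
  simp at e20 e21 e22
  simp [e20, e21] at e10 e11
  simp [e20, e10] at e00
  exact ⟨e00, e11, e22, e10, e20, e21⟩

namespace Crys
variable {G : Type} [Group G] (c : Crys G)

theorem solv_of_comm_uni (h : ∀ g k, Uni (c.L (g * k * g⁻¹ * k⁻¹))) :
    Group.IsSolvable G ∧ NoethG G := by
  refine c.solv_endgame
    { carrier := {g | Uni (c.L g)}
      mul_mem' := fun {a b} ha hb => ?_
      one_mem' := ?_
      inv_mem' := fun {a} ha => ?_ } h (fun u hu => hu)
  · change Uni (c.L (a * b)); rw [map_mul]; exact Uni.mul ha hb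
  · change Uni (c.L 1); rw [map_one]; constructor <;> simp
  · change Uni (c.L a⁻¹); exact Uni.inv ha (c.L_mul_inv a)

theorem L_mul_apply (g h : G) (i j : Fin 3) :
    c.L (g * h) i j = c.L g i 0 * c.L h 0 j + c.L g i 1 * c.L h 1 j + c.L g i 2 * c.L h 2 j := by
  rw [map_mul, mul_apply, Fin.sum_univ_three]

theorem b_mul_apply (g h : G) (i : Fin 3) :
    c.b (g * h) i = c.L g i 0 * c.b h 0 + c.L g i 1 * c.b h 1 + c.L g i 2 * c.b h 2 + c.b g i := by
  rw [c.b_mul, Pi.add_apply, Matrix.mulVec, dotProduct, Fin.sum_univ_three]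

theorem act_apply (g : G) (x : V3) (i : Fin 3) :
    c.act g x i = c.L g i 0 * x 0 + c.L g i 1 * x 1 + c.L g i 2 * x 2 + c.b g i := by
  rw [act, Pi.add_apply, Matrix.mulVec, dotProduct, Fin.sum_univ_three]

theorem char_comm (χ : G → ℝ) (h1 : χ 1 = 1) (hm : ∀ g h, χ (g * h) = χ g * χ h) (g h : G) :
    χ (g * h * g⁻¹ * h⁻¹) = 1 := by
  have e1 : χ g * χ g⁻¹ = 1 := by rw [← hm, mul_inv_cancel, h1]
  have e2 : χ h * χ h⁻¹ = 1 := by rw [← hm, mul_inv_cancel, h1]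
  rw [hm, hm, hm]; linear_combination χ h * χ h⁻¹ * e1 + e2

theorem solv_tri (h10 : ∀ g, c.L g 1 0 = 0) (h20 : ∀ g, c.L g 2 0 = 0) (h21 : ∀ g, c.L g 2 1 = 0) :
    Group.IsSolvable G ∧ NoethG G := by
  refine c.solv_of_comm_uni fun g k => ⟨?_, ?_, ?_, h10 _, h20 _, h21 _⟩
  · exact char_comm (fun g => c.L g 0 0) (by simp) (fun g h => by simp [-map_mul, L_mul_apply, h10, h20]) g k
  · exact char_comm (fun g => c.L g 1 1) (by simp) (fun g h => by simp [-map_mul, L_mul_apply, h10, h21]) g k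
  · exact char_comm (fun g => c.L g 2 2) (by simp) (fun g h => by simp [-map_mul, L_mul_apply, h20, h21]) g k

/-! ### Invariant plane -/

def planeA (h0 : ∀ g, c.L g 2 0 = 0) (h1 : ∀ g, c.L g 2 1 = 0) : G →* M2 where
  toFun g := !![c.L g 0 0, c.L g 0 1; c.L g 1 0, c.L g 1 1]
  map_one' := by ext i j; fin_cases i <;> fin_cases j <;> simp
  map_mul' g h := by
    ext i j
    fin_cases i <;> fin_cases j <;> simp [-map_mul, L_mul_apply, h0, h1, mul_apply, Fin.sum_univ_two]

def lineA (h0 : ∀ g, c.L g 1 0 = 0) (h1 : ∀ g, c.L g 2 0 = 0) : G →* M2 where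
  toFun g := !![c.L g 1 1, c.L g 1 2; c.L g 2 1, c.L g 2 2]
  map_one' := by ext i j; fin_cases i <;> fin_cases j <;> simp
  map_mul' g h := by
    ext i j
    fin_cases i <;> fin_cases j <;> simp [-map_mul, L_mul_apply, h0, h1, mul_apply, Fin.sum_univ_two]

theorem solv_plane_of_not_ns (h0 : ∀ g, c.L g 2 0 = 0) (h1 : ∀ g, c.L g 2 1 = 0)
    (h : ∀ g k, ((c.planeA h0 h1) (g * k * g⁻¹ * k⁻¹)).trace = 2) :
    Group.IsSolvable G ∧ NoethG G := by
  rcases not_ns _ h with ⟨v, hv, hev⟩ | hcom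
  · obtain ⟨P, Q, hPQ, hQ⟩ := exists_basis_vec 0 hv
    have hQ0 : Q 0 0 = v 0 := by rw [← hQ]; simp
    have hQ1 : Q 1 0 = v 1 := by rw [← hQ]; simp
    have hPv : P *ᵥ v = Pi.single 0 1 := by rw [← hQ, mulVec_mulVec, hPQ, one_mulVec]
    have hP : P 1 0 * v 0 + P 1 1 * v 1 = 0 := by
      have := congrFun hPv 1
      rw [Matrix.mulVec, dotProduct, Fin.sum_univ_two] at this
      simpa using this
    have e : ∀ i j, (P * Q) i j = (1 : M2) i j := fun i j => by rw [hPQ]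
    have e00 := e 0 0
    have e01 := e 0 1
    have e10 := e 1 0
    have e11 := e 1 1
    simp only [mul_apply, Fin.sum_univ_two, one_apply] at e00 e01 e10 e11
    simp at e00 e01 e10 e11
    refine (c.conj !![P 0 0, P 0 1, 0; P 1 0, P 1 1, 0; 0, 0, 1]
      !![Q 0 0, Q 0 1, 0; Q 1 0, Q 1 1, 0; 0, 0, 1] ?_).solv_tri ?_ ?_ ?_
    · ext i j
      fin_cases i <;> fin_cases j <;> simp [mul_apply, Fin.sum_univ_three, e00, e01, e10, e11]
    · intro g
      obtain ⟨r, hr⟩ := hev g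
      have r0 := congrFun hr 0
      have r1 := congrFun hr 1
      simp only [Matrix.mulVec, dotProduct, Fin.sum_univ_two] at r0 r1
      simp [planeA] at r0 r1
      simp only [conj_L, mul_apply, Fin.sum_univ_three]
      simp [hQ0, hQ1]
      linear_combination P 1 0 * r0 + P 1 1 * r1 + r * hP
    · intro g
      simp only [conj_L, mul_apply, Fin.sum_univ_three]
      simp [h0, h1]
    · intro g
      simp only [conj_L, mul_apply, Fin.sum_univ_three]
      simp [h0, h1]
  · refine c.solv_of_comm_uni fun g k => ?_
    have := hcom g k
    have e : ∀ i j, c.planeA h0 h1 (g * k * g⁻¹ * k⁻¹) i j = (1 : M2) i j := fun i j => by rw [this]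
    have e00 := e 0 0
    have e10 := e 1 0
    have e11 := e 1 1
    simp [-map_mul, planeA] at e00 e10 e11
    refine ⟨e00, e11, ?_, e10, h0 _, h1 _⟩
    exact char_comm (fun g => c.L g 2 2) (by simp) (fun g h => by simp [-map_mul, L_mul_apply, h0, h1]) g k

theorem solv_line_of_not_ns (h0 : ∀ g, c.L g 1 0 = 0) (h1 : ∀ g, c.L g 2 0 = 0)
    (h : ∀ g k, ((c.lineA h0 h1) (g * k * g⁻¹ * k⁻¹)).trace = 2) :
    Group.IsSolvable G ∧ NoethG G := by
  rcases not_ns _ h with ⟨v, hv, hev⟩ | hcom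
  · obtain ⟨P, Q, hPQ, hQ⟩ := exists_basis_vec 0 hv
    have hQ0 : Q 0 0 = v 0 := by rw [← hQ]; simp
    have hQ1 : Q 1 0 = v 1 := by rw [← hQ]; simp
    have hPv : P *ᵥ v = Pi.single 0 1 := by rw [← hQ, mulVec_mulVec, hPQ, one_mulVec]
    have hP : P 1 0 * v 0 + P 1 1 * v 1 = 0 := by
      have := congrFun hPv 1
      rw [Matrix.mulVec, dotProduct, Fin.sum_univ_two] at this
      simpa using this
    have e : ∀ i j, (P * Q) i j = (1 : M2) i j := fun i j => by rw [hPQ]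
    have e00 := e 0 0
    have e01 := e 0 1
    have e10 := e 1 0
    have e11 := e 1 1
    simp only [mul_apply, Fin.sum_univ_two, one_apply] at e00 e01 e10 e11
    simp at e00 e01 e10 e11
    refine (c.conj !![1, 0, 0; 0, P 0 0, P 0 1; 0, P 1 0, P 1 1]
      !![1, 0, 0; 0, Q 0 0, Q 0 1; 0, Q 1 0, Q 1 1] ?_).solv_tri ?_ ?_ ?_
    · ext i j
      fin_cases i <;> fin_cases j <;> simp [mul_apply, Fin.sum_univ_three, e00, e01, e10, e11]
    · intro g
      simp only [conj_L, mul_apply, Fin.sum_univ_three]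
      simp [h0, h1]
    · intro g
      simp only [conj_L, mul_apply, Fin.sum_univ_three]
      simp [h0, h1]
    · intro g
      obtain ⟨r, hr⟩ := hev g
      have r0 := congrFun hr 0
      have r1 := congrFun hr 1
      simp only [Matrix.mulVec, dotProduct, Fin.sum_univ_two] at r0 r1
      simp [lineA] at r0 r1
      simp only [conj_L, mul_apply, Fin.sum_univ_three]
      simp [hQ0, hQ1]
      linear_combination P 1 0 * r0 + P 1 1 * r1 + r * hP
  · refine c.solv_of_comm_uni fun g k => ?_
    have := hcom g k
    have e : ∀ i j, c.lineA h0 h1 (g * k * g⁻¹ * k⁻¹) i j = (1 : M2) i j := fun i j => by rw [this]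
    have e00 := e 0 0
    have e10 := e 1 0
    have e11 := e 1 1
    simp [-map_mul, lineA] at e00 e10 e11
    refine ⟨?_, e00, e11, h0 _, h1 _, e10⟩
    exact char_comm (fun g => c.L g 0 0) (by simp) (fun g h => by simp [-map_mul, L_mul_apply, h0, h1]) g k

theorem det_comm {n : ℕ} (A : G →* Matrix (Fin n) (Fin n) ℝ) (g h : G) :
    (A (g * h * g⁻¹ * h⁻¹)).det = 1 :=
  char_comm (fun g => (A g).det) (by simp) (fun g h => by simp) g h

theorem det_sub_one2 (M : M2) : (M - 1).det = M.det - M.trace + 1 := by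
  rw [det_fin_two, det_fin_two, trace_fin_two]; simp; ring

/-- The plane case. -/
theorem plane_case (hI : c.Irr) (h0 : ∀ g, c.L g 2 0 = 0) (h1 : ∀ g, c.L g 2 1 = 0) :
    Group.IsSolvable G ∧ NoethG G := by
  apply c.solv_plane_of_not_ns h0 h1
  by_contra hNS
  push Not at hNS
  obtain ⟨α, β, hαβ⟩ := hNS
  set A := c.planeA h0 h1 with hA
  have htr : ∀ g, (c.L g).trace = (A g).trace + c.L g 2 2 := by
    intro g; simp [hA, planeA, trace_fin_three, trace_fin_two]
  have hlam : ∀ g, c.L g 2 2 = 1 := by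
    have hdet : ∀ g, (A g - 1).det * (c.L g 2 2 - 1) = 0 := by
      intro g
      rw [← c.eig_one hI g, det_fin_three, det_fin_two]
      simp [hA, planeA, h0, h1]
      ring
    have hp : (fun g => (A g - 1).det) ∈ c.Pol := by
      have : (fun g => (A g - 1).det) = fun g =>
          (c.L g 0 0 - 1) * (c.L g 1 1 - 1) - c.L g 0 1 * c.L g 1 0 := by
        ext g; rw [det_fin_two]; simp [hA, planeA]
      rw [this]
      exact c.pol_sub (c.pol_mul (c.pol_sub (c.pol_L _ _) (c.pol_const _))
        (c.pol_sub (c.pol_L _ _) (c.pol_const _))) (c.pol_mul (c.pol_L _ _) (c.pol_L _ _))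
    rcases hI _ hp _ (c.pol_sub (c.pol_L 2 2) (c.pol_const 1)) hdet with h | h
    · exfalso
      have := h (α * β * α⁻¹ * β⁻¹)
      rw [det_sub_one2, det_comm] at this
      apply hαβ; linarith
    · intro g; exact sub_eq_zero.mp (h g)
  obtain ⟨F, hF, hFc⟩ := c.exists_fix_finite
  have hb : ∀ g h, c.b (g * h) 2 = c.b g 2 + c.b h 2 := by
    intro g h; rw [b_mul_apply, h0, h1, hlam]; ring
  have hbc : c.b (α * β * α⁻¹ * β⁻¹) 2 = 0 := by
    have e1 := hb α α⁻¹
    have e2 := hb β β⁻¹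
    rw [mul_inv_cancel, c.b_one] at e1 e2
    simp only [hb]
    simp at e1 e2
    linarith
  have key : ∀ α, (c.L (α * β * α⁻¹ * β⁻¹)).trace ∈ insert 3 ((fun g => (c.L g).trace) '' F) := by
    intro α
    have hbc : c.b (α * β * α⁻¹ * β⁻¹) 2 = 0 := by
      have e1 := hb α α⁻¹
      have e2 := hb β β⁻¹
      rw [mul_inv_cancel, c.b_one] at e1 e2
      simp only [hb]
      simp at e1 e2
      linarith
    by_cases ht : (A (α * β * α⁻¹ * β⁻¹)).trace = 2
    · left
      rw [htr, ht, hlam]; norm_num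
    · right
      have hd : (A (α * β * α⁻¹ * β⁻¹) - 1).det ≠ 0 := by
        rw [det_sub_one2, det_comm]; intro h; apply ht; linarith
      set γ := α * β * α⁻¹ * β⁻¹ with hγ
      obtain ⟨x, hx0, hx1⟩ := solve2 _ hd ![-c.b γ 0, -c.b γ 1]
      obtain ⟨δ, hδ⟩ := hFc γ ![x 0, x 1, 0] (by
        simp [hA, planeA, -map_mul] at hx0 hx1
        ext i
        rw [act_apply]
        fin_cases i
        · simp; linarith
        · simp; linarith
        · simp [h0, h1, hbc])
      exact ⟨_, hδ, c.trace_conj δ γ⟩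
  have := hI.finite_values' (f := fun α => (c.L (α * β * α⁻¹ * β⁻¹)).trace)
    (c.isPolMap_comm β _ c.pol_trace) ((hF.image _).insert 3) key α
  simp only [one_mul, inv_one, mul_one, mul_inv_cancel, map_one] at this
  rw [htr, hlam] at this
  simp at this
  apply hαβ; rw [hA] at *; simp at this ⊢; linarith

end Crys
end FG3
end Part3

section Part4
open Matrix
set_option linter.all false
namespace FG3
namespace Crys
variable {G : Type} [Group G] (c : Crys G)

/-! ### Invariant line -/

theorem zpow_lin {f : G → ℝ} (n : G) (v : ℝ) (h1 : f 1 = 0) (h : ∀ g, f (n * g) = v + f g) (k : ℤ) :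
    f (n ^ k) = k * v := by
  have hp : ∀ k : ℕ, f (n ^ k) = k * v := by
    intro k
    induction k with
    | zero => simp [h1]
    | succ k ih => rw [pow_succ', h, ih]; push_cast; ring
  have hm : ∀ k : ℕ, f (n ^ (-(k : ℤ))) = -k * v := by
    intro k
    induction k with
    | zero => simp [h1]
    | succ k ih =>
      have := h (n ^ (-((k + 1 : ℕ) : ℤ)))
      rw [← _root_.zpow_one_add] at this
      have e : (1 : ℤ) + -((k + 1 : ℕ) : ℤ) = -(k : ℤ) := by push_cast; ring
      rw [e, ih] at this
      push_cast at this ⊢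
      linarith
  rcases Int.eq_nat_or_neg k with ⟨j, rfl | rfl⟩
  · rw [zpow_natCast, hp]; simp
  · rw [hm]; simp

theorem fixed_torsion {g : G} {x : V3} (h : c.act g x = x) : ∃ k : ℕ, 0 < k ∧ g ^ k = 1 := by
  have hp : ∀ k : ℕ, c.act (g ^ k) x = x := by
    intro k
    induction k with
    | zero => simp [c.act_one]
    | succ k ih => rw [pow_succ, c.act_mul, h, ih]
  have hfin : (Set.range fun k : ℕ => g ^ k).Finite := by
    refine (c.proper ‖x‖).subset ?_
    rintro _ ⟨k, rfl⟩
    refine ⟨x, le_rfl, ?_⟩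
    have := hp k
    rw [act] at this
    rw [this]
  have hni : ¬ Function.Injective fun k : ℕ => g ^ k := fun hi =>
    Set.infinite_range_of_injective hi hfin
  rw [injective_pow_iff_not_isOfFinOrder, not_not] at hni
  obtain ⟨n, hn, h1⟩ := isOfFinOrder_iff_pow_eq_one.mp hni
  exact ⟨n, hn, h1⟩

structure Line (c : Crys G) : Prop where
  hI : c.Irr
  h10 : ∀ g, c.L g 1 0 = 0
  h20 : ∀ g, c.L g 2 0 = 0
  h00 : ∀ g, c.L g 0 0 = 1
  ns : ∃ α β, (c.L (α * β * α⁻¹ * β⁻¹)).trace ≠ 3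

namespace Line
variable {c} (l : c.Line)
include l

theorem mul11 (g h : G) : c.L (g * h) 1 1 = c.L g 1 1 * c.L h 1 1 + c.L g 1 2 * c.L h 2 1 := by
  rw [L_mul_apply, l.h10]; ring
theorem mul12 (g h : G) : c.L (g * h) 1 2 = c.L g 1 1 * c.L h 1 2 + c.L g 1 2 * c.L h 2 2 := by
  rw [L_mul_apply, l.h10]; ring
theorem mul21 (g h : G) : c.L (g * h) 2 1 = c.L g 2 1 * c.L h 1 1 + c.L g 2 2 * c.L h 2 1 := by
  rw [L_mul_apply, l.h20]; ring
theorem mul22 (g h : G) : c.L (g * h) 2 2 = c.L g 2 1 * c.L h 1 2 + c.L g 2 2 * c.L h 2 2 := by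
  rw [L_mul_apply, l.h20]; ring
theorem mul01 (g h : G) : c.L (g * h) 0 1 =
    c.L h 0 1 + c.L g 0 1 * c.L h 1 1 + c.L g 0 2 * c.L h 2 1 := by
  rw [L_mul_apply, l.h00]; ring
theorem mul02 (g h : G) : c.L (g * h) 0 2 =
    c.L h 0 2 + c.L g 0 1 * c.L h 1 2 + c.L g 0 2 * c.L h 2 2 := by
  rw [L_mul_apply, l.h00]; ring
theorem mulb0 (g h : G) : c.b (g * h) 0 =
    c.b h 0 + c.L g 0 1 * c.b h 1 + c.L g 0 2 * c.b h 2 + c.b g 0 := by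
  rw [b_mul_apply, l.h00]; ring
theorem mulb1 (g h : G) : c.b (g * h) 1 =
    c.L g 1 1 * c.b h 1 + c.L g 1 2 * c.b h 2 + c.b g 1 := by
  rw [b_mul_apply, l.h10]; ring
theorem mulb2 (g h : G) : c.b (g * h) 2 =
    c.L g 2 1 * c.b h 1 + c.L g 2 2 * c.b h 2 + c.b g 2 := by
  rw [b_mul_apply, l.h20]; ring
theorem act0 (g : G) (x : V3) : c.act g x 0 =
    x 0 + c.L g 0 1 * x 1 + c.L g 0 2 * x 2 + c.b g 0 := by
  rw [act_apply, l.h00]; ring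
theorem act1 (g : G) (x : V3) : c.act g x 1 = c.L g 1 1 * x 1 + c.L g 1 2 * x 2 + c.b g 1 := by
  rw [act_apply, l.h10]; ring
theorem act2 (g : G) (x : V3) : c.act g x 2 = c.L g 2 1 * x 1 + c.L g 2 2 * x 2 + c.b g 2 := by
  rw [act_apply, l.h20]; ring

theorem tr (g : G) : (c.L g).trace = 1 + (c.lineA l.h10 l.h20 g).trace := by
  simp [trace_fin_three, trace_fin_two, lineA, l.h00]; ring

theorem A_comm_det (α β : G) : (c.lineA l.h10 l.h20 (α * β * α⁻¹ * β⁻¹)).det = 1 := det_comm _ _ _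

/-- Finiteness of commutator traces is impossible. -/
theorem comm_tr {T : Set ℝ} (hT : T.Finite)
    (h : ∀ α β, (c.L (α * β * α⁻¹ * β⁻¹)).trace ∈ T) : False := by
  obtain ⟨α, β, hαβ⟩ := l.ns
  have := l.hI.finite_values' (f := fun α => (c.L (α * β * α⁻¹ * β⁻¹)).trace)
    (c.isPolMap_comm β _ c.pol_trace) hT (fun α => h α β) α
  simp only [one_mul, inv_one, mul_one, mul_inv_cancel, map_one] at this
  apply hαβ; rw [this]; simp

/-- No common eigenvector in the quotient plane. -/
theorem no_eig {v : Fin 2 → ℝ} (hv : v ≠ 0) :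
    ∃ g, v 0 * (c.L g 2 1 * v 0 + c.L g 2 2 * v 1) ≠ v 1 * (c.L g 1 1 * v 0 + c.L g 1 2 * v 1) := by
  by_contra hcon
  push Not at hcon
  set A := c.lineA l.h10 l.h20 with hA
  have hmv : ∀ g, A g *ᵥ v = ![c.L g 1 1 * v 0 + c.L g 1 2 * v 1, c.L g 2 1 * v 0 + c.L g 2 2 * v 1] := by
    intro g
    ext i
    fin_cases i <;> simp [Matrix.mulVec, dotProduct, Fin.sum_univ_two, hA, lineA]
  have hr : ∀ g, ∃ r : ℝ, A g *ᵥ v = r • v := by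
    intro g
    apply par2 hv
    rw [hmv]; simpa using hcon g
  choose r hr using hr
  have hmul : ∀ g h, r (g * h) = r g * r h := by
    intro g h
    have e1 := hr (g * h)
    rw [map_mul, ← mulVec_mulVec, hr h, mulVec_smul, hr g, smul_smul] at e1
    have := smul_left_injective ℝ hv e1
    linarith
  have hone : r 1 = 1 := by
    have e1 := hr 1
    rw [map_one, one_mulVec] at e1
    have := smul_left_injective ℝ hv (a₁ := 1) (a₂ := r 1) (by simpa using e1)
    exact this.symm
  obtain ⟨α, β, hαβ⟩ := l.ns
  have h1 := hr (α * β * α⁻¹ * β⁻¹)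
  rw [char_comm r hone hmul, one_smul] at h1
  have hd : (A (α * β * α⁻¹ * β⁻¹) - 1).det = 0 := by
    apply Matrix.exists_mulVec_eq_zero_iff.mp
    exact ⟨v, hv, by rw [sub_mulVec, h1, one_mulVec, sub_self]⟩
  rw [det_sub_one2, l.A_comm_det] at hd
  apply hαβ
  rw [l.tr]
  linarith

/-- (i): no translations along the invariant line. -/
theorem no_trans {n : G} (hn : c.L n = 1) (h1 : c.b n 1 = 0) (h2 : c.b n 2 = 0) : n = 1 := by
  by_contra hne
  set t := c.b n 0 with ht
  have ht0 : t ≠ 0 := by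
    intro h0
    apply hne
    apply c.faithful _ hn
    ext i; fin_cases i
    · exact h0
    · exact h1
    · exact h2
  have hLk : ∀ k : ℤ, c.L (n ^ k) = 1 := by
    intro k
    rcases Int.eq_nat_or_neg k with ⟨j, rfl | rfl⟩
    · rw [zpow_natCast, map_pow, hn, one_pow]
    · have e := c.L_mul_inv (n ^ j)
      rw [map_pow, hn, one_pow, one_mul] at e
      rw [_root_.zpow_neg, zpow_natCast, e]
  have hb0 : ∀ k : ℤ, c.b (n ^ k) 0 = k * t := fun k =>
    zpow_lin (f := fun g => c.b g 0) n t (by simp [c.b_one])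
      (fun g => by simp only [l.mulb0, hn]; simp; ring) k
  have hb1 : ∀ k : ℤ, c.b (n ^ k) 1 = 0 := fun k => by
    have := zpow_lin (f := fun g => c.b g 1) n 0 (by simp [c.b_one])
      (fun g => by simp only [l.mulb1, hn]; simp [h1]) k
    simpa using this
  have hb2 : ∀ k : ℤ, c.b (n ^ k) 2 = 0 := fun k => by
    have := zpow_lin (f := fun g => c.b g 2) n 0 (by simp [c.b_one])
      (fun g => by simp only [l.mulb2, hn]; simp [h2]) k
    simpa using this
  obtain ⟨R, hR⟩ := c.cocompact
  have hfin := (c.proper (R + |t|)).image (fun g => (c.L g).trace)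
  have key : ∀ g, (c.lineA l.h10 l.h20 g - 1).det ≠ 0 →
      (c.L g).trace ∈ (fun g => (c.L g).trace) '' {g | ∃ x : V3, ‖x‖ ≤ R + |t| ∧ ‖c.L g *ᵥ x + c.b g‖ ≤ R + |t|} := by
    intro g hd
    obtain ⟨p, hp0, hp1⟩ := solve2 _ hd ![-c.b g 1, -c.b g 2]
    simp [lineA] at hp0 hp1
    set s := c.act g ![0, p 0, p 1] 0 with hs
    set k : ℤ := ⌊s / t⌋ with hk
    have hks : |s - k * t| ≤ |t| := by
      have h1 := Int.floor_le (s / t)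
      have h2 := Int.lt_floor_add_one (s / t)
      have : s - k * t = (s / t - k) * t := by field_simp
      rw [this, abs_mul]
      have : |s / t - k| ≤ 1 := by rw [abs_le]; constructor <;> linarith
      nlinarith [abs_nonneg t]
    set g' := n ^ (-k) * g with hg'
    have hg'x : c.act g' ![0, p 0, p 1] = ![s - k * t, p 0, p 1] := by
      rw [hg', c.act_mul]
      ext i
      rw [act, hLk, one_mulVec]
      fin_cases i
      · simp [hb0, ← hs, -_root_.zpow_neg]; ring
      · simp [hb1, l.act1, -_root_.zpow_neg]; linarith
      · simp [hb2, l.act2, -_root_.zpow_neg]; linarith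
    obtain ⟨δ, hδ⟩ := hR ![0, p 0, p 1]
    have htr : (c.L (δ * g' * δ⁻¹)).trace = (c.L g).trace := by
      rw [c.trace_conj, hg', map_mul, hLk, one_mul]
    refine ⟨δ * g' * δ⁻¹, ⟨c.act δ ![0, p 0, p 1], ?_, ?_⟩, htr⟩
    · exact hδ.trans (by linarith [abs_nonneg t])
    · change ‖c.act (δ * g' * δ⁻¹) _‖ ≤ _
      rw [c.act_mul, c.act_inv_act, c.act_mul, hg'x]
      have e : c.act δ ![s - k * t, p 0, p 1] = c.act δ ![0, p 0, p 1] + ![s - k * t, 0, 0] := by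
        ext i
        fin_cases i
        · simp [l.act0]; ring
        · simp [l.act1]
        · simp [l.act2]
      rw [e]
      refine (norm_add_le _ _).trans (add_le_add hδ ?_)
      rw [pi_norm_le_iff_of_nonneg (abs_nonneg _)]
      intro i
      fin_cases i
      · simpa using hks
      · simp
      · simp
  have hp : (fun g => (c.lineA l.h10 l.h20 g - 1).det) ∈ c.Pol := by
    have : (fun g => (c.lineA l.h10 l.h20 g - 1).det) = fun g =>
        (c.L g 1 1 - 1) * (c.L g 2 2 - 1) - c.L g 1 2 * c.L g 2 1 := by
      ext g; rw [det_fin_two]; simp [lineA]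
    rw [this]
    exact c.pol_sub (c.pol_mul (c.pol_sub (c.pol_L _ _) (c.pol_const _))
      (c.pol_sub (c.pol_L _ _) (c.pol_const _))) (c.pol_mul (c.pol_L _ _) (c.pol_L _ _))
  obtain ⟨α, β, hαβ⟩ := l.ns
  rcases l.hI.finite_values c.pol_trace hp hfin key with h | ⟨r, _, h⟩
  · have := h (α * β * α⁻¹ * β⁻¹)
    rw [det_sub_one2, l.A_comm_det] at this
    apply hαβ
    rw [l.tr]; linarith
  · apply hαβ
    rw [h, ← h 1, map_one]; simp

theorem eq_of_L_b {g h : G} (hL : c.L g = c.L h) (h1 : c.b g 1 = c.b h 1) (h2 : c.b g 2 = c.b h 2) :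
    g = h := by
  have hb : c.b (g * h⁻¹) = c.b g - c.b h := by
    rw [c.b_mul, c.b_inv, hL, mulVec_neg, mulVec_mulVec, c.L_mul_inv, one_mulVec]; abel
  rw [← mul_inv_eq_one]
  apply l.no_trans
  · rw [map_mul, hL, c.L_mul_inv]
  · rw [hb]; simp [h1]
  · rw [hb]; simp [h2]

end Line
end Crys
end FG3
end Part4

section Part5
open Matrix
set_option linter.all false
namespace FG3
namespace Crys
variable {G : Type} [Group G] (c : Crys G)

/-- The plane part of the linear part of `g` is the scalar `s`. -/
structure SC (c : Crys G) (g : G) (s : ℝ) : Prop where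
  e11 : c.L g 1 1 = s
  e12 : c.L g 1 2 = 0
  e21 : c.L g 2 1 = 0
  e22 : c.L g 2 2 = s

namespace Line
variable {c} (l : c.Line)
include l

theorem sc_iff (g : G) (s : ℝ) : SC c g s ↔ c.lineA l.h10 l.h20 g = s • (1 : M2) := by
  constructor
  · rintro ⟨a, b, d, e⟩
    ext i j
    fin_cases i <;> fin_cases j <;> simp [lineA, a, b, d, e]
  · intro h
    have e : ∀ i j, c.lineA l.h10 l.h20 g i j = (s • (1 : M2)) i j := fun i j => by rw [h]
    have e00 := e 0 0
    have e01 := e 0 1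
    have e10 := e 1 0
    have e11 := e 1 1
    simp [lineA] at e00 e01 e10 e11
    exact ⟨e00, e01, e10, e11⟩

theorem sc_mul {g h : G} {s r : ℝ} (hg : SC c g s) (hh : SC c h r) : SC c (g * h) (s * r) := by
  rw [l.sc_iff] at *
  rw [map_mul, hg, hh, smul_mul_smul_comm, one_mul]

theorem sc_one : SC c 1 1 := by
  rw [l.sc_iff]; simp

theorem sc_ne {g : G} {s : ℝ} (hg : SC c g s) : s ≠ 0 := by
  have h := l.mul11 g g⁻¹
  rw [mul_inv_cancel, map_one, hg.e12, hg.e11] at h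
  rintro rfl
  simp at h

theorem sc_inv {g : G} {s : ℝ} (hg : SC c g s) : SC c g⁻¹ s⁻¹ := by
  have hs := l.sc_ne hg
  have h := l.sc_iff g s |>.mp hg
  rw [l.sc_iff]
  have e : c.lineA l.h10 l.h20 g * c.lineA l.h10 l.h20 g⁻¹ = 1 := by
    rw [← map_mul, mul_inv_cancel, map_one]
  rw [h, smul_mul_assoc, one_mul] at e
  rw [← e, smul_smul, inv_mul_cancel₀ hs, one_smul]

theorem sc_conj {g : G} {s : ℝ} (hg : SC c g s) (γ : G) : SC c (γ * g * γ⁻¹) s := by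
  rw [l.sc_iff] at *
  rw [map_mul, map_mul, hg, mul_smul_comm, mul_one, smul_mul_assoc, ← map_mul, mul_inv_cancel, map_one]

theorem sc_comm {g : G} {s : ℝ} (hg : SC c g s) (γ : G) : SC c (γ * g * γ⁻¹ * g⁻¹) 1 := by
  have := l.sc_mul (l.sc_conj hg γ) (l.sc_inv hg)
  rwa [mul_inv_cancel₀ (l.sc_ne hg)] at this

theorem nu_comm {m n : G} (hm : SC c m 1) (hn : SC c n 1) : m * n = n * m ∧
    c.L m 0 1 * c.b n 1 + c.L m 0 2 * c.b n 2 = c.L n 0 1 * c.b m 1 + c.L n 0 2 * c.b m 2 := by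
  have h : m * n = n * m := by
    apply l.eq_of_L_b
    · ext i j
      fin_cases i <;> fin_cases j
      · exact (l.h00 _).trans (l.h00 _).symm
      · simp only [Fin.zero_eta, Fin.mk_one, Fin.reduceFinMk]
        rw [l.mul01, l.mul01, hm.e11, hm.e21, hn.e11, hn.e21]; ring
      · simp only [Fin.zero_eta, Fin.mk_one, Fin.reduceFinMk]
        rw [l.mul02, l.mul02, hm.e12, hm.e22, hn.e12, hn.e22]; ring
      · exact (l.h10 _).trans (l.h10 _).symm
      · simp only [Fin.zero_eta, Fin.mk_one, Fin.reduceFinMk]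
        rw [l.mul11, l.mul11, hm.e11, hm.e12, hn.e11, hn.e12]; ring
      · simp only [Fin.zero_eta, Fin.mk_one, Fin.reduceFinMk]
        rw [l.mul12, l.mul12, hm.e11, hm.e12, hm.e22, hn.e11, hn.e12, hn.e22]
      · exact (l.h20 _).trans (l.h20 _).symm
      · simp only [Fin.zero_eta, Fin.mk_one, Fin.reduceFinMk]
        rw [l.mul21, l.mul21, hm.e11, hm.e21, hm.e22, hn.e11, hn.e21, hn.e22]
      · simp only [Fin.zero_eta, Fin.mk_one, Fin.reduceFinMk]
        rw [l.mul22, l.mul22, hm.e21, hm.e22, hn.e21, hn.e22]; ring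
    · rw [l.mulb1, l.mulb1, hm.e11, hm.e12, hn.e11, hn.e12]; ring
    · rw [l.mulb2, l.mulb2, hm.e21, hm.e22, hn.e21, hn.e22]; ring
  refine ⟨h, ?_⟩
  have := congrArg (fun g => c.b g 0) h
  beta_reduce at this
  rw [l.mulb0, l.mulb0] at this
  linarith

theorem nu_conj {m : G} (hm : SC c m 1) (γ : G) :
    c.b (γ * m * γ⁻¹) 1 = c.L γ 1 1 * c.b m 1 + c.L γ 1 2 * c.b m 2 ∧
    c.b (γ * m * γ⁻¹) 2 = c.L γ 2 1 * c.b m 1 + c.L γ 2 2 * c.b m 2 ∧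
    c.L (γ * m * γ⁻¹) 0 1 * c.L γ 1 1 + c.L (γ * m * γ⁻¹) 0 2 * c.L γ 2 1 = c.L m 0 1 ∧
    c.L (γ * m * γ⁻¹) 0 1 * c.L γ 1 2 + c.L (γ * m * γ⁻¹) 0 2 * c.L γ 2 2 = c.L m 0 2 := by
  have hw := l.sc_conj hm γ
  set w := γ * m * γ⁻¹ with hwd
  have h : w * γ = γ * m := by rw [hwd]; group
  clear_value w
  refine ⟨?_, ?_, ?_, ?_⟩
  · have := congrArg (fun g => c.b g 1) h
    beta_reduce at this
    rw [l.mulb1, l.mulb1, hw.e11, hw.e12] at this; linarith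
  · have := congrArg (fun g => c.b g 2) h
    beta_reduce at this
    rw [l.mulb2, l.mulb2, hw.e21, hw.e22] at this; linarith
  · have := congrArg (fun g => c.L g 0 1) h
    beta_reduce at this
    rw [l.mul01, l.mul01, hm.e11, hm.e21] at this; linarith
  · have := congrArg (fun g => c.L g 0 2) h
    beta_reduce at this
    rw [l.mul02, l.mul02, hm.e12, hm.e22] at this; linarith

theorem nu_pow {m : G} (hm : SC c m 1) (k : ℕ) :
    c.L (m ^ k) 0 1 = k * c.L m 0 1 ∧ c.L (m ^ k) 0 2 = k * c.L m 0 2 ∧ SC c (m ^ k) 1 := by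
  induction k with
  | zero => exact ⟨by simp, by simp, by rw [pow_zero]; exact l.sc_one⟩
  | succ k ih =>
    obtain ⟨h1, h2, h3⟩ := ih
    refine ⟨?_, ?_, ?_⟩
    · rw [pow_succ, l.mul01, h1, h2, hm.e11, hm.e21]; push_cast; ring
    · rw [pow_succ, l.mul02, h1, h2, hm.e12, hm.e22]; push_cast; ring
    · rw [pow_succ]; simpa using l.sc_mul h3 hm

theorem L_eq_one {m : G} (hm : SC c m 1) (h1 : c.L m 0 1 = 0) (h2 : c.L m 0 2 = 0) : c.L m = 1 := by
  ext i j
  fin_cases i <;> fin_cases j <;> simp [l.h00, l.h10, l.h20, hm.e11, hm.e12, hm.e21, hm.e22, h1, h2]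

theorem u_inj {m : G} (hm : SC c m 1) (h1 : c.b m 1 = 0) (h2 : c.b m 2 = 0) : m = 1 := by
  have hfix : (∃ x, c.act m x = x) → c.L m 0 1 = 0 ∧ c.L m 0 2 = 0 := by
    rintro ⟨x, hx⟩
    obtain ⟨k, hk, hk1⟩ := c.fixed_torsion hx
    obtain ⟨e1, e2, -⟩ := l.nu_pow hm k
    rw [hk1, map_one] at e1 e2
    have hk' : (k : ℝ) ≠ 0 := by positivity
    constructor
    · simpa [hk'] using e1.symm
    · simpa [hk'] using e2.symm
  have hc : c.L m 0 1 = 0 ∧ c.L m 0 2 = 0 := by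
    by_contra hcon
    apply hcon
    apply hfix
    set d := c.L m 0 1 ^ 2 + c.L m 0 2 ^ 2 with hd
    have hd0 : d ≠ 0 := by
      intro h0
      apply hcon
      constructor <;> nlinarith [sq_nonneg (c.L m 0 1), sq_nonneg (c.L m 0 2)]
    refine ⟨![0, -c.b m 0 * c.L m 0 1 / d, -c.b m 0 * c.L m 0 2 / d], ?_⟩
    ext i
    fin_cases i
    · simp [l.act0]; field_simp; rw [hd]; ring
    · simp [l.act1, hm.e11, hm.e12, h1]
    · simp [l.act2, hm.e21, hm.e22, h2]
  exact l.no_trans (l.L_eq_one hm hc.1 hc.2) h1 h2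

theorem u_ne {m : G} (hm : SC c m 1) (hne : m ≠ 1) : ![c.b m 1, c.b m 2] ≠ 0 := by
  intro h
  apply hne
  apply l.u_inj hm
  · exact congrFun h 0
  · exact congrFun h 1

/-- Existence of a contracting scalar kills `N_u`. -/
theorem nu_trivial_of_contr {n m : G} {s : ℝ} (hn : SC c n s) (hs : |s| < 1) (hm : SC c m 1) : m = 1 := by
  have hs0 := l.sc_ne hn
  have hs1 : s ^ 2 - 1 ≠ 0 := by
    intro h; have := (sq_lt_one_iff_abs_lt_one s).mpr hs; linarith
  have hs2 : s - 1 ≠ 0 := by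
    intro h; apply hs1; rw [sub_eq_zero.mp h]; norm_num
  -- c·u = 0
  have hcu : ∀ m, SC c m 1 → c.L m 0 1 * c.b m 1 + c.L m 0 2 * c.b m 2 = 0 := by
    intro m hm
    obtain ⟨e1, e2, e3, e4⟩ := l.nu_conj hm n
    have hw := (l.nu_comm hm (l.sc_conj hm n)).2
    rw [hn.e11, hn.e12] at e1
    rw [hn.e21, hn.e22] at e2
    rw [hn.e11, hn.e21] at e3
    rw [hn.e12, hn.e22] at e4
    rw [e1, e2, ← e3, ← e4] at hw
    have : (s ^ 2 - 1) * (c.L (n * m * n⁻¹) 0 1 * c.b m 1 + c.L (n * m * n⁻¹) 0 2 * c.b m 2) = 0 := by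
      linear_combination hw
    rcases mul_eq_zero.mp this with h | h
    · exact absurd h hs1
    · rw [← e3, ← e4]; linear_combination s * h
  have hc0 : ∀ m, SC c m 1 → m ≠ 1 → c.L m 0 1 = 0 ∧ c.L m 0 2 = 0 := by
    intro m hm hne
    by_contra hcon
    obtain ⟨g, hg⟩ := l.no_eig (l.u_ne hm hne)
    have hw := l.sc_conj hm g
    obtain ⟨e1, e2, -, -⟩ := l.nu_conj hm g
    generalize g * m * g⁻¹ = w at hw e1 e2
    have h1 := (l.nu_comm hm hw).2
    have h2 := hcu _ hm
    have h3 := hcu _ hw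
    have hmw : SC c (m * w) 1 := by simpa using l.sc_mul hm hw
    have h4 := hcu _ hmw
    rw [l.mul01, l.mul02, l.mulb1, l.mulb2, hw.e11, hw.e12, hw.e21, hw.e22, hm.e11, hm.e12,
      hm.e21, hm.e22] at h4
    have h5 : c.L m 0 1 * c.b w 1 + c.L m 0 2 * c.b w 2 = 0 := by linarith
    rw [e1, e2] at h5
    simp at hg
    have k1 : c.L m 0 1 * (c.b m 1 * (c.L g 2 1 * c.b m 1 + c.L g 2 2 * c.b m 2) -
      c.b m 2 * (c.L g 1 1 * c.b m 1 + c.L g 1 2 * c.b m 2)) = 0 := by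
      linear_combination (c.L g 2 1 * c.b m 1 + c.L g 2 2 * c.b m 2) * h2 - c.b m 2 * h5
    have k2 : c.L m 0 2 * (c.b m 1 * (c.L g 2 1 * c.b m 1 + c.L g 2 2 * c.b m 2) -
      c.b m 2 * (c.L g 1 1 * c.b m 1 + c.L g 1 2 * c.b m 2)) = 0 := by
      linear_combination c.b m 1 * h5 - (c.L g 1 1 * c.b m 1 + c.L g 1 2 * c.b m 2) * h2
    have hne' := sub_ne_zero.mpr hg
    apply hcon
    exact ⟨by simpa [hne'] using k1, by simpa [hne'] using k2⟩
  by_contra hne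
  -- conjugate translations
  have htrans : ∀ m, SC c m 1 → m ≠ 1 → c.L m = 1 := fun m hm hne =>
    l.L_eq_one hm (hc0 m hm hne).1 (hc0 m hm hne).2
  set q := n * m * n⁻¹ * m⁻¹ with hq
  have hqs : SC c q 1 := by
    have := l.sc_mul (l.sc_conj hm n) (l.sc_inv hm); simpa [hq] using this
  have hbq : c.b q = c.L n *ᵥ c.b m - c.b m := by
    have hLm := htrans m hm hne
    have hLmi : c.L m⁻¹ = 1 := by
      have := c.L_mul_inv m; rwa [hLm, one_mul] at this
    have hbmi : c.b m⁻¹ = - c.b m := by rw [c.b_inv, hLmi, one_mulVec]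
    rw [hq, c.b_mul, c.b_mul, c.b_mul, map_mul, map_mul, hLm, mul_one, c.L_mul_inv, c.b_inv n, hbmi,
      mulVec_neg, one_mulVec, mulVec_neg, mulVec_mulVec, c.L_mul_inv, one_mulVec]
    abel
  have hbq1 : c.b q 1 = (s - 1) * c.b m 1 := by
    rw [hbq]; simp [Matrix.mulVec, dotProduct, Fin.sum_univ_three, l.h10, hn.e11, hn.e12]; ring
  have hbq2 : c.b q 2 = (s - 1) * c.b m 2 := by
    rw [hbq]; simp [Matrix.mulVec, dotProduct, Fin.sum_univ_three, l.h20, hn.e21, hn.e22]; ring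
  have hbq0 : c.b q 0 = c.L n 0 1 * c.b m 1 + c.L n 0 2 * c.b m 2 := by
    rw [hbq]; simp [Matrix.mulVec, dotProduct, Fin.sum_univ_three, l.h00]; ring
  have hqne : q ≠ 1 := by
    intro h
    rw [h, c.b_one] at hbq1 hbq2
    simp [hs2] at hbq1 hbq2
    exact hne (l.u_inj hm hbq1 hbq2)
  have hLq := htrans q hqs hqne
  have heig : c.L n *ᵥ c.b q = s • c.b q := by
    ext i
    fin_cases i
    · simp [Matrix.mulVec, dotProduct, Fin.sum_univ_three, l.h00, hbq0, hbq1, hbq2]; ring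
    · simp [Matrix.mulVec, dotProduct, Fin.sum_univ_three, l.h10, hn.e11, hn.e12]
    · simp [Matrix.mulVec, dotProduct, Fin.sum_univ_three, l.h20, hn.e21, hn.e22]
  have hk : ∀ k : ℕ, c.L (n ^ k * q * (n ^ k)⁻¹) = 1 ∧ c.b (n ^ k * q * (n ^ k)⁻¹) = s ^ k • c.b q := by
    intro k
    induction k with
    | zero => simp [hLq]
    | succ k ih =>
      have e : n ^ (k + 1) * q * (n ^ (k + 1))⁻¹ = n * (n ^ k * q * (n ^ k)⁻¹) * n⁻¹ := by
        rw [pow_succ']; group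
      rw [e]
      set w := n ^ k * q * (n ^ k)⁻¹
      obtain ⟨i1, i2⟩ := ih
      constructor
      · rw [map_mul, map_mul, i1, mul_one, c.L_mul_inv]
      · rw [c.b_mul, c.b_mul, map_mul, i1, mul_one, c.b_inv, mulVec_neg, mulVec_mulVec, c.L_mul_inv,
          one_mulVec, i2, mulVec_smul, heig, smul_smul, pow_succ]; abel
  have hinj : Function.Injective (fun k : ℕ => n ^ k * q * (n ^ k)⁻¹) := by
    intro i j hij
    have h1 := congrArg c.b hij
    beta_reduce at h1
    rw [(hk i).2, (hk j).2] at h1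
    have hb0 : c.b q ≠ 0 := by
      intro h; apply hqne; exact c.faithful _ hLq h
    have h2 := smul_left_injective ℝ hb0 h1
    have h3 : |s| ^ i = |s| ^ j := by rw [← abs_pow, ← abs_pow, h2]
    exact (pow_right_strictAnti₀ (abs_pos.mpr hs0) hs).injective h3
  refine Set.infinite_range_of_injective hinj ((c.proper ‖c.b q‖).subset ?_)
  rintro _ ⟨k, rfl⟩
  refine ⟨0, by simp, ?_⟩
  beta_reduce
  rw [mulVec_zero, zero_add, (hk k).2, norm_smul, norm_pow, Real.norm_eq_abs]
  exact mul_le_of_le_one_left (norm_nonneg _) (pow_le_one₀ (abs_nonneg _) hs.le)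

theorem scalar_aux {n : G} {s : ℝ} (hn : SC c n s) (hs : |s| < 1) : False := by
  have hs2 : 1 - s ≠ 0 := by
    intro h; have : s = 1 := by linarith
    rw [this] at hs; simp at hs
  have hcen : ∀ γ, γ * n = n * γ := by
    intro γ
    have := l.nu_trivial_of_contr hn hs (l.sc_comm hn γ)
    have h2 := mul_inv_eq_one.mp this
    exact mul_inv_eq_iff_eq_mul.mp h2
  set p1 := c.b n 1 / (1 - s) with hp1
  set p2 := c.b n 2 / (1 - s) with hp2
  have hb1 : c.b n 1 = (1 - s) * p1 := by rw [hp1]; field_simp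
  have hb2 : c.b n 2 = (1 - s) * p2 := by rw [hp2]; field_simp
  have hfix : ∀ γ x, c.act γ ![x, p1, p2] = ![x + c.act γ ![0, p1, p2] 0, p1, p2] := by
    intro γ x
    have h1 := congrArg (fun g => c.b g 1) (hcen γ)
    have h2 := congrArg (fun g => c.b g 2) (hcen γ)
    beta_reduce at h1 h2
    rw [l.mulb1, l.mulb1, hn.e11, hn.e12, hb1, hb2] at h1
    rw [l.mulb2, l.mulb2, hn.e21, hn.e22, hb1, hb2] at h2
    have k1 : c.L γ 1 1 * p1 + c.L γ 1 2 * p2 + c.b γ 1 = p1 := by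
      apply mul_left_cancel₀ hs2; linear_combination h1
    have k2 : c.L γ 2 1 * p1 + c.L γ 2 2 * p2 + c.b γ 2 = p2 := by
      apply mul_left_cancel₀ hs2; linear_combination h2
    ext i
    fin_cases i
    · simp [l.act0]; ring
    · simp [l.act1, k1]
    · simp [l.act2, k2]
  obtain ⟨F, hF, hFc⟩ := c.exists_fix_finite
  apply l.comm_tr (hF.image fun g => (c.L g).trace)
  intro α β
  have hinv : ∀ γ, c.act γ ![0, p1, p2] 0 + c.act γ⁻¹ ![0, p1, p2] 0 = 0 := by
    intro γ
    have h1 : c.act γ (c.act γ⁻¹ ![0, p1, p2]) 0 = (![0, p1, p2] : V3) 0 := by rw [c.act_act_inv]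
    rw [hfix γ⁻¹, hfix γ] at h1
    simp at h1
    linarith
  obtain ⟨δ, hδ⟩ := hFc (α * β * α⁻¹ * β⁻¹) ![0, p1, p2] (by
    rw [c.act_mul, c.act_mul, c.act_mul, hfix β⁻¹, hfix α⁻¹, hfix β, hfix α]
    have e1 := hinv α
    have e2 := hinv β
    congr 1
    linarith)
  exact ⟨_, hδ, c.trace_conj _ _⟩

theorem scalar_sq {n : G} {s : ℝ} (hn : SC c n s) : s ^ 2 = 1 := by
  have hs0 := l.sc_ne hn
  rcases lt_trichotomy |s| 1 with h | h | h
  · exact (l.scalar_aux hn h).elim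
  · rw [← sq_abs, h]; norm_num
  · refine (l.scalar_aux (l.sc_inv hn) ?_).elim
    rw [abs_inv]; exact inv_lt_one_of_one_lt₀ h

end Line
end Crys
end FG3
end Part5

section Part6
open Matrix
set_option linter.all false
namespace FG3

theorem quad_period {a b d l1 l2 u1 u2 v1 v2 : ℝ} (hdet : u1 * v2 - u2 * v1 ≠ 0)
    (hu : ∀ x y : ℝ, a * (x + u1) ^ 2 + b * ((x + u1) * (y + u2)) + d * (y + u2) ^ 2 + l1 * (x + u1)
      + l2 * (y + u2) = a * x ^ 2 + b * (x * y) + d * y ^ 2 + l1 * x + l2 * y)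
    (hv : ∀ x y : ℝ, a * (x + v1) ^ 2 + b * ((x + v1) * (y + v2)) + d * (y + v2) ^ 2 + l1 * (x + v1)
      + l2 * (y + v2) = a * x ^ 2 + b * (x * y) + d * y ^ 2 + l1 * x + l2 * y) :
    a = 0 ∧ b = 0 ∧ d = 0 ∧ l1 = 0 ∧ l2 = 0 := by
  have u00 := hu 0 0
  have u10 := hu 1 0
  have u01 := hu 0 1
  have v00 := hv 0 0
  have v10 := hv 1 0
  have v01 := hv 0 1
  have e1 : 2 * a * u1 + b * u2 = 0 := by linear_combination u10 - u00
  have e2 : 2 * a * v1 + b * v2 = 0 := by linear_combination v10 - v00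
  have e3 : b * u1 + 2 * d * u2 = 0 := by linear_combination u01 - u00
  have e4 : b * v1 + 2 * d * v2 = 0 := by linear_combination v01 - v00
  have ha : a = 0 := by
    have : a * (u1 * v2 - u2 * v1) = 0 := by linear_combination (v2 * e1 - u2 * e2) / 2
    simpa [hdet] using this
  have hb : b = 0 := by
    have : b * (u1 * v2 - u2 * v1) = 0 := by linear_combination (v2 * e3 - u2 * e4)
    simpa [hdet] using this
  have hd : d = 0 := by
    have : d * (u1 * v2 - u2 * v1) = 0 := by linear_combination (u1 * e4 - v1 * e3) / 2
    simpa [hdet] using this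
  subst ha hb hd
  have f1 : l1 * u1 + l2 * u2 = 0 := by linear_combination u00
  have f2 : l1 * v1 + l2 * v2 = 0 := by linear_combination v00
  refine ⟨rfl, rfl, rfl, ?_, ?_⟩
  · have : l1 * (u1 * v2 - u2 * v1) = 0 := by linear_combination (v2 * f1 - u2 * f2)
    simpa [hdet] using this
  · have : l2 * (u1 * v2 - u2 * v1) = 0 := by linear_combination (u1 * f2 - v1 * f1)
    simpa [hdet] using this

namespace Crys
variable {G : Type} [Group G] (c : Crys G)
namespace Line
variable {c} (l : c.Line)
include l

theorem sc_zpow {m : G} (hm : SC c m 1) (k : ℤ) : SC c (m ^ k) 1 := by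
  rcases Int.eq_nat_or_neg k with ⟨j, rfl | rfl⟩
  · rw [zpow_natCast]; exact (l.nu_pow hm j).2.2
  · rw [_root_.zpow_neg, zpow_natCast]
    simpa using l.sc_inv (l.nu_pow hm j).2.2

theorem nu_trivial {m : G} (hm : SC c m 1) : m = 1 := by
  by_contra hne
  -- a second independent element
  obtain ⟨g, hg⟩ := l.no_eig (l.u_ne hm hne)
  have hw := l.sc_conj hm g
  obtain ⟨e1, e2, -, -⟩ := l.nu_conj hm g
  generalize g * m * g⁻¹ = w at hw e1 e2
  simp at hg
  rw [← e1, ← e2] at hg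
  obtain ⟨-, hsym⟩ := l.nu_comm hm hw
  set u1 := c.b m 1 with hu1
  set u2 := c.b m 2 with hu2
  set v1 := c.b w 1 with hv1
  set v2 := c.b w 2 with hv2
  set D := u1 * v2 - u2 * v1 with hD
  have hD0 : D ≠ 0 := sub_ne_zero.mpr hg
  -- the form κ
  obtain ⟨k11, k12, k22, hk1, hk2, hk3, hk4⟩ : ∃ k11 k12 k22 : ℝ,
      c.L m 0 1 = k11 * u1 + k12 * u2 ∧ c.L m 0 2 = k12 * u1 + k22 * u2 ∧
      c.L w 0 1 = k11 * v1 + k12 * v2 ∧ c.L w 0 2 = k12 * v1 + k22 * v2 := by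
    have h12 : (c.L w 0 1 * u1 - c.L m 0 1 * v1) = (c.L m 0 2 * v2 - c.L w 0 2 * u2) := by
      linarith
    refine ⟨(c.L m 0 1 * v2 - c.L w 0 1 * u2) / D, (c.L w 0 1 * u1 - c.L m 0 1 * v1) / D,
      (c.L w 0 2 * u1 - c.L m 0 2 * v1) / D, ?_, ?_, ?_, ?_⟩
    · field_simp; rw [hD]; ring
    · rw [h12]; field_simp; rw [hD]; ring
    · field_simp; rw [hD]; ring
    · rw [h12]; field_simp; rw [hD]; ring
  have hkap : ∀ n, SC c n 1 → c.L n 0 1 = k11 * c.b n 1 + k12 * c.b n 2 ∧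
      c.L n 0 2 = k12 * c.b n 1 + k22 * c.b n 2 := by
    intro n hn
    have a1 := (l.nu_comm hn hm).2
    have a2 := (l.nu_comm hn hw).2
    rw [hk1, hk2, ← hu1, ← hu2] at a1
    rw [hk3, hk4, ← hv1, ← hv2] at a2
    constructor
    · have : D * (c.L n 0 1 - (k11 * c.b n 1 + k12 * c.b n 2)) = 0 := by
        rw [hD]; linear_combination v2 * a1 - u2 * a2
      rcases mul_eq_zero.mp this with h | h
      · exact absurd h hD0
      · linarith
    · have : D * (c.L n 0 2 - (k12 * c.b n 1 + k22 * c.b n 2)) = 0 := by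
        rw [hD]; linear_combination u1 * a2 - v1 * a1
      rcases mul_eq_zero.mp this with h | h
      · exact absurd h hD0
      · linarith
  let e : G → ℝ := fun n => c.b n 0 -
    (k11 * c.b n 1 ^ 2 + 2 * k12 * (c.b n 1 * c.b n 2) + k22 * c.b n 2 ^ 2) / 2
  obtain ⟨f1, f2, hf1, hf2⟩ : ∃ f1 f2 : ℝ, e m + f1 * u1 + f2 * u2 = 0 ∧ e w + f1 * v1 + f2 * v2 = 0 := by
    refine ⟨(-e m * v2 + e w * u2) / D, (-e w * u1 + e m * v1) / D, ?_, ?_⟩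
    · field_simp; rw [hD]; ring
    · field_simp; rw [hD]; ring
  let F : V3 → ℝ := fun x => x 0 - (k11 * x 1 ^ 2 + 2 * k12 * (x 1 * x 2) + k22 * x 2 ^ 2) / 2
    + f1 * x 1 + f2 * x 2
  let ε : G → ℝ := fun n => e n + f1 * c.b n 1 + f2 * c.b n 2
  have hF : ∀ n, SC c n 1 → ∀ x, F (c.act n x) = ε n + F x := by
    intro n hn x
    obtain ⟨a1, a2⟩ := hkap n hn
    simp only [F, ε, e, l.act0, l.act1, l.act2, hn.e11, hn.e12, hn.e21, hn.e22, a1, a2]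
    ring
  have hεm : ε m = 0 := hf1
  have hεw : ε w = 0 := hf2
  have hεF : ∀ n, SC c n 1 → ε n = F (c.act n 0) := by
    intro n hn
    rw [hF n hn]; simp [F]
  have hFz : ∀ n, SC c n 1 → ∀ (k : ℤ) x, F (c.act (n ^ k) x) = k * ε n + F x := by
    intro n hn k x
    have := zpow_lin (f := fun g => F (c.act g x) - F x) n (ε n) (by simp [c.act_one])
      (fun g => by rw [c.act_mul, hF n hn]; ring) k
    linarith
  have hact1 : ∀ n, SC c n 1 → ∀ (k : ℤ) x, c.act (n ^ k) x 1 = k * c.b n 1 + x 1 := by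
    intro n hn k x
    have := zpow_lin (f := fun g => c.act g x 1 - x 1) n (c.b n 1) (by simp [c.act_one])
      (fun g => by rw [c.act_mul, l.act1, hn.e11, hn.e12]; ring) k
    linarith
  have hact2 : ∀ n, SC c n 1 → ∀ (k : ℤ) x, c.act (n ^ k) x 2 = k * c.b n 2 + x 2 := by
    intro n hn k x
    have := zpow_lin (f := fun g => c.act g x 2 - x 2) n (c.b n 2) (by simp [c.act_one])
      (fun g => by rw [c.act_mul, l.act2, hn.e21, hn.e22]; ring) k
    linarith
  -- reduction
  have hred : ∀ E : ℝ, ∃ R, ∀ z : V3, |F z| ≤ E → ∃ n, SC c n 1 ∧ ‖c.act n z‖ ≤ R := by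
    intro E
    set B := |u1| + |u2| + |v1| + |v2| with hB
    have hB0 : 0 ≤ B := by positivity
    refine ⟨B + E + (|k11| * B ^ 2 + 2 * |k12| * B ^ 2 + |k22| * B ^ 2) / 2 + |f1| * B + |f2| * B, ?_⟩
    intro z hz
    set a := (z 1 * v2 - z 2 * v1) / D with ha
    set b := (u1 * z 2 - u2 * z 1) / D with hb
    have hz1 : z 1 = a * u1 + b * v1 := by rw [ha, hb]; field_simp; rw [hD]; ring
    have hz2 : z 2 = a * u2 + b * v2 := by rw [ha, hb]; field_simp; rw [hD]; ring
    refine ⟨m ^ (-⌊a⌋) * w ^ (-⌊b⌋), by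
      have := l.sc_mul (l.sc_zpow hm (-⌊a⌋)) (l.sc_zpow hw (-⌊b⌋))
      rwa [one_mul] at this, ?_⟩
    set y := c.act (m ^ (-⌊a⌋) * w ^ (-⌊b⌋)) z with hy
    have hy1 : y 1 = Int.fract a * u1 + Int.fract b * v1 := by
      rw [hy, c.act_mul, hact1 m hm, hact1 w hw, hz1, ← Int.self_sub_floor, ← Int.self_sub_floor]
      push_cast; ring
    have hy2 : y 2 = Int.fract a * u2 + Int.fract b * v2 := by
      rw [hy, c.act_mul, hact2 m hm, hact2 w hw, hz2, ← Int.self_sub_floor, ← Int.self_sub_floor]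
      push_cast; ring
    have hyF : F y = F z := by
      rw [hy, c.act_mul, hFz m hm, hFz w hw, hεm, hεw]; ring
    have hfr : ∀ p q r s : ℝ, |Int.fract p * r + Int.fract q * s| ≤ |r| + |s| := by
      intro p q r s
      refine (abs_add_le _ _).trans (add_le_add ?_ ?_)
      · rw [abs_mul, Int.abs_fract]
        exact mul_le_of_le_one_left (abs_nonneg _) (Int.fract_lt_one _).le
      · rw [abs_mul, Int.abs_fract]
        exact mul_le_of_le_one_left (abs_nonneg _) (Int.fract_lt_one _).le
    have hb1 : |y 1| ≤ B := by
      rw [hy1]; refine (hfr _ _ _ _).trans ?_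
      rw [hB]; linarith [abs_nonneg u2, abs_nonneg v2]
    have hb2 : |y 2| ≤ B := by
      rw [hy2]; refine (hfr _ _ _ _).trans ?_
      rw [hB]; linarith [abs_nonneg u1, abs_nonneg v1]
    have hy0 : y 0 = F y + (k11 * y 1 ^ 2 + 2 * k12 * (y 1 * y 2) + k22 * y 2 ^ 2) / 2
      - f1 * y 1 - f2 * y 2 := by simp only [F]; ring
    have hE0 : 0 ≤ E := (abs_nonneg _).trans hz
    have q1 : |k11 * y 1 ^ 2| ≤ |k11| * B ^ 2 := by
      rw [abs_mul, abs_pow]; gcongr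
    have q2 : |2 * k12 * (y 1 * y 2)| ≤ 2 * |k12| * B ^ 2 := by
      rw [abs_mul, abs_mul, abs_mul, sq, abs_two]; gcongr
    have q3 : |k22 * y 2 ^ 2| ≤ |k22| * B ^ 2 := by
      rw [abs_mul, abs_pow]; gcongr
    have q4 : |f1 * y 1| ≤ |f1| * B := by rw [abs_mul]; gcongr
    have q5 : |f2 * y 2| ≤ |f2| * B := by rw [abs_mul]; gcongr
    have q6 : |F y| ≤ E := by rw [hyF]; exact hz
    rw [abs_le] at q1 q2 q3 q4 q5 q6
    have p1 : 0 ≤ |k11| * B ^ 2 := by positivity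
    have p2 : 0 ≤ |k12| * B ^ 2 := by positivity
    have p3 : 0 ≤ |k22| * B ^ 2 := by positivity
    have p4 : 0 ≤ |f1| * B := by positivity
    have p5 : 0 ≤ |f2| * B := by positivity
    rw [pi_norm_le_iff_of_nonneg (by positivity)]
    intro i
    fin_cases i
    · change |y 0| ≤ _
      rw [hy0, abs_le]
      constructor <;> linarith [q1.1, q1.2, q2.1, q2.2, q3.1, q3.2, q4.1, q4.2, q5.1, q5.2, q6.1, q6.2]
    · change |y 1| ≤ _
      linarith
    · change |y 2| ≤ _
      linarith
  have hbdd : ∀ (S : Set G) (E : ℝ), (∀ γ ∈ S, ∃ n, SC c n 1 ∧ |F (c.act (n * γ) 0)| ≤ E) →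
      ((fun g => (c.L g).trace) '' S).Finite := by
    intro S E hS
    obtain ⟨R, hR⟩ := hred E
    refine ((c.proper (max R 0)).image fun g => (c.L g).trace).subset ?_
    rintro _ ⟨γ, hγ, rfl⟩
    obtain ⟨n, hn, hnE⟩ := hS γ hγ
    obtain ⟨n', hn', hR'⟩ := hR _ hnE
    refine ⟨n' * (n * γ), ⟨0, by simp, ?_⟩, ?_⟩
    · change ‖c.act _ _‖ ≤ _
      rw [c.act_mul]; exact hR'.trans (le_max_left _ _)
    · beta_reduce
      have h1 : SC c (n' * n) 1 := by simpa using l.sc_mul hn' hn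
      rw [l.tr, l.tr, ← mul_assoc, map_mul, (l.sc_iff _ _).mp h1, one_smul, one_mul]
  by_cases hcase : ∀ n, SC c n 1 → ε n = 0
  · -- F is invariant up to constants
    have hinv : ∀ γ x, F (c.act γ x) = F x + F (c.act γ 0) := by
      intro γ
      obtain ⟨a, b, d, l1, l2, hq⟩ : ∃ a b d l1 l2 : ℝ, ∀ x : V3, F (c.act γ x) - F x =
          a * x 1 ^ 2 + b * (x 1 * x 2) + d * x 2 ^ 2 + l1 * x 1 + l2 * x 2 + F (c.act γ 0) := by
        refine ⟨(k11 - (k11 * c.L γ 1 1 ^ 2 + 2 * k12 * (c.L γ 1 1 * c.L γ 2 1) + k22 * c.L γ 2 1 ^ 2)) / 2,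
          k12 - (k11 * (c.L γ 1 1 * c.L γ 1 2) + k12 * (c.L γ 1 1 * c.L γ 2 2 + c.L γ 1 2 * c.L γ 2 1)
            + k22 * (c.L γ 2 1 * c.L γ 2 2)),
          (k22 - (k11 * c.L γ 1 2 ^ 2 + 2 * k12 * (c.L γ 1 2 * c.L γ 2 2) + k22 * c.L γ 2 2 ^ 2)) / 2,
          c.L γ 0 1 - (k11 * (c.L γ 1 1 * c.b γ 1) + k12 * (c.L γ 1 1 * c.b γ 2 + c.L γ 2 1 * c.b γ 1)
            + k22 * (c.L γ 2 1 * c.b γ 2)) + f1 * (c.L γ 1 1 - 1) + f2 * c.L γ 2 1,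
          c.L γ 0 2 - (k11 * (c.L γ 1 2 * c.b γ 1) + k12 * (c.L γ 1 2 * c.b γ 2 + c.L γ 2 2 * c.b γ 1)
            + k22 * (c.L γ 2 2 * c.b γ 2)) + f1 * c.L γ 1 2 + f2 * (c.L γ 2 2 - 1), fun x => ?_⟩
        simp only [F, l.act0, l.act1, l.act2, Pi.zero_apply]
        ring
      have hper : ∀ n, SC c n 1 → ∀ x, F (c.act γ (c.act n x)) - F (c.act n x) = F (c.act γ x) - F x := by
        intro n hn x
        have e : c.act γ (c.act n x) = c.act (γ * n * γ⁻¹) (c.act γ x) := by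
          rw [← c.act_mul, ← c.act_mul]; congr 1; group
        rw [e, hF _ (l.sc_conj hn γ), hF _ hn, hcase _ hn, hcase _ (l.sc_conj hn γ)]; ring
      have hqp : ∀ n, SC c n 1 → ∀ x y : ℝ, a * (x + c.b n 1) ^ 2 + b * ((x + c.b n 1) * (y + c.b n 2))
          + d * (y + c.b n 2) ^ 2 + l1 * (x + c.b n 1)
          + l2 * (y + c.b n 2) = a * x ^ 2 + b * (x * y) + d * y ^ 2 + l1 * x + l2 * y := by
        intro n hn x y
        have h1 := hper n hn ![0, x, y]
        rw [hq, hq, l.act1, l.act2, hn.e11, hn.e12, hn.e21, hn.e22] at h1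
        simp at h1
        linear_combination h1
      obtain ⟨rfl, rfl, rfl, rfl, rfl⟩ := quad_period hD0 (hqp m hm) (hqp w hw)
      intro x
      have := hq x
      linarith
    refine l.comm_tr (hbdd {γ | F (c.act γ 0) = 0} 0 ?_) ?_
    · intro γ hγ
      exact ⟨1, l.sc_one, by rw [one_mul, hγ]; simp⟩
    · intro α β
      refine ⟨_, ?_, rfl⟩
      have hi : ∀ g, F (c.act g⁻¹ 0) + F (c.act g 0) = 0 := by
        intro g
        have := hinv g (c.act g⁻¹ 0)
        rw [c.act_act_inv] at this
        rw [← this]; simp [F]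
      change F _ = 0
      rw [c.act_mul, c.act_mul, c.act_mul, hinv α, hinv β, hinv α⁻¹]
      linarith [hi α, hi β]
  · push Not at hcase
    obtain ⟨n, hn, hne⟩ := hcase
    refine l.comm_tr (hbdd Set.univ |ε n| ?_) (fun α β => ⟨_, Set.mem_univ _, rfl⟩)
    intro γ _
    refine ⟨n ^ (-⌊F (c.act γ 0) / ε n⌋), l.sc_zpow hn _, ?_⟩
    rw [c.act_mul, hFz n hn]
    set s := F (c.act γ 0)
    have : ((-⌊s / ε n⌋ : ℤ) : ℝ) * ε n + s = Int.fract (s / ε n) * ε n := by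
      rw [← Int.self_sub_floor]; push_cast; field_simp; ring
    rw [this, abs_mul, Int.abs_fract]
    exact mul_le_of_le_one_left (abs_nonneg _) (Int.fract_lt_one _).le

end Line
end Crys
end FG3
end Part6

section Part7
open Matrix
set_option linter.all false
namespace FG3
attribute [local instance] Matrix.linftyOpNormedRing Matrix.linftyOpNormedAlgebra

section zass
variable {G : Type} [Group G] {n : Type} [Fintype n] [DecidableEq n]

/-- `g` has linear part near the identity. -/
def Near (A : G →* Matrix n n ℝ) (ε : ℝ) (g : G) : Prop :=
  (A g).det = 1 ∧ ‖A g - 1‖ ≤ ε ∧ ‖A g⁻¹ - 1‖ ≤ ε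

theorem hom_mul_inv (A : G →* Matrix n n ℝ) (g : G) : A g * A g⁻¹ = 1 := by
  rw [← map_mul, mul_inv_cancel, map_one]
theorem hom_inv_mul (A : G →* Matrix n n ℝ) (g : G) : A g⁻¹ * A g = 1 := by
  rw [← map_mul, inv_mul_cancel, map_one]

theorem Near.inv {A : G →* Matrix n n ℝ} {ε : ℝ} {g : G} (h : Near A ε g) : Near A ε g⁻¹ := by
  refine ⟨?_, h.2.2, by simpa using h.2.1⟩
  have := congrArg Matrix.det (hom_mul_inv A g)
  rw [det_mul, h.1, det_one, one_mul] at this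
  exact this

theorem near_conj (A : G →* Matrix n n ℝ) {ε : ℝ} (hε : 0 < ε) (h : G) :
    ∃ δ > 0, ∀ g, Near A δ g → Near A ε (h * g * h⁻¹) := by
  set C := ‖A h‖ * ‖A h⁻¹‖ + 1 with hC
  have hC0 : 0 < C := by positivity
  have key : ∀ g, ‖A (h * g * h⁻¹) - 1‖ ≤ C * ‖A g - 1‖ := by
    intro g
    have e : A (h * g * h⁻¹) - 1 = A h * (A g - 1) * A h⁻¹ := by
      rw [map_mul, map_mul, mul_sub, sub_mul, mul_one, hom_mul_inv]
    rw [e]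
    calc _ ≤ ‖A h‖ * ‖A g - 1‖ * ‖A h⁻¹‖ :=
          (norm_mul_le _ _).trans (mul_le_mul_of_nonneg_right (norm_mul_le _ _) (norm_nonneg _))
      _ ≤ _ := by rw [hC]; nlinarith [norm_nonneg (A g - 1)]
  refine ⟨ε / C, by positivity, fun g hg => ⟨?_, ?_, ?_⟩⟩
  · rw [map_mul, map_mul, det_mul, det_mul, hg.1, mul_one, ← det_mul, hom_mul_inv, det_one]
  · refine (key g).trans ?_
    calc _ ≤ C * (ε / C) := mul_le_mul_of_nonneg_left hg.2.1 hC0.le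
      _ = ε := by field_simp
  · have e : (h * g * h⁻¹)⁻¹ = h * g⁻¹ * h⁻¹ := by group
    rw [e]
    refine (key _).trans ?_
    calc _ ≤ C * (ε / C) := mul_le_mul_of_nonneg_left hg.2.2 hC0.le
      _ = ε := by field_simp

theorem zass (i0 : n) (A : G →* Matrix n n ℝ) (hA : ∀ g, A g = 1 → g = 1)
    (H2 : ∀ Z : Set (Matrix n n ℝ), (∀ z ∈ Z, ∀ z' ∈ Z, z * z' = z' * z) →
      (∀ g, ∀ z ∈ Z, A g * z * A g⁻¹ ∈ Z) → ∀ z ∈ Z, ∃ r : ℝ, z = r • (1 : Matrix n n ℝ))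
    {ε0 : ℝ} (h0 : 0 < ε0)
    (HD : ∀ S : Finset G, (∀ s ∈ S, Near A ε0 s) → ∃ d : G → ℝ, (∀ g, g ≠ 1 → 0 < d g) ∧
      {g | d g ≤ 1/16}.Finite ∧ (∀ s ∈ S, d s ≤ 1/16) ∧
      (∀ s c, d s ≤ 1/16 → d c ≤ 1/16 → d (s * c * s⁻¹ * c⁻¹) ≤ 1/2 * d c) ∧
      (∀ g, d g ≤ 1/16 → 0 < A g i0 i0)) :
    ∃ ε > 0, ∀ g, Near A ε g → g = 1 := by
  classical
  set V : ℝ → Submodule ℝ (Matrix n n ℝ) := fun ε => Submodule.span ℝ (A '' {g | Near A ε g}) with hV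
  have hmono : ∀ {ε δ}, ε ≤ δ → V ε ≤ V δ := by
    intro ε δ h
    apply Submodule.span_mono
    apply Set.image_mono
    exact fun g hg => ⟨hg.1, hg.2.1.trans h, hg.2.2.trans h⟩
  obtain ⟨ε1, ⟨hε1, hε10⟩, hmin⟩ : ∃ ε1 ∈ {ε | 0 < ε ∧ ε ≤ ε0}, ∀ ε ∈ {ε | 0 < ε ∧ ε ≤ ε0},
      ¬ (Module.finrank ℝ (V ε) < Module.finrank ℝ (V ε1)) := by
    have := (measure (fun ε => Module.finrank ℝ (V ε))).wf.has_min {ε : ℝ | 0 < ε ∧ ε ≤ ε0}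
      ⟨ε0, h0, le_rfl⟩
    exact this
  have hVeq : ∀ ε, 0 < ε → ε ≤ ε1 → V ε = V ε1 := by
    intro ε h1 h2
    exact Submodule.eq_of_le_of_finrank_le (hmono h2) (not_lt.mp (hmin ε ⟨h1, h2.trans hε10⟩))
  refine ⟨ε1, hε1, fun g0 hg0 => ?_⟩
  by_contra hg1
  have hfg : (V ε1).FG := IsNoetherian.noetherian _
  obtain ⟨T, hT1, hT2⟩ := Submodule.fg_span_iff_fg_span_finset_subset _ |>.mp hfg
  obtain ⟨S0, hS0, hS0T⟩ := Finset.subset_set_image_iff.mp hT1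
  set S := insert g0 S0 with hS
  have hSnear : ∀ s ∈ S, Near A ε1 s := by
    intro s hs
    rcases Finset.mem_insert.mp hs with rfl | h
    · exact hg0
    · exact hS0 h
  obtain ⟨d, hd0, hdfin, hdS, hdc, hdA⟩ := HD S (fun s hs => ⟨(hSnear s hs).1,
    (hSnear s hs).2.1.trans hε10, (hSnear s hs).2.2.trans hε10⟩)
  set W : Set G := {x | x ∈ Subgroup.closure (S : Set G) ∧ (A x).det = 1 ∧ d x ≤ 1/16 ∧ x ≠ 1} with hW
  have hg0W : g0 ∈ W := ⟨Subgroup.subset_closure (by simp [hS]), hg0.1, hdS _ (by simp [hS]), hg1⟩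
  obtain ⟨x, ⟨hx1, hx2, hx3, hx4⟩, hxmin⟩ := Set.exists_min_image W d
    (hdfin.subset fun y hy => hy.2.2.1) ⟨g0, hg0W⟩
  have hcomm : ∀ s ∈ S, s * x = x * s := by
    intro s hs
    by_contra hne
    have hlt : d (s * x * s⁻¹ * x⁻¹) ≤ 1/2 * d x := hdc s x (hdS s hs) hx3
    have hxp := hd0 x hx4
    have : s * x * s⁻¹ * x⁻¹ ∈ W := by
      refine ⟨?_, ?_, by linarith, ?_⟩
      · have hs' : s ∈ Subgroup.closure (S : Set G) := Subgroup.subset_closure hs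
        exact mul_mem (mul_mem (mul_mem hs' hx1) (inv_mem hs')) (inv_mem hx1)
      · have h1 := congrArg Matrix.det (hom_mul_inv A s)
        have h2 := congrArg Matrix.det (hom_mul_inv A x)
        rw [det_mul, det_one] at h1 h2
        rw [map_mul, map_mul, map_mul, det_mul, det_mul, det_mul]
        linear_combination (A x).det * (A x⁻¹).det * h1 + h2
      · intro h
        apply hne
        have : s * x = (s * x * s⁻¹ * x⁻¹) * (x * s) := by group
        rw [this, h, one_mul]
    have := hxmin _ this
    linarith
  -- `A x` commutes with `V`
  have hxV : ∀ v ∈ V ε1, A x * v = v * A x := by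
    intro v hv
    rw [hV] at hv
    beta_reduce at hv
    rw [hT2] at hv
    induction hv using Submodule.span_induction with
    | mem v hv =>
      rw [← hS0T] at hv
      obtain ⟨s, hs, rfl⟩ := Finset.mem_image.mp hv
      rw [← map_mul, ← map_mul, hcomm s (Finset.mem_insert_of_mem hs)]
    | zero => simp
    | add a b _ _ ha hb => rw [mul_add, add_mul, ha, hb]
    | smul r a _ ha => rw [mul_smul_comm, smul_mul_assoc, ha]
  have hxadj : A x ∈ Algebra.adjoin ℝ (V ε1 : Set (Matrix n n ℝ)) ∧
      A x⁻¹ ∈ Algebra.adjoin ℝ (V ε1 : Set (Matrix n n ℝ)) := by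
    clear hxV hcomm hxmin hx2 hx3 hx4
    induction hx1 using Subgroup.closure_induction with
    | mem s hs =>
      have := hSnear s hs
      exact ⟨Algebra.subset_adjoin (Submodule.subset_span ⟨s, this, rfl⟩),
        Algebra.subset_adjoin (Submodule.subset_span ⟨s⁻¹, this.inv, rfl⟩)⟩
    | one => simp [one_mem]
    | mul a b _ _ ha hb =>
      rw [_root_.mul_inv_rev, map_mul, map_mul]
      exact ⟨mul_mem ha.1 hb.1, mul_mem hb.2 ha.2⟩
    | inv a _ ha => exact ⟨ha.2, by simpa using ha.1⟩
  have hconjV : ∀ h, ∀ v ∈ V ε1, A h * v * A h⁻¹ ∈ V ε1 := by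
    intro h v hv
    obtain ⟨δ, hδ, hδc⟩ := near_conj A hε1 h
    rw [← hVeq (min δ ε1) (lt_min hδ hε1) (min_le_right _ _), hV] at hv
    beta_reduce at hv
    induction hv using Submodule.span_induction with
    | mem v hv =>
      obtain ⟨s, hs, rfl⟩ := hv
      rw [← map_mul, ← map_mul]
      refine Submodule.subset_span ⟨_, hδc s ?_, rfl⟩
      exact ⟨hs.1, hs.2.1.trans (min_le_left _ _), hs.2.2.trans (min_le_left _ _)⟩
    | zero => simp
    | add a b _ _ ha hb => rw [mul_add, add_mul]; exact add_mem ha hb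
    | smul r a _ ha => rw [mul_smul_comm, smul_mul_assoc]; exact Submodule.smul_mem _ _ ha
  obtain ⟨r, hr⟩ := H2 {z | z ∈ Algebra.adjoin ℝ (V ε1 : Set (Matrix n n ℝ)) ∧
      ∀ v ∈ V ε1, z * v = v * z} (by
    rintro z ⟨hz, -⟩ z' ⟨-, hz'⟩
    induction hz using Algebra.adjoin_induction with
    | mem v hv => exact (hz' v hv).symm
    | algebraMap r => exact Algebra.commutes r z'
    | add a b _ _ ha hb => rw [add_mul, mul_add, ha, hb]
    | mul a b _ _ ha hb => rw [mul_assoc, hb, ← mul_assoc, ha, mul_assoc]) (by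
    rintro g z ⟨hz, hz'⟩
    constructor
    · clear hz'
      induction hz using Algebra.adjoin_induction with
      | mem v hv => exact Algebra.subset_adjoin (hconjV g v hv)
      | algebraMap r =>
        rw [← Algebra.commutes, mul_assoc, hom_mul_inv, mul_one]
        exact Subalgebra.algebraMap_mem _ r
      | add a b _ _ ha hb => rw [mul_add, add_mul]; exact add_mem ha hb
      | mul a b _ _ ha hb =>
        have e : A g * (a * b) * A g⁻¹ = (A g * a * A g⁻¹) * (A g * b * A g⁻¹) := by
          have : (A g * a * A g⁻¹) * (A g * b * A g⁻¹) = A g * a * (A g⁻¹ * A g) * b * A g⁻¹ := by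
            noncomm_ring
          rw [this, hom_inv_mul]; noncomm_ring
        rw [e]; exact mul_mem ha hb
    · intro v hv
      have h1 := hz' _ (hconjV g⁻¹ v hv)
      rw [inv_inv] at h1
      calc A g * z * A g⁻¹ * v = A g * z * A g⁻¹ * v * (A g * A g⁻¹) := by
            rw [hom_mul_inv, mul_one]
        _ = A g * (z * (A g⁻¹ * v * A g)) * A g⁻¹ := by noncomm_ring
        _ = A g * ((A g⁻¹ * v * A g) * z) * A g⁻¹ := by rw [h1]
        _ = (A g * A g⁻¹) * v * (A g * z * A g⁻¹) := by noncomm_ring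
        _ = _ := by rw [hom_mul_inv, one_mul]) (A x) ⟨hxadj.1, hxV⟩
  have hpos := hdA x hx3
  rw [hr] at hpos hx2
  simp only [Matrix.smul_apply, one_apply_eq, smul_eq_mul, mul_one] at hpos
  rw [det_smul, det_one, mul_one] at hx2
  haveI : Nonempty n := ⟨i0⟩
  have hn : Fintype.card n ≠ 0 := Fintype.card_ne_zero
  have : r = 1 := (pow_eq_one_iff_of_nonneg hpos.le hn).mp hx2
  apply hx4
  apply hA
  rw [hr, this, one_smul]

end zass

theorem linf_entry {n : Type} [Fintype n] [DecidableEq n] (M : Matrix n n ℝ) (i j : n) : |M i j| ≤ ‖M‖ := by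
  have h := Matrix.linfty_opNorm_mulVec M (Pi.single j 1)
  rw [Matrix.mulVec_single_one] at h
  have h2 : ‖(Pi.single j 1 : n → ℝ)‖ ≤ 1 := by
    refine (pi_norm_le_iff_of_nonneg zero_le_one).mpr fun k => ?_
    rcases eq_or_ne k j with rfl | hk
    · simp
    · simp [hk]
  have h3 := norm_le_pi_norm (M.col j) i
  have h4 : ‖M.col j i‖ = |M i j| := rfl
  rw [h4] at h3
  nlinarith [norm_nonneg M]

theorem linf_le {n : Type} [Fintype n] [DecidableEq n] (M : Matrix n n ℝ) {e : ℝ} (he : 0 ≤ e)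
    (h : ∀ i j, |M i j| ≤ e) : ‖M‖ ≤ Fintype.card n * e := by
  lift e to NNReal using he
  have : ‖M‖₊ ≤ Fintype.card n * e := by
    rw [Matrix.linfty_opNNNorm_def]
    apply Finset.sup_le
    intro i _
    calc _ ≤ ∑ j : n, e := Finset.sum_le_sum fun j _ => by
          have := h i j
          exact this
      _ = _ := by simp
  exact_mod_cast this

namespace Crys
variable {G : Type} [Group G] (c : Crys G)

/-- weighted homogeneous representation -/
noncomputable def hrep (w : Fin 3 → ℝ) (hw : ∀ i, 0 < w i) : G →* Matrix (Fin 3 ⊕ Unit) (Fin 3 ⊕ Unit) ℝ where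
  toFun g := fromBlocks (Matrix.of fun i j => w i * c.L g i j * (w j)⁻¹) (Matrix.of fun i _ => w i * c.b g i) 0 1
  map_one' := by
    ext i j
    rcases i with i | i <;> rcases j with j | j
    · rcases eq_or_ne i j with rfl | h
      · simp [(hw i).ne']
      · simp [h]
    · simp [c.b_one]
    · simp
    · simp
  map_mul' g h := by
    ext i j
    rcases i with i | i <;> rcases j with j | j
    · have := (hw 0).ne'
      have := (hw 1).ne'
      have := (hw 2).ne'
      simp only [fromBlocks_multiply, fromBlocks_apply₁₁, of_apply, Matrix.add_apply, mul_apply,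
        Fin.sum_univ_three, L_mul_apply]
      simp [Fin.sum_univ_three]
      have := (hw j).ne'
      field_simp
    · have := (hw 0).ne'
      have := (hw 1).ne'
      have := (hw 2).ne'
      simp only [fromBlocks_multiply, fromBlocks_apply₁₂, of_apply, Matrix.add_apply, mul_apply,
        Fin.sum_univ_three, b_mul_apply]
      simp [Fin.sum_univ_three]
      field_simp
    · simp [fromBlocks_multiply]
    · simp [fromBlocks_multiply]

theorem exists_d (w : Fin 3 → ℝ) (hw : ∀ i, 0 < w i) : ∃ d : G → ℝ, (∀ g, g ≠ 1 → 0 < d g) ∧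
      {g | d g ≤ 1/16}.Finite ∧
      (∀ s c, d s ≤ 1/16 → d c ≤ 1/16 → d (s * c * s⁻¹ * c⁻¹) ≤ 1/2 * d c) ∧
      (∀ g, d g ≤ 1/16 → ∀ i, 0 < c.L g i i) ∧
      ∀ g, (∀ i j, |w i * c.L g i j * (w j)⁻¹ - (1 : M3) i j| ≤ 1/64) → 
        (∀ i j, |w i * c.L g⁻¹ i j * (w j)⁻¹ - (1 : M3) i j| ≤ 1/64) →
        (∀ i, |w i * c.b g i| ≤ 1/64) → (∀ i, |w i * c.b g⁻¹ i| ≤ 1/64) → d g ≤ 1/16 := by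
  set ρ := c.hrep w hw with hρ
  have e11 : ∀ g i j, ρ g (Sum.inl i) (Sum.inl j) = w i * c.L g i j * (w j)⁻¹ := fun g i j => rfl
  have e12 : ∀ g i j, ρ g (Sum.inl i) (Sum.inr j) = w i * c.b g i := fun g i j => rfl
  have e21 : ∀ g i j, ρ g (Sum.inr i) (Sum.inl j) = 0 := fun g i j => rfl
  have e22 : ∀ g i j, ρ g (Sum.inr i) (Sum.inr j) = 1 := fun g i j => rfl
  have hm : ∀ g, ρ g * ρ g⁻¹ = 1 := hom_mul_inv ρ
  refine ⟨fun g => max ‖ρ g - 1‖ ‖ρ g⁻¹ - 1‖, ?_, ?_, ?_, ?_, ?_⟩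
  · intro g hg
    apply lt_max_of_lt_left
    rw [norm_pos_iff, sub_ne_zero]
    intro h
    apply hg
    apply c.faithful
    · ext i j
      have := congrFun (congrFun h (Sum.inl i)) (Sum.inl j)
      rw [e11] at this
      have h1 := (hw i).ne'
      have h2 := (hw j).ne'
      rcases eq_or_ne i j with rfl | hij
      · simp at this ⊢; field_simp at this; linarith
      · simp [hij, h1, h2] at this ⊢; exact this
    · ext i
      have := congrFun (congrFun h (Sum.inl i)) (Sum.inr ())
      rw [e12] at this
      have h1 := (hw i).ne'
      simpa [h1] using this
  · set R := ∑ i, (w i)⁻¹ with hR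
    have hR0 : 0 ≤ R := Finset.sum_nonneg fun i _ => (inv_pos.mpr (hw i)).le
    refine (c.proper R).subset ?_
    intro g hg
    refine ⟨0, by simpa using hR0, ?_⟩
    rw [mulVec_zero, zero_add]
    refine (pi_norm_le_iff_of_nonneg hR0).mpr fun i => ?_
    have h1 := (linf_entry _ (Sum.inl i) (Sum.inr ())).trans ((le_max_left _ _).trans hg)
    rw [Matrix.sub_apply, e12] at h1
    simp only [ne_eq, reduceCtorEq, not_false_eq_true, one_apply_ne, sub_zero] at h1
    rw [abs_mul, abs_of_pos (hw i)] at h1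
    have h2 : (w i)⁻¹ ≤ R := Finset.single_le_sum (f := fun i => (w i)⁻¹)
      (fun i _ => (inv_pos.mpr (hw i)).le) (Finset.mem_univ i)
    have h3 : |c.b g i| ≤ (w i)⁻¹ := by
      rw [← one_div, le_div_iff₀ (hw i)]; linarith
    exact h3.trans h2
  · intro s x hs hx
    have hb : ∀ g, ‖ρ g - 1‖ ≤ 1/16 → ‖ρ g‖ ≤ 17/16 := by
      intro g hg
      have : ρ g = (ρ g - 1) + 1 := by abel
      rw [this]
      refine (norm_add_le _ _).trans ?_
      have h1 : ‖(1 : Matrix (Fin 3 ⊕ Unit) (Fin 3 ⊕ Unit) ℝ)‖ = 1 := by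
        have h := Matrix.linfty_opNorm_diagonal (fun _ : Fin 3 ⊕ Unit => (1:ℝ))
        rw [Matrix.diagonal_one] at h
        rw [h]; simp
      rw [h1]; linarith
    have key : ∀ a b : G, ‖ρ a⁻¹ - 1‖ ≤ 1/16 → ‖ρ b⁻¹ - 1‖ ≤ 1/16 →
        ‖ρ (a * b * a⁻¹ * b⁻¹) - 1‖ ≤ 3 * ‖ρ a - 1‖ * ‖ρ b - 1‖ := by
      intro a b ha hb'
      have e : ρ (a * b * a⁻¹ * b⁻¹) - 1 =
          ((ρ a - 1) * (ρ b - 1) - (ρ b - 1) * (ρ a - 1)) * (ρ a⁻¹ * ρ b⁻¹) := by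
        have e1 : (ρ a - 1) * (ρ b - 1) - (ρ b - 1) * (ρ a - 1) = ρ a * ρ b - ρ b * ρ a := by
          noncomm_ring
        rw [e1, sub_mul, map_mul, map_mul, map_mul]
        have e2 : ρ b * ρ a * (ρ a⁻¹ * ρ b⁻¹) = ρ b * (ρ a * ρ a⁻¹) * ρ b⁻¹ := by noncomm_ring
        rw [e2, hm, mul_one, hm]
        noncomm_ring
      rw [e]
      have n1 := norm_mul_le ((ρ a - 1) * (ρ b - 1) - (ρ b - 1) * (ρ a - 1)) (ρ a⁻¹ * ρ b⁻¹)
      have n2 := norm_sub_le ((ρ a - 1) * (ρ b - 1)) ((ρ b - 1) * (ρ a - 1))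
      have n3 := norm_mul_le (ρ a - 1) (ρ b - 1)
      have n4 := norm_mul_le (ρ b - 1) (ρ a - 1)
      have n5 := norm_mul_le (ρ a⁻¹) (ρ b⁻¹)
      have n6 := hb _ ha
      have n7 := hb _ hb'
      have n8 : ‖ρ a⁻¹ * ρ b⁻¹‖ ≤ 3/2 := by
        refine n5.trans ?_
        nlinarith [norm_nonneg (ρ a⁻¹), norm_nonneg (ρ b⁻¹)]
      have n9 : ‖(ρ a - 1) * (ρ b - 1) - (ρ b - 1) * (ρ a - 1)‖ ≤ 2 * (‖ρ a - 1‖ * ‖ρ b - 1‖) := by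
        linarith
      calc _ ≤ _ := n1
        _ ≤ (2 * (‖ρ a - 1‖ * ‖ρ b - 1‖)) * (3/2) := by gcongr
        _ = _ := by ring
    have hs1 := (le_max_left _ _).trans hs
    have hs2 := (le_max_right _ _).trans hs
    have hx1 := (le_max_left _ _).trans hx
    have hx2 := (le_max_right _ _).trans hx
    have hxm := le_max_left ‖ρ x - 1‖ ‖ρ x⁻¹ - 1‖
    apply max_le
    · have := key s x hs2 hx2
      nlinarith [norm_nonneg (ρ x - 1)]
    · have e : (s * x * s⁻¹ * x⁻¹)⁻¹ = x * s * x⁻¹ * s⁻¹ := by group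
      rw [e]
      have := key x s hx2 hs2
      nlinarith [norm_nonneg (ρ x - 1)]
  · intro g hg i
    have h1 := (linf_entry _ (Sum.inl i) (Sum.inl i)).trans ((le_max_left _ _).trans hg)
    rw [Matrix.sub_apply, e11, one_apply_eq] at h1
    have h2 : w i * c.L g i i * (w i)⁻¹ = c.L g i i := by have := (hw i).ne'; field_simp
    rw [h2] at h1
    linarith [(abs_le.mp h1).1]
  · intro g h1 h2 h3 h4
    have key : ∀ g, (∀ i j, |w i * c.L g i j * (w j)⁻¹ - (1 : M3) i j| ≤ 1/64) → 
        (∀ i, |w i * c.b g i| ≤ 1/64) → ‖ρ g - 1‖ ≤ 1/16 := by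
      intro g h1 h3
      refine (linf_le _ (e := 1/64) (by norm_num) ?_).trans (by simp; norm_num)
      intro i j
      rcases i with i | i <;> rcases j with j | j
      · rw [Matrix.sub_apply, e11]
        have : (1 : Matrix (Fin 3 ⊕ Unit) (Fin 3 ⊕ Unit) ℝ) (Sum.inl i) (Sum.inl j) = (1 : M3) i j := by
          simp [one_apply]
        rw [this]; exact h1 i j
      · rw [Matrix.sub_apply, e12]; simpa using h3 i
      · rw [Matrix.sub_apply, e21]; simp
      · rw [Matrix.sub_apply, e22]; simp
    exact max_le (key g h1 h3) (key _ h2 h4)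

end Crys

end FG3
end Part7

section Part8
open Matrix
set_option linter.all false
namespace FG3
attribute [local instance] Matrix.linftyOpNormedRing Matrix.linftyOpNormedAlgebra

section disc
variable {G : Type} [Group G] {n : Type} [Fintype n] [DecidableEq n]
open Filter Topology

theorem disc (A A' : G →* Matrix n n ℝ) (s : G → ℝ) (hs : ∀ g, A' g = s g • A g) (hs0 : ∀ g h, s (g * h) = s g * s h)
    (hs1 : s 1 = 1)
    {ε : ℝ} (hε : 0 < ε) (hZ : ∀ g, Near A ε g → g = 1)
    (T : Finset G) (hT : {γ | ∀ a ∈ T, γ * a = a * γ}.Finite) (R : ℝ) :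
    {γ | ‖A' γ‖ ≤ R ∧ ‖A' γ⁻¹‖ ≤ R}.Finite := by
  by_contra hinf
  have hinf : {γ | ‖A' γ‖ ≤ R ∧ ‖A' γ⁻¹‖ ≤ R}.Infinite := hinf
  set u := hinf.natEmbedding with hu
  haveI : ProperSpace (Matrix n n ℝ) := FiniteDimensional.proper ℝ _
  haveI : FirstCountableTopology (Matrix n n ℝ) := (inferInstance : FirstCountableTopology (n → n → ℝ))
  have hK : IsCompact ((Metric.closedBall (0 : Matrix n n ℝ) R) ×ˢ (Metric.closedBall (0 : Matrix n n ℝ) R)) :=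
    (isCompact_closedBall _ _).prod (isCompact_closedBall _ _)
  obtain ⟨⟨B, B'⟩, -, φ, hφ, hlim⟩ := hK.tendsto_subseq
    (x := fun k => (A' (u k).1, A' (u k).1⁻¹)) (fun k => by
      have := (u k).2
      exact ⟨by simpa using this.1, by simpa using this.2⟩)
  set γ : ℕ → G := fun k => (u (φ k)).1 with hγ
  have hγi : Function.Injective γ := fun a b h => hφ.injective (u.injective (Subtype.ext h))
  have hB : Tendsto (fun k => A' (γ k)) atTop (𝓝 B) := (continuous_fst.tendsto _).comp hlim
  have hB' : Tendsto (fun k => A' (γ k)⁻¹) atTop (𝓝 B') := (continuous_snd.tendsto _).comp hlim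
  have hBB : B' * B = 1 := by
    have h1 := hB'.mul hB
    have h2 : (fun k => A' (γ k)⁻¹ * A' (γ k)) = fun _ => 1 := by ext1 k; exact hom_inv_mul A' _
    rw [h2] at h1
    exact (tendsto_nhds_unique tendsto_const_nhds h1).symm
  have hcomm : ∀ x y, A (x * y * x⁻¹ * y⁻¹) = A' (x * y * x⁻¹ * y⁻¹) := by
    intro x y
    rw [hs]
    have e1 : s x * s x⁻¹ = 1 := by rw [← hs0, mul_inv_cancel, hs1]
    have e2 : s y * s y⁻¹ = 1 := by rw [← hs0, mul_inv_cancel, hs1]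
    have : s (x * y * x⁻¹ * y⁻¹) = 1 := by
      rw [hs0, hs0, hs0]
      linear_combination s y * s y⁻¹ * e1 + e2
    rw [this, one_smul]
  have hk1 : Tendsto (fun p : ℕ × ℕ => A' (γ p.1)) (atTop ×ˢ atTop) (𝓝 B) := hB.comp tendsto_fst
  have hk2 : Tendsto (fun p : ℕ × ℕ => A' (γ p.1)⁻¹) (atTop ×ˢ atTop) (𝓝 B') := hB'.comp tendsto_fst
  have hj1 : Tendsto (fun p : ℕ × ℕ => A' (γ p.2)) (atTop ×ˢ atTop) (𝓝 B) := hB.comp tendsto_snd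
  have hj2 : Tendsto (fun p : ℕ × ℕ => A' (γ p.2)⁻¹) (atTop ×ˢ atTop) (𝓝 B') := hB'.comp tendsto_snd
  have hBB' : B * B' = 1 := mul_eq_one_comm.mp hBB
  have hev : ∀ a ∈ T, ∀ᶠ p : ℕ × ℕ in atTop ×ˢ atTop,
      ((γ p.1)⁻¹ * γ p.2) * a = a * ((γ p.1)⁻¹ * γ p.2) := by
    intro a _
    have t1 : Tendsto (fun p : ℕ × ℕ => A ((γ p.1)⁻¹ * γ p.2 * a * ((γ p.1)⁻¹ * γ p.2)⁻¹ * a⁻¹))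
        (atTop ×ˢ atTop) (𝓝 1) := by
      have h := ((((hk2.mul hj1).mul (tendsto_const_nhds (x := A' a))).mul (hj2.mul hk1)).mul
        (tendsto_const_nhds (x := A' a⁻¹)))
      have e : B' * B * A' a * (B' * B) * A' a⁻¹ = 1 := by
        rw [hBB, one_mul, mul_one, hom_mul_inv]
      rw [e] at h
      refine h.congr fun p => ?_
      rw [hcomm]
      simp only [map_mul, _root_.mul_inv_rev, inv_inv]
    have t2 : Tendsto (fun p : ℕ × ℕ => A ((γ p.1)⁻¹ * γ p.2 * a * ((γ p.1)⁻¹ * γ p.2)⁻¹ * a⁻¹)⁻¹)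
        (atTop ×ˢ atTop) (𝓝 1) := by
      have h := (((tendsto_const_nhds (x := A' a)).mul (hk2.mul hj1)).mul
        (tendsto_const_nhds (x := A' a⁻¹))).mul (hj2.mul hk1)
      have e : A' a * (B' * B) * A' a⁻¹ * (B' * B) = 1 := by
        rw [hBB, mul_one, mul_one, hom_mul_inv]
      rw [e] at h
      refine h.congr fun p => ?_
      have e : ((γ p.1)⁻¹ * γ p.2 * a * ((γ p.1)⁻¹ * γ p.2)⁻¹ * a⁻¹)⁻¹ =
        a * ((γ p.1)⁻¹ * γ p.2) * a⁻¹ * ((γ p.1)⁻¹ * γ p.2)⁻¹ := by group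
      rw [e, hcomm]
      simp only [map_mul, _root_.mul_inv_rev, inv_inv]
    have n1 := (tendsto_iff_norm_sub_tendsto_zero.mp t1).eventually_le_const hε
    have n2 := (tendsto_iff_norm_sub_tendsto_zero.mp t2).eventually_le_const hε
    filter_upwards [n1, n2] with p h1 h2
    have := hZ _ ⟨?_, h1, h2⟩
    · have e : ((γ p.1)⁻¹ * γ p.2) * a = ((γ p.1)⁻¹ * γ p.2 * a * ((γ p.1)⁻¹ * γ p.2)⁻¹ * a⁻¹) *
          (a * ((γ p.1)⁻¹ * γ p.2)) := by group
      rw [e, this, one_mul]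
    · have h1 := congrArg Matrix.det (hom_mul_inv A ((γ p.1)⁻¹ * γ p.2))
      have h2 := congrArg Matrix.det (hom_mul_inv A a)
      rw [det_mul, det_one] at h1 h2
      rw [map_mul _ _ a⁻¹, map_mul _ _ ((γ p.1)⁻¹ * γ p.2)⁻¹, map_mul _ _ a, det_mul, det_mul, det_mul]
      linear_combination (A a).det * (A a⁻¹).det * h1 + h2
  have hev2 := (Filter.eventually_all_finset T).mpr hev
  rw [prod_atTop_atTop_eq, eventually_atTop] at hev2
  obtain ⟨⟨k1, k2⟩, hk⟩ := hev2
  have hinj : Set.InjOn (fun j => (γ k1)⁻¹ * γ j) (Set.Ici k2) := fun a _ b _ h =>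
    hγi (mul_left_cancel h)
  exact (Set.Ici_infinite k2) (Set.Finite.of_finite_image
    (hT.subset (by rintro _ ⟨j, hj, rfl⟩; exact hk (k1, j) ⟨le_rfl, hj⟩)) hinj)

end disc

namespace Crys
namespace Line
variable {G : Type} [Group G] {c : Crys G} (l : c.Line)
include l

/-- normalized commuting families of two by two matrices are scalar -/
theorem H2 (Z : Set M2) (hcomm : ∀ z ∈ Z, ∀ z' ∈ Z, z * z' = z' * z)
    (hn : ∀ g, ∀ z ∈ Z, c.lineA l.h10 l.h20 g * z * c.lineA l.h10 l.h20 g⁻¹ ∈ Z) (z : M2) (hz : z ∈ Z) :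
    ∃ r : ℝ, z = r • (1 : M2) := by
  set A := c.lineA l.h10 l.h20 with hA
  by_contra hns
  have hnz : z 0 1 ≠ 0 ∨ z 1 0 ≠ 0 ∨ z 0 0 ≠ z 1 1 := by
    by_contra h
    push Not at h
    apply hns
    refine ⟨z 0 0, ?_⟩
    ext i j
    fin_cases i <;> fin_cases j <;> simp [h.1, h.2.1, ← h.2.2]
  -- the commutant of z
  have par : ∀ y : M2, y * z = z * y → ∃ p q : ℝ, y = p • (1 : M2) + q • z := by
    intro y hy
    have h00 := congrFun (congrFun hy 0) 0
    have h01 := congrFun (congrFun hy 0) 1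
    have h10 := congrFun (congrFun hy 1) 0
    simp only [mul_apply, Fin.sum_univ_two] at h00 h01 h10
    rcases hnz with h | h | h
    · refine ⟨y 0 0 - y 0 1 / z 0 1 * z 0 0, y 0 1 / z 0 1, ?_⟩
      ext i j
      fin_cases i <;> fin_cases j <;> simp <;> field_simp <;> linarith
    · refine ⟨y 0 0 - y 1 0 / z 1 0 * z 0 0, y 1 0 / z 1 0, ?_⟩
      ext i j
      fin_cases i <;> fin_cases j <;> simp <;> field_simp <;> linarith
    · have h' := sub_ne_zero.mpr h
      refine ⟨y 0 0 - (y 0 0 - y 1 1) / (z 0 0 - z 1 1) * z 0 0, (y 0 0 - y 1 1) / (z 0 0 - z 1 1), ?_⟩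
      ext i j
      fin_cases i <;> fin_cases j <;> simp <;> field_simp <;> linarith
  have htr : ∀ g, (A g * z * A g⁻¹).trace = z.trace := by
    intro g; rw [trace_mul_comm, ← mul_assoc, hom_inv_mul, one_mul]
  have hdet : ∀ g, (A g * z * A g⁻¹).det = z.det := by
    intro g
    have := congrArg Matrix.det (hom_mul_inv A g)
    rw [det_mul, det_one] at this
    rw [det_mul, det_mul]
    linear_combination z.det * this
  have hpq : ∀ g, ∃ p q : ℝ, A g * z * A g⁻¹ = p • (1 : M2) + q • z := fun g =>
    par _ (hcomm _ (hn g z hz) _ hz)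
  by_cases hD : z.trace ^ 2 = 4 * z.det
  · -- nilpotent traceless part
    set t := z.trace / 2 with ht
    have hN : ∀ g, ∃ q : ℝ, (z - t • 1) * A g = q • (A g * (z - t • (1 : M2))) := by
      intro g
      obtain ⟨p, q, h⟩ := hpq g⁻¹
      refine ⟨q, ?_⟩
      have h1 := htr g⁻¹
      rw [h] at h1
      rw [inv_inv] at h
      have h2 : p + q * t = t := by
        simp [trace_fin_two] at h1 ht
        rw [ht]; linear_combination h1 / 2
      have h3 := congrArg (fun X => A g * X) h
      beta_reduce at h3
      rw [← mul_assoc, ← mul_assoc, hom_mul_inv, one_mul] at h3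
      rw [sub_mul, h3, mul_add, mul_sub, mul_smul_comm, mul_smul_comm, mul_smul_comm, mul_one, smul_mul_assoc, one_mul, smul_sub, smul_smul]
      have hp : p = t - q * t := by linarith
      rw [hp]
      module
    have hN2 : (z 0 0 - t) ^ 2 + z 0 1 * z 1 0 = 0 := by
      rw [det_fin_two, trace_fin_two] at hD
      rw [trace_fin_two] at ht
      rw [ht]; linear_combination hD / 4
    have ht2 : z 0 0 - t = - (z 1 1 - t) := by rw [ht, trace_fin_two]; ring
    have : ∃ v : Fin 2 → ℝ, v ≠ 0 ∧ (z - t • 1) *ᵥ v = 0 := by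
      apply Matrix.exists_mulVec_eq_zero_iff.mpr
      rw [det_fin_two]
      simp
      have : z 1 1 - t = -(z 0 0 - t) := by linarith
      rw [this]; linarith
    obtain ⟨v, hv, hv0⟩ := this
    obtain ⟨g, hg⟩ := l.no_eig hv
    obtain ⟨q, hq⟩ := hN g
    have h4 : (z - t • 1) *ᵥ (A g *ᵥ v) = 0 := by
      rw [mulVec_mulVec, hq, smul_mulVec, ← mulVec_mulVec, hv0, mulVec_zero, smul_zero]
    have hp : ∀ u : Fin 2 → ℝ, (z - t • 1) *ᵥ u = 0 → (z 0 0 - t) * u 0 + z 0 1 * u 1 = 0 ∧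
        z 1 0 * u 0 + (z 1 1 - t) * u 1 = 0 := by
      intro u hu
      have h0 := congrFun hu 0
      have h1 := congrFun hu 1
      simp [Matrix.mulVec, dotProduct, Fin.sum_univ_two] at h0 h1
      exact ⟨h0, h1⟩
    obtain ⟨a1, a2⟩ := hp v hv0
    obtain ⟨b1, b2⟩ := hp _ h4
    simp [Matrix.mulVec, dotProduct, Fin.sum_univ_two, hA, lineA] at b1 b2
    apply hg
    set u0 := c.L g 1 1 * v 0 + c.L g 1 2 * v 1
    set u1 := c.L g 2 1 * v 0 + c.L g 2 2 * v 1
    rcases hnz with h | h | h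
    · apply mul_left_cancel₀ h
      linear_combination v 0 * b1 - u0 * a1
    · apply mul_left_cancel₀ h
      linear_combination - v 1 * b2 + u1 * a2
    · have h' : z 0 0 - t ≠ 0 := by
        intro h5; apply h; linarith
      apply mul_left_cancel₀ h'
      linear_combination - v 1 * b1 + u1 * a1
  · -- semisimple
    have hq2 : ∀ g, A g * z * A g⁻¹ = z ∨ A g * z * A g⁻¹ = z.trace • (1 : M2) - z := by
      intro g
      obtain ⟨p, q, h⟩ := hpq g
      have h1 := htr g
      have h2 := hdet g
      rw [h] at h1 h2
      have h1' : 2 * p + q * z.trace = z.trace := by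
        simp [trace_fin_two] at h1 ⊢; linear_combination h1
      have h2' : p ^ 2 + p * q * z.trace + q ^ 2 * z.det = z.det := by
        simp [det_fin_two, trace_fin_two] at h2 ⊢; linear_combination h2
      have hq : (q - 1) * (q + 1) = 0 := by
        apply mul_left_cancel₀ (sub_ne_zero.mpr hD)
        have hp : p = (z.trace - q * z.trace) / 2 := by linarith
        rw [hp] at h2'
        linear_combination -4 * h2'
      rcases mul_eq_zero.mp hq with hq | hq
      · left
        have hq : q = 1 := by linarith
        rw [hq] at h1'
        have hp : p = 0 := by linarith
        rw [h, hp, hq]; simp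
      · right
        have hq : q = -1 := by linarith
        rw [hq] at h1'
        have hp : p = z.trace := by linarith
        rw [h, hp, hq]; module
    have hc : ∀ g, A g * z * A g⁻¹ = z := by
      intro g
      have hpol : (fun g => (A g * z * A g⁻¹ * z).trace) ∈ c.Pol := by
        have e : (fun g => (A g * z * A g⁻¹ * z).trace) = fun g =>
            ∑ i : Fin 2, ∑ x : Fin 2, ∑ y : Fin 2, ∑ w : Fin 2,
              A g i w * z w y * A g⁻¹ y x * z x i := by
          ext g
          simp only [trace, diag, mul_apply, Finset.sum_mul]
        rw [e]
        have pA : ∀ i j : Fin 2, (fun g => A g i j) ∈ c.Pol := by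
          intro i j
          fin_cases i <;> fin_cases j <;> simp [hA, lineA] <;> exact c.pol_L _ _
        have pAi : ∀ i j : Fin 2, (fun g => A g⁻¹ i j) ∈ c.Pol := by
          intro i j
          fin_cases i <;> fin_cases j <;> simp [hA, lineA] <;> exact c.pol_Li _ _
        refine c.pol_sum _ fun i => c.pol_sum _ fun x => c.pol_sum _ fun y => c.pol_sum _ fun w => ?_
        exact c.pol_mul (c.pol_mul (c.pol_mul (pA _ _) (c.pol_const _)) (pAi _ _)) (c.pol_const _)
      have hval := l.hI.finite_values' hpol (T := {(z * z).trace, ((z.trace • (1 : M2) - z) * z).trace})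
        (by simp) (fun g => by
          rcases hq2 g with h | h
          · left; rw [h]
          · right; rw [h]; rfl) g
      beta_reduce at hval
      rw [inv_one, map_one, one_mul, mul_one] at hval
      rcases hq2 g with h | h
      · exact h
      · exfalso
        rw [h] at hval
        apply hD
        simp [trace_fin_two, det_fin_two, mul_apply, Fin.sum_univ_two] at hval ⊢
        linear_combination -hval
    obtain ⟨α, β, hne⟩ := l.ns
    apply hne
    have hcg : ∀ g, A g * z = z * A g := by
      intro g
      have := congrArg (fun X => X * A g) (hc g)
      beta_reduce at this
      rwa [mul_assoc, hom_inv_mul, mul_one] at this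
    obtain ⟨p, q, h1⟩ := par _ (hcg α)
    have hab : A α * A β = A β * A α := by
      rw [h1, add_mul, mul_add, smul_mul_assoc, smul_mul_assoc, mul_smul_comm, mul_smul_comm, hcg, one_mul, mul_one]
    rw [l.tr]
    have : A (α * β * α⁻¹ * β⁻¹) = 1 := by
      rw [map_mul, map_mul, map_mul, hab, mul_assoc (A β), hom_mul_inv, mul_one, hom_mul_inv]
    rw [← hA, this]
    simp; norm_num

end Line
end Crys
end FG3
end Part8

section Part9
open Matrix
set_option linter.all false
namespace FG3
attribute [local instance] Matrix.linftyOpNormedRing Matrix.linftyOpNormedAlgebra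

theorem comm2 {x y z : M2} (hx : x * z = z * x) (hy : y * z = z * y) (hxy : x * y ≠ y * x) :
    ∃ r : ℝ, z = r • (1 : M2) := by
  by_contra hns
  have hnz : z 0 1 ≠ 0 ∨ z 1 0 ≠ 0 ∨ z 0 0 ≠ z 1 1 := by
    by_contra h
    push Not at h
    apply hns
    refine ⟨z 0 0, ?_⟩
    ext i j
    fin_cases i <;> fin_cases j <;> simp [h.1, h.2.1, ← h.2.2]
  have par : ∀ y : M2, y * z = z * y → ∃ p q : ℝ, y = p • (1 : M2) + q • z := by
    intro y hy
    have h00 := congrFun (congrFun hy 0) 0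
    have h01 := congrFun (congrFun hy 0) 1
    have h10 := congrFun (congrFun hy 1) 0
    simp only [mul_apply, Fin.sum_univ_two] at h00 h01 h10
    rcases hnz with h | h | h
    · refine ⟨y 0 0 - y 0 1 / z 0 1 * z 0 0, y 0 1 / z 0 1, ?_⟩
      ext i j
      fin_cases i <;> fin_cases j <;> simp <;> field_simp <;> linarith
    · refine ⟨y 0 0 - y 1 0 / z 1 0 * z 0 0, y 1 0 / z 1 0, ?_⟩
      ext i j
      fin_cases i <;> fin_cases j <;> simp <;> field_simp <;> linarith
    · have h' := sub_ne_zero.mpr h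
      refine ⟨y 0 0 - (y 0 0 - y 1 1) / (z 0 0 - z 1 1) * z 0 0, (y 0 0 - y 1 1) / (z 0 0 - z 1 1), ?_⟩
      ext i j
      fin_cases i <;> fin_cases j <;> simp <;> field_simp <;> linarith
  obtain ⟨p, q, h1⟩ := par x hx
  apply hxy
  rw [h1, add_mul, mul_add, smul_mul_assoc, smul_mul_assoc, mul_smul_comm, mul_smul_comm, hy, one_mul, mul_one]

namespace Crys
variable {G : Type} [Group G] (c : Crys G)

theorem exists_bound (S : Finset G) : ∃ B : ℝ, 1 ≤ B ∧ ∀ s ∈ S, (∀ i j, |c.L s i j| ≤ B) ∧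
    (∀ i j, |c.L s⁻¹ i j| ≤ B) ∧ (∀ i, |c.b s i| ≤ B) ∧ (∀ i, |c.b s⁻¹ i| ≤ B) := by
  set f : G → ℝ := fun s => ‖c.L s‖ + ‖c.L s⁻¹‖ + ‖c.b s‖ + ‖c.b s⁻¹‖ with hf
  have hf0 : ∀ s, 0 ≤ f s := fun s => by positivity
  refine ⟨1 + ∑ s ∈ S, f s, le_add_of_nonneg_right (Finset.sum_nonneg fun s _ => hf0 s), fun s hs => ?_⟩
  have h1 : f s ≤ ∑ s ∈ S, f s := Finset.single_le_sum (fun s _ => hf0 s) hs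
  have a1 := norm_nonneg (c.L s)
  have a2 := norm_nonneg (c.L s⁻¹)
  have a3 := norm_nonneg (c.b s)
  have a4 := norm_nonneg (c.b s⁻¹)
  simp only [hf] at h1
  refine ⟨fun i j => (linf_entry _ i j).trans ?_, fun i j => (linf_entry _ i j).trans ?_,
    fun i => (norm_le_pi_norm (c.b s) i).trans ?_, fun i => (norm_le_pi_norm (c.b s⁻¹) i).trans ?_⟩ <;>
  linarith

namespace Line
variable {c} (l : c.Line)
include l

theorem zass : ∃ ε > 0, ∀ g, Near (c.lineA l.h10 l.h20) ε g → g = 1 := by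
  set A := c.lineA l.h10 l.h20 with hA
  refine FG3.zass (0 : Fin 2) A (fun g hg => l.nu_trivial ((l.sc_iff g 1).mpr (by rw [← hA, hg, one_smul])))
    l.H2 (ε0 := 1/64) (by norm_num) ?_
  intro S hS
  obtain ⟨B, hB1, hB⟩ := c.exists_bound S
  set η := 1 / (64 * B) with hη
  have hη0 : 0 < η := by positivity
  have hηB : η * B = 1/64 := by rw [hη]; field_simp
  have hη1 : η ≤ 1 := by nlinarith
  obtain ⟨d, h1, h2, h3, h4, h5⟩ := c.exists_d ![η ^ 2, η, η] (by
    intro i; fin_cases i <;> simp <;> positivity)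
  refine ⟨d, h1, h2, ?_, h3, fun g hg => h4 g hg 1⟩
  intro s hs
  obtain ⟨b1, b2, b3, b4⟩ := hB s hs
  obtain ⟨-, n1, n2⟩ := hS s hs
  have key : ∀ s, (∀ i j, |c.L s i j| ≤ B) → ‖A s - 1‖ ≤ 1/64 →
      ∀ i j, |![η ^ 2, η, η] i * c.L s i j * (![η ^ 2, η, η] j)⁻¹ - (1 : M3) i j| ≤ 1/64 := by
    intro s b n i j
    have e11 := (linf_entry (A s - 1) 0 0).trans n
    have e12 := (linf_entry (A s - 1) 0 1).trans n
    have e21 := (linf_entry (A s - 1) 1 0).trans n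
    have e22 := (linf_entry (A s - 1) 1 1).trans n
    have b01 := b 0 1
    have b02 := b 0 2
    simp [hA, lineA] at e11 e12 e21 e22
    fin_cases i <;> fin_cases j
    · simp [l.h00]; rw [mul_inv_cancel₀ (by positivity)]; simp
    · simp [-abs_mul, -abs_inv]
      have : η ^ 2 * c.L s 0 1 * η⁻¹ = η * c.L s 0 1 := by field_simp
      rw [this, abs_mul, abs_of_pos hη0]; nlinarith
    · simp [-abs_mul, -abs_inv]
      have : η ^ 2 * c.L s 0 2 * η⁻¹ = η * c.L s 0 2 := by field_simp
      rw [this, abs_mul, abs_of_pos hη0]; nlinarith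
    · simp [l.h10]
    · simp [-abs_mul, -abs_inv]
      have : η * c.L s 1 1 * η⁻¹ = c.L s 1 1 := by field_simp
      rw [this]; linarith
    · simp [-abs_mul, -abs_inv]
      have : η * c.L s 1 2 * η⁻¹ = c.L s 1 2 := by field_simp
      rw [this]; linarith
    · simp [l.h20]
    · simp [-abs_mul, -abs_inv]
      have : η * c.L s 2 1 * η⁻¹ = c.L s 2 1 := by field_simp
      rw [this]; linarith
    · simp [-abs_mul, -abs_inv]
      have : η * c.L s 2 2 * η⁻¹ = c.L s 2 2 := by field_simp
      rw [this]; linarith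
  have keyb : ∀ s, (∀ i, |c.b s i| ≤ B) → ∀ i, |![η ^ 2, η, η] i * c.b s i| ≤ 1/64 := by
    intro s b i
    have b0 := b i
    rw [abs_mul]
    have : |![η ^ 2, η, η] i| ≤ η := by
      fin_cases i
      · simp; nlinarith
      · simp [abs_of_pos hη0]
      · simp [abs_of_pos hη0]
    calc _ ≤ η * B := by gcongr
      _ = _ := hηB
  exact h5 s (key s b1 n1) (key _ b2 n2) (keyb s b3) (keyb _ b4)

theorem disc (R : ℝ) : {γ | ∀ i j, (c.lineA l.h10 l.h20 γ i j) ^ 2 ≤ R * |(c.lineA l.h10 l.h20 γ).det|}.Finite := by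
  set A := c.lineA l.h10 l.h20 with hA
  obtain ⟨ε, hε, hZ⟩ := l.zass
  obtain ⟨α, β, hne⟩ := l.ns
  have hdet : ∀ g, (A g).det ≠ 0 := by
    intro g h
    have := congrArg Matrix.det (hom_mul_inv A g)
    rw [det_mul, h, det_one, zero_mul] at this
    norm_num at this
  have hab : A α * A β ≠ A β * A α := by
    intro hab
    apply hne
    have : A (α * β * α⁻¹ * β⁻¹) = 1 := by
      rw [map_mul, map_mul, map_mul, hab, mul_assoc (A β), hom_mul_inv, mul_one, hom_mul_inv]
    rw [l.tr, ← hA, this]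
    simp; norm_num
  classical
  set s : G → ℝ := fun g => (Real.sqrt |(A g).det|)⁻¹ with hs
  have hsm : ∀ g h, s (g * h) = s g * s h := by
    intro g h
    simp only [hs]
    rw [map_mul, det_mul, abs_mul, Real.sqrt_mul (abs_nonneg _), mul_inv]
  have hs1 : s 1 = 1 := by simp [hs]
  set A' : G →* M2 := 
    { toFun := fun g => s g • A g
      map_one' := by rw [hs1, map_one, one_smul]
      map_mul' := fun g h => by rw [hsm, map_mul, smul_mul_smul_comm] } with hA'
  have hA's : ∀ g, A' g = s g • A g := fun g => rfl
  have hT : {γ | ∀ a ∈ ({α, β} : Finset G), γ * a = a * γ}.Finite := by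
    have hN : {γ | ∃ r, SC c γ r}.Finite := by
      by_cases hm : ∃ m, SC c m (-1)
      · obtain ⟨m, hm⟩ := hm
        refine (Set.toFinite {1, m⁻¹}).subset ?_
        rintro γ ⟨r, hr⟩
        have h2 := l.scalar_sq hr
        have : (r - 1) * (r + 1) = 0 := by linarith
        rcases mul_eq_zero.mp this with h | h
        · left
          have : r = 1 := by linarith
          subst this
          exact l.nu_trivial hr
        · right
          have : r = -1 := by linarith
          subst this
          have := l.sc_mul hr hm
          norm_num at this
          have := l.nu_trivial this
          exact eq_inv_of_mul_eq_one_left this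
      · refine (Set.toFinite {1}).subset ?_
        rintro γ ⟨r, hr⟩
        have h2 := l.scalar_sq hr
        have : (r - 1) * (r + 1) = 0 := by linarith
        rcases mul_eq_zero.mp this with h | h
        · have : r = 1 := by linarith
          subst this
          exact l.nu_trivial hr
        · have : r = -1 := by linarith
          subst this
          exact (hm ⟨_, hr⟩).elim
    refine hN.subset ?_
    intro γ hγ
    have h1 := congrArg A (hγ α (by simp))
    have h2 := congrArg A (hγ β (by simp))
    rw [map_mul, map_mul] at h1 h2
    obtain ⟨r, hr⟩ := comm2 h1.symm h2.symm hab
    exact ⟨r, (l.sc_iff γ r).mpr hr⟩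
  have := FG3.disc A A' s hA's hsm hs1 hε hZ {α, β} hT (2 * Real.sqrt R)
  refine this.subset ?_
  intro γ hγ
  have hd : 0 < |(A γ).det| := abs_pos.mpr (hdet γ)
  have hsq : 0 < Real.sqrt |(A γ).det| := Real.sqrt_pos.mpr hd
  have hsq2 := Real.sq_sqrt hd.le
  have hR : 0 ≤ R := by
    by_contra h
    have := hγ 0 0
    nlinarith [sq_nonneg (A γ 0 0)]
  have hent : ∀ i j, |A' γ i j| ≤ Real.sqrt R := by
    intro i j
    apply Real.abs_le_sqrt
    rw [hA's, Matrix.smul_apply, smul_eq_mul]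
    simp only [hs]
    rw [mul_pow, inv_pow, hsq2, inv_mul_le_iff₀ hd]
    linarith [hγ i j]
  have hsR := Real.sqrt_nonneg R
  refine ⟨(linf_le _ hsR hent).trans (by simp), (linf_le _ hsR ?_).trans (by simp)⟩
  -- inverse
  have hAd : |(A' γ).det| = 1 := by
    rw [hA's, det_smul, Fintype.card_fin, abs_mul]
    simp only [hs]
    rw [inv_pow, hsq2, abs_inv, abs_abs, inv_mul_cancel₀ hd.ne']
  have hinv : (A' γ).adjugate = (A' γ).det • A' γ⁻¹ := by
    have h1 := adjugate_mul (A' γ)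
    calc _ = (A' γ).adjugate * (A' γ * A' γ⁻¹) := by rw [hom_mul_inv, mul_one]
      _ = _ := by rw [← mul_assoc, h1, smul_mul_assoc, one_mul]
  intro i j
  have h3 : |(A' γ).adjugate i j| = |A' γ⁻¹ i j| := by
    rw [hinv, Matrix.smul_apply, smul_eq_mul, abs_mul, hAd, one_mul]
  rw [← h3, adjugate_fin_two]
  fin_cases i <;> fin_cases j
  · simpa using hent 1 1
  · simpa using hent 0 1
  · simpa using hent 1 0
  · simpa using hent 0 0

end Line
end Crys
end FG3
end Part9

section Part10
open Matrix
set_option linter.all false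
namespace FG3

/-- a real matrix of size three has a real eigenvalue -/
theorem exists_eig (φ : Module.End ℝ V3) : ∃ (r : ℝ) (v : V3), v ≠ 0 ∧ φ v = r • v := by
  have hd : φ.charpoly.natDegree = 3 := by rw [LinearMap.charpoly_natDegree]; simp
  have hm := LinearMap.charpoly_monic φ
  have : ∃ r, φ.charpoly.IsRoot r := by
    have h1 := Polynomial.tendsto_atTop_of_leadingCoeff_nonneg φ.charpoly
      (by rw [← Polynomial.natDegree_pos_iff_degree_pos, hd]; norm_num) (by rw [hm.leadingCoeff]; norm_num)
    set q := φ.charpoly.comp (-Polynomial.X) with hq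
    have hqd : q.natDegree = 3 := by rw [hq, Polynomial.natDegree_comp, hd]; simp
    have hql : q.leadingCoeff = -1 := by
      rw [hq, Polynomial.leadingCoeff_comp (by simp), hd, hm.leadingCoeff]; simp; norm_num
    have h2 := Polynomial.tendsto_atBot_of_leadingCoeff_nonpos q
      (by rw [← Polynomial.natDegree_pos_iff_degree_pos, hqd]; norm_num) (by rw [hql]; norm_num)
    obtain ⟨a, ha⟩ := (h1.eventually_ge_atTop 0).exists
    obtain ⟨b, hb⟩ := (h2.eventually_le_atBot 0).exists
    rw [hq, Polynomial.eval_comp] at hb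
    obtain ⟨r, hr⟩ := mem_range_of_exists_le_of_exists_ge φ.charpoly.continuous ⟨_, hb⟩ ⟨_, ha⟩
    exact ⟨r, hr⟩
  obtain ⟨r, hr⟩ := this
  obtain ⟨v, hv⟩ := ((Module.End.hasEigenvalue_iff_isRoot_charpoly φ r).mpr hr).exists_hasEigenvector
  exact ⟨r, v, hv.2, hv.apply_eq_smul⟩

namespace Crys
variable {G : Type} [Group G] (c : Crys G)

/-- The irreducible case. -/
structure Irred (c : Crys G) : Prop where
  hI : c.Irr
  nev : ∀ v : V3, v ≠ 0 → ∃ g, ∀ r : ℝ, c.L g *ᵥ v ≠ r • v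
  nel : ∀ w : V3, w ≠ 0 → ∃ g, ∀ r : ℝ, w ᵥ* c.L g ≠ r • w

namespace Irred
variable {c} (l : c.Irred)
include l

theorem inv_sub (p : Submodule ℝ V3) (hp : ∀ g, ∀ x ∈ p, c.L g *ᵥ x ∈ p) (hb : p ≠ ⊥) : p = ⊤ := by
  by_contra ht
  have h3 : Module.finrank ℝ V3 = 3 := by simp
  have hlt := Submodule.finrank_lt ht
  have hpos : 0 < Module.finrank ℝ p := by
    rw [Module.finrank_pos_iff]
    exact Submodule.nontrivial_iff_ne_bot.mpr hb
  rw [h3] at hlt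
  have : Module.finrank ℝ p = 1 ∨ Module.finrank ℝ p = 2 := by omega
  rcases this with h | h
  · obtain ⟨⟨v, hv⟩, hv0, hvs⟩ := finrank_eq_one_iff'.mp h
    have hv0' : v ≠ 0 := fun h => hv0 (by simpa using h)
    obtain ⟨g, hg⟩ := l.nev v hv0'
    obtain ⟨r, hr⟩ := hvs ⟨_, hp g v hv⟩
    exact hg r (by simpa using (congrArg Subtype.val hr).symm)
  · obtain ⟨f, hf, hpf⟩ := Submodule.exists_le_ker_of_lt_top p (lt_top_iff_ne_top.mpr ht)
    set w : V3 := fun i => f (Pi.single i 1) with hw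
    have hfw : ∀ x, f x = w ⬝ᵥ x := by
      intro x
      have hx : x = x 0 • (Pi.single 0 1 : V3) + x 1 • (Pi.single 1 1 : V3) + x 2 • (Pi.single 2 1 : V3) := by
        ext j; fin_cases j <;> simp
      conv_lhs => rw [hx]
      simp only [map_add, map_smul, smul_eq_mul, dotProduct, Fin.sum_univ_three, hw]
      ring
    have hw0 : w ≠ 0 := by
      intro h; apply hf; ext1 i; ext; simp [hfw, h]
    have hker : Module.finrank ℝ (LinearMap.ker f) ≤ 2 := by
      have hk : LinearMap.ker f ≠ ⊤ := fun h => hf (LinearMap.ker_eq_top.mp h)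
      have := Submodule.finrank_lt hk
      rw [h3] at this; omega
    have hpk : p = LinearMap.ker f := Submodule.eq_of_le_of_finrank_le hpf (by omega)
    obtain ⟨g, hg⟩ := l.nel w hw0
    have hww : w ⬝ᵥ w ≠ 0 := fun h => hw0 (dotProduct_self_eq_zero.mp h)
    have hk : ∀ x, w ⬝ᵥ x = 0 → (w ᵥ* c.L g) ⬝ᵥ x = 0 := by
      intro x hx
      have h1 : x ∈ p := by rw [hpk, LinearMap.mem_ker, hfw, hx]
      have h2 := hp g x h1
      rw [hpk, LinearMap.mem_ker, hfw, dotProduct_mulVec] at h2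
      exact h2
    refine hg (((w ᵥ* c.L g) ⬝ᵥ w) / (w ⬝ᵥ w)) ?_
    set u := w ᵥ* c.L g
    ext i
    have := hk (Pi.single i 1 - (w i / (w ⬝ᵥ w)) • w) (by
      rw [dotProduct_sub, dotProduct_smul, smul_eq_mul, dotProduct_single, mul_one]; field_simp; ring)
    rw [dotProduct_sub, dotProduct_smul, smul_eq_mul, dotProduct_single, mul_one] at this
    rw [Pi.smul_apply, smul_eq_mul]
    field_simp at this ⊢; linarith

/-- Burnside -/
theorem burnside : Function.Surjective (MonoidAlgebra.lift ℝ M3 G c.L) := by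
  set Λ := MonoidAlgebra.lift ℝ M3 G c.L with hΛ
  set e : M3 ≃ₐ[ℝ] Module.End ℝ V3 := Matrix.toLinAlgEquiv' with he
  set ρ : MonoidAlgebra ℝ G →ₐ[ℝ] Module.End ℝ V3 := e.toAlgHom.comp Λ with hρ
  have hρg : ∀ g x, ρ (MonoidAlgebra.of ℝ G g) x = c.L g *ᵥ x := by
    intro g x
    simp [hρ, hΛ, he]
  letI mod : Module (MonoidAlgebra ℝ G) V3 := Module.compHom V3 ρ.toRingHom
  have hsm : ∀ (a : MonoidAlgebra ℝ G) (x : V3), a • x = ρ a x := fun a x => rfl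
  have hre : ∀ (r : ℝ) (x : V3), (algebraMap ℝ (MonoidAlgebra ℝ G) r) • x = r • x := by
    intro r x
    rw [hsm, AlgHom.commutes]; rfl
  haveI : Nontrivial V3 := inferInstance
  haveI hsimp : IsSimpleModule (MonoidAlgebra ℝ G) V3 := by
    refine (isSimpleModule_iff _ _).mpr ?_
    refine { eq_bot_or_eq_top := fun p => ?_ }
    by_cases hb : p = ⊥
    · exact Or.inl hb
    right
    let p' : Submodule ℝ V3 :=
      { carrier := p
        add_mem' := fun h h' => p.add_mem h h'
        zero_mem' := p.zero_mem
        smul_mem' := fun r x hx => by rw [← hre]; exact p.smul_mem _ hx }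
    have hp' : ∀ x, x ∈ p' ↔ x ∈ p := fun x => Iff.rfl
    have h1 := l.inv_sub p' (by
      intro g x hx
      rw [hp'] at hx ⊢
      have := p.smul_mem (MonoidAlgebra.of ℝ G g) hx
      rw [hsm] at this
      rw [← hρg]; exact this) (by
      intro h; apply hb; ext x
      rw [← hp', h]; simp)
    ext x
    rw [← hp', h1]; simp
  -- commutant is scalar
  have hcom : ∀ φ : Module.End (MonoidAlgebra ℝ G) V3, ∃ r : ℝ, ∀ x, φ x = r • x := by
    intro φ
    let φ' : Module.End ℝ V3 :=
      { toFun := fun x => φ x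
        map_add' := fun x y => φ.map_add x y
        map_smul' := fun r x => by
          rw [← hre, φ.map_smul, hre]; rfl }
    have hφ' : ∀ x, φ' x = φ x := fun x => rfl
    obtain ⟨r, v, hv, hr⟩ := exists_eig φ'
    refine ⟨r, ?_⟩
    have hk : ∀ x, x ∈ LinearMap.ker (φ' - r • LinearMap.id) ↔ φ' x = r • x := by
      intro x
      rw [LinearMap.mem_ker, LinearMap.sub_apply, sub_eq_zero]; rfl
    have h1 := l.inv_sub (LinearMap.ker (φ' - r • LinearMap.id)) (by
      intro g x hx
      rw [hk] at hx ⊢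
      have h2 : φ' (c.L g *ᵥ x) = c.L g *ᵥ φ' x := by
        have := φ.map_smul (MonoidAlgebra.of ℝ G g) x
        rw [hsm, hsm, hρg, hρg] at this
        exact this
      rw [h2, hx, mulVec_smul]) (by
      intro h
      apply hv
      have := (hk v).mpr hr
      rw [h] at this
      simpa using this)
    intro x
    exact (hk x).mp (by rw [h1]; trivial)
  intro M
  let f : Module.End (Module.End (MonoidAlgebra ℝ G) V3) V3 :=
    { toFun := fun x => M *ᵥ x
      map_add' := fun x y => mulVec_add _ _ _
      map_smul' := fun φ x => by
        obtain ⟨r, hr⟩ := hcom φ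
        rw [RingHom.id_apply, Module.End.smul_def, Module.End.smul_def, hr, hr, mulVec_smul] }
  obtain ⟨y, hy⟩ := jacobson_density f (Finset.univ.image fun i : Fin 3 => (Pi.single i 1 : V3))
  refine ⟨y, ?_⟩
  ext i j
  have := hy (Pi.single j 1) (by simp)
  rw [hsm] at this
  have h2 : f (Pi.single j 1) = M *ᵥ Pi.single j 1 := rfl
  rw [h2] at this
  have h3 : ρ y (Pi.single j 1) = (Λ y) *ᵥ Pi.single j 1 := by simp [hρ, he]
  have h4 := this.trans h3
  rw [mulVec_single_one, mulVec_single_one] at h4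
  exact (congrFun h4 i).symm

end Irred
end Crys
end FG3
end Part10

section Part11
open Matrix
set_option linter.all false
namespace FG3

theorem lift_alg {A B C : Type*} [Ring A] [Ring B] [Ring C] [Algebra ℝ A] [Algebra ℝ B] [Algebra ℝ C]
    (f : A →ₐ[ℝ] B) (hf : Function.Surjective f) (ψ : A →ₐ[ℝ] C) (h : ∀ x, f x = 0 → ψ x = 0) :
    ∃ Φ : B →ₐ[ℝ] C, ∀ x, Φ (f x) = ψ x := by
  have hw : ∀ x y, f x = f y → ψ x = ψ y := by
    intro x y hxy
    rw [← sub_eq_zero, ← map_sub]; exact h _ (by rw [map_sub, hxy, sub_self])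
  have hs : ∀ y, f (Function.surjInv hf y) = y := Function.surjInv_eq hf
  refine ⟨{ toFun := fun y => ψ (Function.surjInv hf y)
            map_one' := ?_
            map_mul' := ?_
            map_zero' := ?_
            map_add' := ?_
            commutes' := ?_ }, ?_⟩
  · rw [← map_one ψ]; exact hw _ _ (by rw [hs, map_one])
  · intro x y
    change ψ _ = ψ _ * ψ _
    rw [← map_mul ψ]; exact hw _ _ (by simp only [map_mul, hs])
  · change ψ _ = 0
    rw [← map_zero ψ]; exact hw _ _ (by rw [hs, map_zero])
  · intro x y
    change ψ _ = ψ _ + ψ _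
    rw [← map_add ψ]; exact hw _ _ (by simp only [map_add, hs])
  · intro r
    change ψ _ = _
    rw [← AlgHom.commutes ψ]; exact hw _ _ (by rw [hs, AlgHom.commutes])
  · intro x
    exact hw _ _ (hs _)

namespace Crys
variable {G : Type} [Group G] (c : Crys G)

/-- contragredient twisted by the determinant -/
noncomputable def cog : G →* M3 where
  toFun g := (c.L g).det • (c.L g⁻¹)ᵀ
  map_one' := by simp
  map_mul' g h := by
    simp only [_root_.mul_inv_rev, map_mul, Matrix.det_mul, transpose_mul, smul_mul_smul_comm]

theorem cog_apply (g : G) : c.cog g = (c.L g).det • (c.L g⁻¹)ᵀ := rfl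

namespace Irred
variable {c} (l : c.Irred)
include l

theorem comm_scalar (M : M3) (h : ∀ g, M * c.L g = c.L g * M) : ∃ r : ℝ, M = r • (1 : M3) := by
  obtain ⟨r, v, hv, hr⟩ := exists_eig (Matrix.toLin' M)
  refine ⟨r, ?_⟩
  have hk : ∀ x, x ∈ LinearMap.ker (Matrix.toLin' M - r • LinearMap.id) ↔ M *ᵥ x = r • x := by
    intro x
    rw [LinearMap.mem_ker, LinearMap.sub_apply, sub_eq_zero]; simp
  have h1 := l.inv_sub (LinearMap.ker (Matrix.toLin' M - r • LinearMap.id)) (by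
    intro g x hx
    rw [hk] at hx ⊢
    rw [mulVec_mulVec, h, ← mulVec_mulVec, hx, mulVec_smul]) (by
    intro hb
    apply hv
    have := (hk v).mpr (by simpa using hr)
    rw [hb] at this
    simpa using this)
  ext i j
  have := congrFun ((hk (Pi.single j 1)).mp (by rw [h1]; trivial)) i
  rw [mulVec_single_one] at this
  simpa [Matrix.one_apply, Pi.single_apply, eq_comm] using this

theorem det_ne (g : G) : (c.L g).det ≠ 0 := by
  intro h
  have : c.L g * c.L g⁻¹ = 1 := by rw [← map_mul]; simp
  have := congrArg Matrix.det this
  rw [Matrix.det_mul, h] at this; simp at this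

theorem nondeg (Z : M3) (h : ∀ g, ((c.L g)ᵀ * Z).trace = 0) : Z = 0 := by
  have h1 : ∀ x, ((MonoidAlgebra.lift ℝ M3 G c.L x)ᵀ * Z).trace = 0 := by
    intro x
    induction x using MonoidAlgebra.induction_linear with
    | zero => simp
    | add f g hf hg => rw [map_add, transpose_add, Matrix.add_mul, trace_add, hf, hg, add_zero]
    | single g r =>
      rw [MonoidAlgebra.lift_single, transpose_smul, Matrix.smul_mul, trace_smul, h, smul_zero]
  obtain ⟨x, hx⟩ := l.burnside Z
  have := h1 x
  rw [hx] at this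
  ext i j
  simp only [Matrix.trace, Matrix.diag, Matrix.mul_apply, Fin.sum_univ_three, transpose_apply] at this
  have hz : ∀ i j, Z i j * Z i j ≥ 0 := fun i j => mul_self_nonneg _
  have : Z i j * Z i j = 0 := by
    have h00 := hz 0 0; have h01 := hz 0 1; have h02 := hz 0 2
    have h10 := hz 1 0; have h11 := hz 1 1; have h12 := hz 1 2
    have h20 := hz 2 0; have h21 := hz 2 1; have h22 := hz 2 2
    fin_cases i <;> fin_cases j <;> simp <;> nlinarith
  simpa using this

theorem col_zero (W : M3) (r : G → ℝ) (h : ∀ g, (c.L g)ᵀ * W = r g • W) : W = 0 := by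
  by_contra hW
  have : ∃ j, Wᵀ j ≠ 0 := by
    by_contra hc
    push Not at hc
    apply hW; ext i j; exact congrFun (hc j) i
  obtain ⟨j, hj⟩ := this
  obtain ⟨g, hg⟩ := l.nel _ hj
  apply hg (r g)
  rw [← mulVec_transpose]
  ext i
  have := congrFun (congrFun (h g) i) j
  simpa [Matrix.mul_apply, mulVec, dotProduct] using this

theorem key (x : MonoidAlgebra ℝ G) (h : G) :
    (c.L h).det * MonoidAlgebra.lift ℝ ℝ G ((Matrix.detMonoidHom).comp c.L) x
      - (c.L h).det * ((c.L h⁻¹)ᵀ * MonoidAlgebra.lift ℝ M3 G c.cog x).trace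
      + (c.L h * MonoidAlgebra.lift ℝ M3 G c.L x).trace
      - MonoidAlgebra.lift ℝ ℝ G (1 : G →* ℝ) x = 0 := by
  induction x using MonoidAlgebra.induction_linear with
  | zero => simp
  | add f g hf hg =>
    simp only [map_add, Matrix.mul_add, trace_add]
    linear_combination hf + hg
  | single g r =>
    simp only [MonoidAlgebra.lift_single, Matrix.mul_smul, trace_smul, smul_eq_mul, cog_apply,
      MonoidHom.comp_apply, MonoidHom.one_apply, Matrix.coe_detMonoidHom]
    have h1 := det_sub_one_fin3 (c.L (h * g)) (c.L (h * g)⁻¹) (by rw [← map_mul]; simp)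
    rw [c.eig_one l.hI] at h1
    have h2 : ((c.L h⁻¹)ᵀ * (c.L g⁻¹)ᵀ).trace = (c.L (h*g)⁻¹).trace := by
      rw [← transpose_mul, trace_transpose, ← map_mul, _root_.mul_inv_rev]
    rw [h2]
    rw [map_mul c.L h g, Matrix.det_mul] at h1
    linear_combination (-r) * h1

theorem cog_zero (x : MonoidAlgebra ℝ G) (hx : MonoidAlgebra.lift ℝ M3 G c.L x = 0) :
    MonoidAlgebra.lift ℝ M3 G c.cog x = 0 ∧
      ∀ g, (c.L g).det ≠ 1 → MonoidAlgebra.lift ℝ ℝ G (1 : G →* ℝ) x = 0 := by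
  set D := MonoidAlgebra.lift ℝ ℝ G ((Matrix.detMonoidHom).comp c.L) x with hD
  set Y := MonoidAlgebra.lift ℝ M3 G c.cog x with hY
  set χ := MonoidAlgebra.lift ℝ ℝ G (1 : G →* ℝ) x with hχ
  have hk : ∀ k, ((c.L k)ᵀ * Y).trace = D - χ * (c.L k).det := by
    intro k
    have := l.key x k⁻¹
    rw [hx, ← hD, ← hY, ← hχ, inv_inv] at this
    have h1 : (c.L k).det * (c.L k⁻¹).det = 1 := by rw [← Matrix.det_mul, ← map_mul]; simp
    simp only [Matrix.mul_zero, trace_zero] at this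
    linear_combination (-(c.L k).det) * this + (D - ((c.L k)ᵀ * Y).trace) * h1
  have hW : ∀ a, (c.L a)ᵀ * Y = Y := by
    intro a
    have h1 : ∀ k, ((c.L k)ᵀ * ((c.L a)ᵀ * Y - Y)).trace = χ * (1 - (c.L a).det) * (c.L k).det := by
      intro k
      rw [Matrix.mul_sub, trace_sub, ← Matrix.mul_assoc, ← transpose_mul, ← map_mul, hk, hk, map_mul,
        Matrix.det_mul]
      ring
    have h2 : (c.L a)ᵀ * Y - Y = 0 := by
      apply l.col_zero _ (fun g => (c.L g).det)
      intro g
      rw [← sub_eq_zero]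
      apply l.nondeg
      intro k
      rw [Matrix.mul_sub, trace_sub, ← Matrix.mul_assoc, ← transpose_mul, ← map_mul, h1, Matrix.mul_smul,
        trace_smul, h1, map_mul, Matrix.det_mul, smul_eq_mul]
      ring
    exact sub_eq_zero.mp h2
  have hY0 : Y = 0 := l.col_zero Y (fun _ => 1) (fun g => by rw [hW, one_smul])
  refine ⟨hY0, fun g hg => ?_⟩
  have h1 := hk 1
  have h2 := hk g
  rw [hY0] at h1 h2
  simp only [Matrix.mul_zero, trace_zero, map_one, Matrix.det_one] at h1 h2
  have : χ * ((c.L g).det - 1) = 0 := by linear_combination h2 - h1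
  exact (mul_eq_zero.mp this).resolve_right (sub_ne_zero.mpr hg)

theorem det_one (g : G) : (c.L g).det = 1 := by
  by_contra hg
  obtain ⟨Φ, _⟩ := lift_alg _ l.burnside (MonoidAlgebra.lift ℝ ℝ G (1 : G →* ℝ))
    (fun x hx => (l.cog_zero x hx).2 g hg)
  have hinj : Function.Injective Φ := Φ.toRingHom.injective
  have := LinearMap.finrank_le_finrank_of_injective (f := Φ.toLinearMap) hinj
  simp [Module.finrank_matrix] at this

theorem exists_form : ∃ T : M3, T.det ≠ 0 ∧ Tᵀ = T ∧ ∀ g, (c.L g)ᵀ * T * c.L g = T := by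
  obtain ⟨Φ, hΦ⟩ := lift_alg _ l.burnside (MonoidAlgebra.lift ℝ M3 G c.cog)
    (fun x hx => (l.cog_zero x hx).1)
  have hinj : Function.Injective Φ := Φ.toRingHom.injective
  have hsurj : Function.Surjective Φ :=
    (LinearMap.injective_iff_surjective (f := Φ.toLinearMap)).mp hinj
  let E : M3 ≃ₐ[ℝ] M3 := AlgEquiv.ofBijective Φ ⟨hinj, hsurj⟩
  let t : M3 ≃ₐ[ℝ] Module.End ℝ V3 := Matrix.toLinAlgEquiv'
  obtain ⟨U, hU⟩ := AlgEquiv.eq_linearEquivConjAlgEquiv ((t.symm.trans E).trans t)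
  have hΦg : ∀ g, Φ (c.L g) = (c.L g⁻¹)ᵀ := by
    intro g
    have := hΦ (MonoidAlgebra.of ℝ G g)
    simpa [cog_apply, l.det_one] using this
  let T : M3 := LinearMap.toMatrix' U.toLinearMap
  have hTU : ∀ x, T *ᵥ x = U x := by
    intro x
    simp [T, LinearMap.toMatrix'_mulVec]
  have hTd : T.det ≠ 0 := by
    have h1 : T * LinearMap.toMatrix' U.symm.toLinearMap = 1 := by
      rw [← LinearMap.toMatrix'_comp]; simp
    intro h
    have := congrArg Matrix.det h1
    rw [Matrix.det_mul, h] at this; simp at this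
  have hTg : ∀ g, (c.L g⁻¹)ᵀ * T = T * c.L g := by
    intro g
    have h1 := congrArg (fun f => f (t (c.L g))) hU
    simp only [AlgEquiv.trans_apply, AlgEquiv.symm_apply_apply] at h1
    have h2 : E (c.L g) = (c.L g⁻¹)ᵀ := hΦg g
    rw [h2] at h1
    apply Matrix.toLin'.injective
    apply LinearMap.ext
    intro x
    have h3 := congrArg (fun f => f (U x)) h1
    simp only [LinearEquiv.conjAlgEquiv_apply_apply, LinearEquiv.symm_apply_apply] at h3
    have h4 : ∀ (M : M3) y, t M y = M *ᵥ y := fun M y => by simp [t]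
    rw [h4, h4] at h3
    simp only [Matrix.toLin'_apply, ← mulVec_mulVec, hTU]
    exact h3
  have hT : ∀ g, (c.L g)ᵀ * T * c.L g = T := by
    intro g
    rw [Matrix.mul_assoc, ← hTg, ← Matrix.mul_assoc, ← transpose_mul, ← map_mul]
    simp
  have hTu : IsUnit T.det := isUnit_iff_ne_zero.mpr hTd
  have hTt : ∀ g, (c.L g)ᵀ * Tᵀ * c.L g = Tᵀ := by
    intro g
    have := congrArg Matrix.transpose (hT g)
    simpa [transpose_mul, Matrix.mul_assoc] using this
  obtain ⟨r, hr⟩ := l.comm_scalar (T⁻¹ * Tᵀ) (by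
    intro g
    have h1 : c.L g = T⁻¹ * ((c.L g⁻¹)ᵀ * T) := by
      rw [hTg, ← Matrix.mul_assoc, nonsing_inv_mul _ hTu, Matrix.one_mul]
    have h2 : Tᵀ * c.L g = (c.L g⁻¹)ᵀ * Tᵀ := by
      have := congrArg (fun M => (c.L g⁻¹)ᵀ * M) (hTt g)
      beta_reduce at this
      rw [← this, ← Matrix.mul_assoc, ← Matrix.mul_assoc, ← transpose_mul, ← map_mul]
      simp
    rw [Matrix.mul_assoc, h2]
    conv_rhs => rw [h1]
    rw [Matrix.mul_assoc T⁻¹, Matrix.mul_assoc (c.L g⁻¹)ᵀ, ← Matrix.mul_assoc T, mul_nonsing_inv _ hTu,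
      Matrix.one_mul])
  have hTr : Tᵀ = r • T := by
    have := congrArg (fun M => T * M) hr
    beta_reduce at this
    rw [← Matrix.mul_assoc, mul_nonsing_inv _ hTu, Matrix.one_mul, Matrix.mul_smul, Matrix.mul_one] at this
    exact this
  have hr3 : r ^ 3 = 1 := by
    have := congrArg Matrix.det hTr
    rw [det_transpose, det_smul] at this
    simp only [Fintype.card_fin] at this
    have h2 : (r^3 - 1) * T.det = 0 := by linear_combination -this
    have := (mul_eq_zero.mp h2).resolve_right hTd
    linarith
  have hr1 : r = 1 := by
    have : (r - 1) * ((2*r+1)^2 + 3) = 0 := by linear_combination 4*hr3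
    rcases mul_eq_zero.mp this with h | h
    · linarith
    · nlinarith [sq_nonneg (2*r+1)]
  exact ⟨T, hTd, by rw [hTr, hr1, one_smul], hT⟩

end Irred
end Crys
end FG3
end Part11

section Part12
open Matrix
set_option linter.all false
namespace FG3
namespace Crys
variable {G : Type} [Group G] (c : Crys G)
namespace Irred
variable {c} (l : c.Irred)
include l

theorem not_finite_L (F : Set G) (hF : F.Finite) (h : ∀ g, ∃ f ∈ F, c.L g = c.L f) : False := by
  have h1 : ∀ g, c.L g = 1 := by
    intro g
    ext i j
    have := l.hI.finite_values' (c.pol_L i j) (hF.image fun f => c.L f i j) (fun g => by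
      obtain ⟨f, hf, hg⟩ := h g
      exact ⟨f, hf, by rw [hg]⟩) g
    rw [this]; simp
  obtain ⟨g, hg⟩ := l.nev (Pi.single 0 1) (by simp)
  apply hg 1
  rw [h1, one_mulVec, one_smul]

theorem trans_trivial (m : G) (hm : c.L m = 1) : m = 1 := by
  by_contra hne
  have hb0 : c.b m ≠ 0 := fun h => hne (c.faithful m hm h)
  let Λ : AddSubgroup V3 :=
    { carrier := {v | ∃ n, c.L n = 1 ∧ c.b n = v}
      add_mem' := by
        rintro _ _ ⟨n, hn, rfl⟩ ⟨n', hn', rfl⟩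
        exact ⟨n * n', by rw [map_mul, hn, hn', mul_one], by rw [c.b_mul, hn, one_mulVec, add_comm]⟩
      zero_mem' := ⟨1, map_one _, c.b_one⟩
      neg_mem' := by
        rintro _ ⟨n, hn, rfl⟩
        have h1 : c.L n⁻¹ = 1 := by
          have := c.L_mul_inv n
          rwa [hn, one_mul] at this
        exact ⟨n⁻¹, h1, by rw [c.b_inv, h1, one_mulVec]⟩ }
  have hΛ : ∀ v, v ∈ Λ ↔ ∃ n, c.L n = 1 ∧ c.b n = v := fun v => Iff.rfl
  have htop := l.inv_sub (Submodule.span ℝ (Λ : Set V3)) (by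
    intro g x hx
    induction hx using Submodule.span_induction with
    | mem x hx =>
      obtain ⟨n, hn, rfl⟩ := hx
      apply Submodule.subset_span
      refine ⟨g * n * g⁻¹, ?_, ?_⟩
      · rw [map_mul, map_mul, hn, mul_one, c.L_mul_inv]
      · rw [c.b_mul, map_mul, hn, mul_one, c.b_inv, mulVec_neg, mulVec_mulVec, c.L_mul_inv, one_mulVec,
          c.b_mul]
        abel
    | zero => simp
    | add x y _ _ hx hy => rw [mulVec_add]; exact Submodule.add_mem _ hx hy
    | smul r x _ hx => rw [mulVec_smul]; exact Submodule.smul_mem _ _ hx) (by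
    intro h
    apply hb0
    have : c.b m ∈ Submodule.span ℝ (Λ : Set V3) := Submodule.subset_span ⟨m, hm, rfl⟩
    rw [h] at this
    simpa using this)
  have hfg : (Submodule.span ℝ (Λ : Set V3)).FG := IsNoetherian.noetherian _
  obtain ⟨t, ht, hts⟩ := Submodule.fg_span_iff_fg_span_finset_subset _ |>.mp hfg
  rw [htop] at hts
  set C : ℝ := ∑ v ∈ t, ‖v‖ with hC
  have hred : ∀ v : V3, ∃ u ∈ Λ, ‖u + v‖ ≤ C := by
    intro v
    have hv : v ∈ Submodule.span ℝ (t : Set V3) := by rw [← hts]; trivial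
    obtain ⟨a, ha, hv⟩ := (Submodule.mem_span_finset).mp hv
    refine ⟨-∑ x ∈ t, ⌊a x⌋ • x, Λ.neg_mem (Λ.sum_mem fun x hx => Λ.zsmul_mem (ht hx) _), ?_⟩
    rw [← hv, neg_add_eq_sub, ← Finset.sum_sub_distrib]
    refine (norm_sum_le _ _).trans (Finset.sum_le_sum fun x hx => ?_)
    rw [← Int.cast_smul_eq_zsmul ℝ, ← sub_smul, norm_smul]
    have : ‖a x - ⌊a x⌋‖ ≤ 1 := by
      rw [Real.norm_eq_abs, abs_of_nonneg (by linarith [Int.floor_le (a x)])]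
      linarith [Int.lt_floor_add_one (a x)]
    calc _ ≤ 1 * ‖x‖ := by gcongr
      _ = _ := one_mul _
  refine l.not_finite_L _ (c.proper C) fun g => ?_
  obtain ⟨u, ⟨n, hn, rfl⟩, hu⟩ := hred (c.b g)
  refine ⟨n * g, ⟨0, ?_, ?_⟩, ?_⟩
  · rw [norm_zero]; exact Finset.sum_nonneg fun _ _ => norm_nonneg _
  · rw [mulVec_zero, zero_add, c.b_mul, hn, one_mulVec, add_comm]; exact hu
  · rw [map_mul, hn, one_mul]

theorem H2 (Z : Set M3) (hcomm : ∀ z ∈ Z, ∀ z' ∈ Z, z * z' = z' * z)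
    (hn : ∀ g, ∀ z ∈ Z, c.L g * z * c.L g⁻¹ ∈ Z) (z : M3) (hz : z ∈ Z) : ∃ r : ℝ, z = r • (1 : M3) := by
  by_contra hns
  obtain ⟨r, v0, hv0, hr⟩ := exists_eig (Matrix.toLin' z)
  set N : Module.End ℝ V3 := Matrix.toLin' z - r • LinearMap.id with hN
  have hNx : ∀ x, N x = z *ᵥ x - r • x := fun x => by simp [hN]
  have hcN : ∀ z' ∈ Z, ∀ x, N (z' *ᵥ x) = z' *ᵥ N x := by
    intro z' hz' x
    rw [hNx, hNx, mulVec_sub, mulVec_mulVec, mulVec_mulVec, hcomm z hz z' hz', mulVec_smul]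
  have h3 : Module.finrank ℝ V3 = 3 := by simp
  have hrk := LinearMap.finrank_range_add_finrank_ker N
  rw [h3] at hrk
  have hkpos : 0 < Module.finrank ℝ (LinearMap.ker N) := by
    rw [Module.finrank_pos_iff]
    apply Submodule.nontrivial_iff_ne_bot.mpr
    intro h
    apply hv0
    have : v0 ∈ LinearMap.ker N := by
      rw [LinearMap.mem_ker, hNx, sub_eq_zero]; simpa using hr
    rw [h] at this; simpa using this
  have hrpos : 0 < Module.finrank ℝ (LinearMap.range N) := by
    rw [Module.finrank_pos_iff]
    apply Submodule.nontrivial_iff_ne_bot.mpr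
    intro h
    rw [LinearMap.range_eq_bot] at h
    apply hns
    refine ⟨r, ?_⟩
    ext i j
    have := congrFun (congrArg (fun f : Module.End ℝ V3 => f (Pi.single j 1)) h) i
    beta_reduce at this
    rw [hNx, Pi.sub_apply, mulVec_single_one] at this
    simp [Pi.single_apply, sub_eq_zero] at this
    simp [this, Matrix.one_apply]
  have hp : ∃ p : Submodule ℝ V3, Module.finrank ℝ p = 1 ∧ ∀ z' ∈ Z, ∀ x ∈ p, z' *ᵥ x ∈ p := by
    have : Module.finrank ℝ (LinearMap.ker N) = 1 ∨ Module.finrank ℝ (LinearMap.range N) = 1 := by omega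
    rcases this with h | h
    · refine ⟨_, h, fun z' hz' x hx => ?_⟩
      rw [LinearMap.mem_ker] at hx ⊢
      rw [hcN z' hz', hx, mulVec_zero]
    · refine ⟨_, h, fun z' hz' x hx => ?_⟩
      obtain ⟨y, rfl⟩ := hx
      exact ⟨z' *ᵥ y, hcN z' hz' y⟩
  obtain ⟨p, hp1, hpZ⟩ := hp
  obtain ⟨⟨v, hv⟩, hv0', hvs⟩ := finrank_eq_one_iff'.mp hp1
  have hvne : v ≠ 0 := fun h => hv0' (by simpa using h)
  have hev : ∀ g, ∃ r : ℝ, (c.L g⁻¹ * z * c.L g) *ᵥ v = r • v := by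
    intro g
    have h1 := hn g⁻¹ z hz
    rw [inv_inv] at h1
    obtain ⟨r, hr⟩ := hvs ⟨_, hpZ _ h1 v hv⟩
    exact ⟨r, by simpa using (congrArg Subtype.val hr).symm⟩
  choose f hf using hev
  obtain ⟨i, hi⟩ : ∃ i, v i ≠ 0 := by
    by_contra h; push Not at h; exact hvne (funext h)
  have hfg : ∀ g, z *ᵥ (c.L g *ᵥ v) = f g • (c.L g *ᵥ v) := by
    intro g
    have := congrArg (fun x => c.L g *ᵥ x) (hf g)
    beta_reduce at this
    rw [mulVec_mulVec, ← mul_assoc, ← mul_assoc, c.L_mul_inv, one_mul, mulVec_smul] at this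
    rw [← this, mulVec_mulVec]
  have hfpol : f ∈ c.Pol := by
    have : f = fun g => (∑ j, ((∑ k, (∑ q, c.L g⁻¹ i q * z q k) * c.L g k j) * v j)) * (v i)⁻¹ := by
      funext g
      have := congrFun (hf g) i
      rw [Pi.smul_apply, smul_eq_mul] at this
      rw [eq_mul_inv_iff_mul_eq₀ hi, ← this]
      simp only [mulVec, dotProduct, Matrix.mul_apply]
    rw [this]
    exact c.pol_mul (c.pol_sum _ fun j => c.pol_mul (c.pol_sum _ fun k => c.pol_mul (c.pol_sum _ fun q =>
      c.pol_mul (c.pol_Li i q) (c.pol_const _)) (c.pol_L k j)) (c.pol_const _)) (c.pol_const _)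
  have hfin : {μ | Module.End.HasEigenvalue (Matrix.toLin' z) μ}.Finite :=
    Module.End.finite_hasEigenvalue _
  have hgv : ∀ g, c.L g *ᵥ v ≠ 0 := by
    intro g h
    apply hvne
    have := congrArg (fun x => c.L g⁻¹ *ᵥ x) h
    simpa [mulVec_mulVec, c.L_inv_mul] using this
  have hconst := l.hI.finite_values' hfpol hfin (fun g =>
    Module.End.hasEigenvalue_of_hasEigenvector (x := c.L g *ᵥ v)
      (Module.End.hasEigenvector_iff.mpr ⟨by rw [Module.End.mem_eigenspace_iff]; simpa using hfg g, hgv g⟩))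
  have htop := l.inv_sub (Submodule.span ℝ (Set.range fun g => c.L g *ᵥ v)) (by
    intro g x hx
    induction hx using Submodule.span_induction with
    | mem x hx =>
      obtain ⟨h, rfl⟩ := hx
      apply Submodule.subset_span
      exact ⟨g * h, by simp [mulVec_mulVec]⟩
    | zero => simp
    | add x y _ _ hx hy => rw [mulVec_add]; exact Submodule.add_mem _ hx hy
    | smul r x _ hx => rw [mulVec_smul]; exact Submodule.smul_mem _ _ hx) (by
    intro h
    apply hvne
    have : v ∈ Submodule.span ℝ (Set.range fun g => c.L g *ᵥ v) := Submodule.subset_span ⟨1, by simp⟩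
    rw [h] at this
    simpa using this)
  apply hns
  refine ⟨f 1, ?_⟩
  have hall : ∀ x, z *ᵥ x = f 1 • x := by
    intro x
    have hx : x ∈ Submodule.span ℝ (Set.range fun g => c.L g *ᵥ v) := by rw [htop]; trivial
    induction hx using Submodule.span_induction with
    | mem x hx =>
      obtain ⟨h, rfl⟩ := hx
      rw [hfg, hconst]
    | zero => simp
    | add x y _ _ hx hy => rw [mulVec_add, hx, hy, smul_add]
    | smul r x _ hx => rw [mulVec_smul, hx, smul_comm]
  ext i j
  have := congrFun (hall (Pi.single j 1)) i
  rw [mulVec_single_one] at this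
  simpa [Matrix.one_apply, Pi.single_apply, eq_comm] using this

section
attribute [local instance] Matrix.linftyOpNormedRing Matrix.linftyOpNormedAlgebra

theorem zass : ∃ ε > 0, ∀ g, Near c.L ε g → g = 1 := by
  refine FG3.zass (0 : Fin 3) c.L l.trans_trivial
    l.H2 (ε0 := 1/64) (by norm_num) ?_
  intro S hS
  obtain ⟨B, hB1, hB⟩ := c.exists_bound S
  set η := 1 / (64 * B) with hη
  have hη0 : 0 < η := by positivity
  have hηB : η * B = 1/64 := by rw [hη]; field_simp
  obtain ⟨d, h1, h2, h3, h4, h5⟩ := c.exists_d (fun _ => η) (fun _ => hη0)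
  refine ⟨d, h1, h2, ?_, h3, fun g hg => h4 g hg 0⟩
  intro s hs
  obtain ⟨b1, b2, b3, b4⟩ := hB s hs
  obtain ⟨-, n1, n2⟩ := hS s hs
  have key : ∀ s, ‖c.L s - 1‖ ≤ 1/64 →
      ∀ i j, |η * c.L s i j * η⁻¹ - (1 : M3) i j| ≤ 1/64 := by
    intro s n i j
    have e11 := (linf_entry (c.L s - 1) i j).trans n
    have : η * c.L s i j * η⁻¹ = c.L s i j := by field_simp
    rw [this]; exact e11
  have keyb : ∀ s, (∀ i, |c.b s i| ≤ B) → ∀ i, |η * c.b s i| ≤ 1/64 := by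
    intro s b i
    rw [abs_mul, abs_of_pos hη0]
    calc _ ≤ η * B := by gcongr; exact b i
      _ = _ := hηB
  exact h5 s (key s n1) (key _ n2) (keyb s b3) (keyb _ b4)

theorem disc (R : ℝ) : {γ | ∀ i j, |c.L γ i j| ≤ R}.Finite := by
  obtain ⟨ε, hε, hZ⟩ := l.zass
  obtain ⟨B, hBd, hBt, hB⟩ := l.exists_form
  have hBu : IsUnit B.det := isUnit_iff_ne_zero.mpr hBd
  obtain ⟨T, hT⟩ := (Group.fg_def.mp c.fg_group)
  by_cases hR : R < 0
  · refine Set.Finite.subset Set.finite_empty ?_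
    intro γ hγ
    have := (abs_nonneg _).trans (hγ 0 0)
    linarith
  push Not at hR
  have hcen : {γ | ∀ a ∈ T, γ * a = a * γ} ⊆ {1} := by
    intro γ hγ
    have h1 : ∀ a, γ * a = a * γ := by
      have : Subgroup.closure (T : Set G) ≤ Subgroup.centralizer {γ} := by
        rw [Subgroup.closure_le]
        intro a ha
        rw [SetLike.mem_coe, Subgroup.mem_centralizer_singleton_iff]
        exact (hγ a ha).symm
      intro a
      have ha : a ∈ Subgroup.centralizer {γ} := this (by rw [hT]; trivial)
      rw [Subgroup.mem_centralizer_singleton_iff] at ha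
      exact ha.symm
    obtain ⟨r, hr⟩ := l.comm_scalar (c.L γ) (fun g => by rw [← map_mul, h1, map_mul])
    have hr3 : r ^ 3 = 1 := by
      have := l.det_one γ
      rw [hr, det_smul] at this
      simpa using this
    have hr1 : r = 1 := by
      have : (r - 1) * ((2*r+1)^2 + 3) = 0 := by linear_combination 4*hr3
      rcases mul_eq_zero.mp this with h | h
      · linarith
      · nlinarith [sq_nonneg (2*r+1)]
    exact l.trans_trivial γ (by rw [hr, hr1, one_smul])
  have hd := FG3.disc c.L c.L (fun _ => 1) (by simp) (by simp) rfl hε hZ T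
    ((Set.finite_singleton _).subset hcen) (max (3 * R) (‖B⁻¹‖ * (3 * R) * ‖B‖))
  refine hd.subset ?_
  intro γ hγ
  have hinv : c.L γ⁻¹ = B⁻¹ * (c.L γ)ᵀ * B := by
    have h1 := congrArg (fun M => B⁻¹ * M * c.L γ⁻¹) (hB γ)
    beta_reduce at h1
    rw [nonsing_inv_mul _ hBu, one_mul] at h1
    rw [← h1]
    simp only [mul_assoc, c.L_mul_inv, mul_one]
  refine ⟨(linf_le _ hR hγ).trans ?_, ?_⟩
  · simp
  · rw [hinv]
    refine le_trans ?_ (le_max_right _ _)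
    have ht : ‖(c.L γ)ᵀ‖ ≤ 3 * R := by
      have := linf_le (c.L γ)ᵀ hR (fun i j => hγ j i)
      simpa using this
    calc _ ≤ ‖B⁻¹ * (c.L γ)ᵀ‖ * ‖B‖ := norm_mul_le _ _
      _ ≤ ‖B⁻¹‖ * ‖(c.L γ)ᵀ‖ * ‖B‖ := by gcongr; exact norm_mul_le _ _
      _ ≤ _ := by gcongr
end

end Irred
end Crys
end FG3
end Part12

section Part13
open Matrix
set_option linter.all false
namespace FG3

theorem cpt_lower {K : Set V3} (hK : IsCompact K) {f : V3 → ℝ} (hf : Continuous f) (hp : ∀ x ∈ K, 0 < f x) :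
    ∃ m > 0, ∀ x ∈ K, m ≤ f x := by
  rcases K.eq_empty_or_nonempty with h | h
  · exact ⟨1, one_pos, by simp [h]⟩
  · obtain ⟨x, hx, hm⟩ := hK.exists_isMinOn h hf.continuousOn
    exact ⟨f x, hp x hx, fun y hy => hm hy⟩

theorem cpt_upper {K : Set V3} (hK : IsCompact K) {f : V3 → ℝ} (hf : Continuous f) :
    ∃ M > 0, ∀ x ∈ K, f x ≤ M := by
  obtain ⟨M, hM⟩ := hK.bddAbove_image hf.continuousOn
  exact ⟨max M 1, by positivity, fun x hx => (hM ⟨x, hx, rfl⟩).trans (le_max_left _ _)⟩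

/-- a properly discontinuous action on the projectivization of a cone -/
structure Cone {G : Type} [Group G] (c : Crys G) where
  σ : G →* M3
  C : Set V3
  isOpen : IsOpen C
  add : ∀ x ∈ C, ∀ y ∈ C, x + y ∈ C
  smul : ∀ t : ℝ, 0 < t → ∀ x ∈ C, t • x ∈ C
  v0 : V3
  hv0 : v0 ∈ C
  w : V3
  pos : ∀ x ∈ C, 0 < w ⬝ᵥ x
  map : ∀ g, ∀ x ∈ C, σ g *ᵥ x ∈ C
  disc : ∀ K : Set V3, IsCompact K → K ⊆ C → {g | ∃ x ∈ K, ∃ t : ℝ, 0 < t ∧ t • (σ g *ᵥ x) ∈ K}.Finite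

/-- symmetric square -/
def sym2 (A : M2) : M3 :=
  !![A 0 0 ^ 2, 2 * A 0 0 * A 0 1, A 0 1 ^ 2; A 0 0 * A 1 0, A 0 0 * A 1 1 + A 0 1 * A 1 0, A 0 1 * A 1 1;
     A 1 0 ^ 2, 2 * A 1 0 * A 1 1, A 1 1 ^ 2]

theorem sym2_mul (A B : M2) : sym2 (A * B) = sym2 A * sym2 B := by
  ext i j
  fin_cases i <;> fin_cases j <;>
    simp [sym2, Matrix.mul_apply, Fin.sum_univ_three, Fin.sum_univ_two] <;> ring

theorem sym2_one : sym2 1 = 1 := by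
  ext i j
  fin_cases i <;> fin_cases j <;> simp [sym2]

theorem sym2_v (A : M2) (x : V3) : sym2 A *ᵥ x = ![A 0 0 ^ 2 * x 0 + 2 * A 0 0 * A 0 1 * x 1 + A 0 1 ^ 2 * x 2,
    A 0 0 * A 1 0 * x 0 + (A 0 0 * A 1 1 + A 0 1 * A 1 0) * x 1 + A 0 1 * A 1 1 * x 2,
    A 1 0 ^ 2 * x 0 + 2 * A 1 0 * A 1 1 * x 1 + A 1 1 ^ 2 * x 2] := by
  ext i
  fin_cases i <;> simp [sym2, mulVec, dotProduct, Fin.sum_univ_three]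

/-- positive definite symmetric matrices -/
def pdc : Set V3 := {x | 0 < x 0 ∧ 0 < x 0 * x 2 - x 1 ^ 2}

theorem pdc_z {x : V3} (h : x ∈ pdc) : 0 < x 2 := by
  obtain ⟨h1, h2⟩ := h
  by_contra hc
  push Not at hc
  nlinarith [sq_nonneg (x 1), mul_nonpos_of_nonneg_of_nonpos h1.le hc]

theorem sym2_det (A : M2) (x : V3) : (sym2 A *ᵥ x) 0 * (sym2 A *ᵥ x) 2 - (sym2 A *ᵥ x) 1 ^ 2
    = A.det ^ 2 * (x 0 * x 2 - x 1 ^ 2) := by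
  rw [sym2_v, det_fin_two]; simp; ring

theorem sym2_tr (A : M2) {x : V3} (hx : x ∈ pdc) :
    (x 0 * x 2 - x 1 ^ 2) * (A 0 0 ^ 2 + A 0 1 ^ 2 + A 1 0 ^ 2 + A 1 1 ^ 2) ≤
      (x 0 + x 2) * ((sym2 A *ᵥ x) 0 + (sym2 A *ᵥ x) 2) := by
  have h2 := pdc_z hx
  obtain ⟨h1, h3⟩ := hx
  rw [sym2_v]; simp
  nlinarith [sq_nonneg (A 0 0 * x 0 + A 0 1 * x 1), sq_nonneg (A 0 0 * x 1 + A 0 1 * x 2),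
    sq_nonneg (A 1 0 * x 0 + A 1 1 * x 1), sq_nonneg (A 1 0 * x 1 + A 1 1 * x 2)]

theorem sym2_map (A : M2) (hA : A.det ≠ 0) {x : V3} (hx : x ∈ pdc) : sym2 A *ᵥ x ∈ pdc := by
  have hz := pdc_z hx
  have hd : 0 < (sym2 A *ᵥ x) 0 * (sym2 A *ᵥ x) 2 - (sym2 A *ᵥ x) 1 ^ 2 := by
    rw [sym2_det]; exact mul_pos (by positivity) hx.2
  refine ⟨?_, hd⟩
  have h0 : 0 ≤ (sym2 A *ᵥ x) 0 := by
    rw [sym2_v]; simp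
    have h1 := hx.1; have h2 := hx.2
    have : 0 ≤ x 0 * (A 0 0 ^ 2 * x 0 + 2 * A 0 0 * A 0 1 * x 1 + A 0 1 ^ 2 * x 2) := by
      nlinarith [sq_nonneg (A 0 0 * x 0 + A 0 1 * x 1), mul_nonneg h2.le (sq_nonneg (A 0 1))]
    exact nonneg_of_mul_nonneg_right this h1
  rcases h0.lt_or_eq with h | h
  · exact h
  · rw [← h] at hd; nlinarith [sq_nonneg ((sym2 A *ᵥ x) 1)]

namespace Crys
variable {G : Type} [Group G] (c : Crys G)

theorem Line.cone {c : Crys G} (l : c.Line) : Nonempty (Cone c) := by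
  set A := c.lineA l.h10 l.h20 with hA
  have hAd : ∀ g, (A g).det ≠ 0 := by
    intro g h
    have := congrArg Matrix.det (hom_mul_inv A g)
    rw [Matrix.det_mul, h] at this
    simp at this
  refine ⟨{ σ := { toFun := fun g => sym2 (A g), map_one' := by rw [map_one, sym2_one],
                    map_mul' := fun g h => by rw [map_mul, sym2_mul] }
            C := pdc
            isOpen := ?_, add := ?_, smul := ?_, v0 := ![1,0,1], hv0 := by simp [pdc], w := ![1,0,1]
            pos := ?_, map := fun g x hx => sym2_map _ (hAd g) hx, disc := ?_ }⟩
  · have h1 : IsOpen {x : V3 | 0 < x 0} := isOpen_lt continuous_const (by fun_prop)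
    have h2 : IsOpen {x : V3 | 0 < x 0 * x 2 - x 1 ^ 2} := isOpen_lt continuous_const (by fun_prop)
    exact h1.inter h2
  · intro x hx y hy
    have hxz := pdc_z hx
    have hyz := pdc_z hy
    obtain ⟨h1, h2⟩ := hx
    obtain ⟨h3, h4⟩ := hy
    refine ⟨by simpa using add_pos h1 h3, ?_⟩
    simp only [Pi.add_apply]
    -- x0 y2 + x2 y0 > 2 x1 y1
    have h5 : (x 1 * y 1) ^ 2 ≤ (x 0 * y 2) * (x 2 * y 0) := by
      have : x 1 ^ 2 * y 1 ^ 2 ≤ (x 0 * x 2) * (y 0 * y 2) := by gcongr <;> linarith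
      nlinarith
    have h6 : x 1 * y 1 ≤ (x 0 * y 2 + x 2 * y 0) / 2 := by
      apply le_of_sq_le_sq _ (by positivity) |> fun h => h
      nlinarith [sq_nonneg (x 0 * y 2 - x 2 * y 0)]
    nlinarith
  · intro t ht x ⟨h1, h2⟩
    refine ⟨by simpa using mul_pos ht h1, ?_⟩
    simp only [Pi.smul_apply, smul_eq_mul]
    have := mul_pos (mul_pos ht ht) h2
    nlinarith
  · intro x hx
    have := pdc_z hx
    have := hx.1
    simp [dotProduct, Fin.sum_univ_three]; linarith
  · intro K hK hKC
    obtain ⟨m, hm, hmK⟩ := cpt_lower hK (f := fun x => x 0 * x 2 - x 1 ^ 2) (by fun_prop) (fun x hx => (hKC hx).2)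
    obtain ⟨M, hM, hMK⟩ := cpt_upper hK (f := fun x => x 0 + x 2) (by fun_prop)
    refine (l.disc (M ^ 2 / m)).subset ?_
    rintro g ⟨x, hx, t, ht, hy⟩
    have hy' : t • (sym2 (A g) *ᵥ x) ∈ K := hy
    have hdx := hmK _ hx
    have hdy := hmK _ hy'
    have htx := hMK _ hx
    have hty := hMK _ hy'
    have hxC := hKC hx
    simp only [Pi.smul_apply, smul_eq_mul] at hdy hty
    have e1 := sym2_det (A g) x
    have e2 := sym2_tr (A g) hxC
    set N := A g 0 0 ^ 2 + A g 0 1 ^ 2 + A g 1 0 ^ 2 + A g 1 1 ^ 2 with hN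
    have hN0 : 0 ≤ N := by positivity
    set D := (A g).det with hD
    set p := x 0 * x 2 - x 1 ^ 2 with hp
    have hp0 : 0 < p := hxC.2
    have hs0 : 0 < x 0 + x 2 := add_pos hxC.1 (pdc_z hxC)
    have hdy' : m ≤ t ^ 2 * (D ^ 2 * p) := by rw [← e1]; linarith
    have hty' : t * (p * N) ≤ M * M := by
      calc t * (p * N) ≤ t * ((x 0 + x 2) * ((sym2 (A g) *ᵥ x) 0 + (sym2 (A g) *ᵥ x) 2)) := by gcongr
        _ = (x 0 + x 2) * (t * (sym2 (A g) *ᵥ x) 0 + t * (sym2 (A g) *ᵥ x) 2) := by ring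
        _ ≤ (x 0 + x 2) * M := by gcongr
        _ ≤ M * M := by gcongr
    have key : (m * N) ^ 2 ≤ (M ^ 2 * |D|) ^ 2 := by
      rw [mul_pow (M ^ 2), sq_abs]
      have h1 : (t * (p * N)) ^ 2 ≤ (M * M) ^ 2 := by gcongr
      calc (m * N) ^ 2 = m * (m * N ^ 2) := by ring
        _ ≤ (t ^ 2 * (D ^ 2 * p)) * (p * N ^ 2) := by gcongr
        _ = D ^ 2 * (t * (p * N)) ^ 2 := by ring
        _ ≤ D ^ 2 * (M * M) ^ 2 := by gcongr
        _ = _ := by ring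
    have key2 : m * N ≤ M ^ 2 * |D| := by
      exact le_of_sq_le_sq key (by positivity)
    have key3 : N ≤ M ^ 2 / m * |D| := by
      rw [div_mul_eq_mul_div, le_div_iff₀ hm]; linarith
    intro i j
    refine le_trans ?_ key3
    rw [hN]
    have q00 := sq_nonneg (A g 0 0); have q01 := sq_nonneg (A g 0 1)
    have q10 := sq_nonneg (A g 1 0); have q11 := sq_nonneg (A g 1 1)
    fin_cases i <;> fin_cases j <;> simp [← hA] <;> linarith

end Crys

/-- Sylvester law in dimension three -/
theorem sylvester (T : M3) (hT : Tᵀ = T) (hd : T.det ≠ 0) :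
    ∃ P : M3, ∃ s e : ℝ, P.det ≠ 0 ∧ s ≠ 0 ∧ (e = 1 ∨ e = -1) ∧ Pᵀ * T * P = s • diagonal ![1, 1, e] := by
  have hH : T.IsHermitian := by
    rw [Matrix.IsHermitian, conjTranspose_eq_transpose_of_trivial]; exact hT
  set U : M3 := hH.eigenvectorUnitary.1 with hU
  have hUU : Uᵀ * U = 1 := by
    have := (Matrix.mem_unitaryGroup_iff').mp hH.eigenvectorUnitary.2
    rw [star_eq_conjTranspose, conjTranspose_eq_transpose_of_trivial] at this
    exact this
  have hUU' : U * Uᵀ = 1 := mul_eq_one_comm.mp hUU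
  set ev := hH.eigenvalues with hev
  have hsp : T = U * diagonal ev * Uᵀ := by
    have := hH.spectral_theorem
    rw [Unitary.conjStarAlgAut_apply] at this
    exact this
  have hdiag : Uᵀ * T * U = diagonal ev := by
    rw [hsp]
    calc Uᵀ * (U * diagonal ev * Uᵀ) * U = (Uᵀ * U) * diagonal ev * (Uᵀ * U) := by simp only [mul_assoc]
      _ = _ := by rw [hUU, one_mul, mul_one]
  have hUd : U.det ≠ 0 := by
    intro h
    have := congrArg Matrix.det hUU
    rw [Matrix.det_mul, h] at this; simp at this
  have hev0 : ∀ i, ev i ≠ 0 := by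
    intro i h
    apply hd
    have := congrArg Matrix.det hsp
    rw [Matrix.det_mul, Matrix.det_mul, det_diagonal, Finset.prod_eq_zero (Finset.mem_univ i) h] at this
    rw [this]; simp
  -- choose a distinguished index
  have hk : ∃ k : Fin 3, ∃ s e : ℝ, (s = 1 ∨ s = -1) ∧ (e = 1 ∨ e = -1) ∧
      (∀ i, i ≠ k → 0 < s * ev i) ∧ 0 < s * e * ev k := by
    rcases lt_or_gt_of_ne (hev0 0) with h0 | h0 <;> rcases lt_or_gt_of_ne (hev0 1) with h1 | h1 <;>
      rcases lt_or_gt_of_ne (hev0 2) with h2 | h2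
    · exact ⟨2, -1, 1, by simp, by simp, by intro i hi; fin_cases i <;> simp at hi ⊢ <;> assumption, by linarith⟩
    · exact ⟨2, -1, -1, by simp, by simp, by intro i hi; fin_cases i <;> simp at hi ⊢ <;> assumption, by linarith⟩
    · exact ⟨1, -1, -1, by simp, by simp, by intro i hi; fin_cases i <;> simp at hi ⊢ <;> assumption, by linarith⟩
    · exact ⟨0, 1, -1, by simp, by simp, by intro i hi; fin_cases i <;> simp at hi ⊢ <;> assumption, by linarith⟩
    · exact ⟨0, -1, -1, by simp, by simp, by intro i hi; fin_cases i <;> simp at hi ⊢ <;> assumption, by linarith⟩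
    · exact ⟨1, 1, -1, by simp, by simp, by intro i hi; fin_cases i <;> simp at hi ⊢ <;> assumption, by linarith⟩
    · exact ⟨2, 1, -1, by simp, by simp, by intro i hi; fin_cases i <;> simp at hi ⊢ <;> assumption, by linarith⟩
    · exact ⟨2, 1, 1, by simp, by simp, by intro i hi; fin_cases i <;> simp at hi ⊢ <;> assumption, by linarith⟩
  obtain ⟨k, s, e, hs, he, hpos, hposk⟩ := hk
  set τ : Equiv.Perm (Fin 3) := Equiv.swap k 2 with hτ
  set W : M3 := diagonal (fun i => (Real.sqrt |ev (τ i)|)⁻¹) with hW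
  have hsq : ∀ i, 0 < Real.sqrt |ev i| := fun i => Real.sqrt_pos.mpr (abs_pos.mpr (hev0 i))
  have hτ2 : τ 2 = k := Equiv.swap_apply_right _ _
  have hτi : ∀ i, i ≠ 2 → τ i ≠ k := fun i hi h => hi (τ.injective (h.trans hτ2.symm))
  refine ⟨U.submatrix id τ * W, s, e, ?_, ?_, he, ?_⟩
  · rw [Matrix.det_mul, Matrix.det_permute', hW, det_diagonal]
    refine mul_ne_zero (mul_ne_zero ?_ hUd) (Finset.prod_ne_zero_iff.mpr fun i _ => inv_ne_zero (hsq _).ne')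
    rcases Int.units_eq_one_or (Equiv.Perm.sign τ) with h | h <;> rw [h] <;> simp
  · rcases hs with h | h <;> rw [h] <;> norm_num
  · have h1 : (U.submatrix id τ)ᵀ * T * U.submatrix id τ = diagonal (fun i => ev (τ i)) := by
      have : (U.submatrix id τ)ᵀ * T * U.submatrix id τ = (Uᵀ * T * U).submatrix τ τ := by
        ext i j; simp [Matrix.mul_apply]
      rw [this, hdiag]
      exact submatrix_diagonal _ _ τ.injective
    have h2 : (U.submatrix id τ * W)ᵀ * T * (U.submatrix id τ * W) =
        Wᵀ * ((U.submatrix id τ)ᵀ * T * U.submatrix id τ) * W := by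
      rw [transpose_mul]; simp only [mul_assoc]
    rw [h2, h1, hW, diagonal_transpose, diagonal_mul_diagonal, diagonal_mul_diagonal, ← diagonal_smul]
    congr 1
    funext i
    have hss : s * s = 1 := by rcases hs with h | h <;> rw [h] <;> norm_num
    have hee : e * e = 1 := by rcases he with h | h <;> rw [h] <;> norm_num
    have hse : |s| = 1 := by rcases hs with h | h <;> rw [h] <;> norm_num
    have hee' : |e| = 1 := by rcases he with h | h <;> rw [h] <;> norm_num
    have hs2 : ∀ i, Real.sqrt |ev i| * Real.sqrt |ev i| = |ev i| := fun i => Real.mul_self_sqrt (abs_nonneg _)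
    have gen : ∀ a : ℝ, a * a = 1 → |a| = 1 → ∀ j, 0 < a * ev j → 
        (Real.sqrt |ev j|)⁻¹ * ev j * (Real.sqrt |ev j|)⁻¹ = a := by
      intro a ha ha' j hj
      have h3 : |ev j| = a * ev j := by
        have := abs_of_pos hj
        rw [abs_mul, ha', one_mul] at this; exact this
      have h4 := hs2 j
      have h5 := (hsq j).ne'
      field_simp
      rw [sq, h4, h3]
      linear_combination (-(ev j)) * ha
    by_cases hi : i = 2
    · subst hi
      simp only [hτ2]
      rw [gen (s * e) (by linear_combination e*e*hss + hee) (by rw [abs_mul, hse, hee', one_mul]) k hposk]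
      simp
    · rw [gen s hss hse _ (hpos _ (hτi i hi))]
      fin_cases i <;> simp at hi ⊢

/-- the Lorentz cone -/
def lor : Set V3 := {x | 0 < x 2 ∧ x 0 ^ 2 + x 1 ^ 2 < x 2 ^ 2}

theorem lor_pair {a b x y z u : ℝ} (hz : 0 < z) (hxy : x ^ 2 + y ^ 2 < z ^ 2) (hu : 0 < u) (hab : a ^ 2 + b ^ 2 < u ^ 2) :
    u * (z ^ 2 - x ^ 2 - y ^ 2) ≤ 2 * z * (u * z - a * x - b * y) := by
  set ρ := Real.sqrt (x ^ 2 + y ^ 2) with hρ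
  have hρ0 : 0 ≤ ρ := Real.sqrt_nonneg _
  have hρ2 : ρ ^ 2 = x ^ 2 + y ^ 2 := Real.sq_sqrt (by positivity)
  have h1 : a * x + b * y ≤ u * ρ := by
    apply le_of_sq_le_sq _ (by positivity)
    rw [mul_pow, hρ2]
    nlinarith [sq_nonneg (a * y - b * x), mul_nonneg (sub_nonneg.mpr hab.le) (add_nonneg (sq_nonneg x) (sq_nonneg y))]
  have h2 : ρ ≤ z := by
    apply le_of_sq_le_sq _ hz.le; rw [hρ2]; exact hxy.le
  nlinarith [mul_nonneg hu.le (sq_nonneg (z - ρ)), mul_le_mul_of_nonneg_left h1 hz.le]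

namespace Crys
variable {G : Type} [Group G] {c : Crys G}

set_option maxHeartbeats 1000000 in
theorem Irred.cone (l : c.Irred) : Nonempty (Cone c) := by
  obtain ⟨T, hTd, hTt, hT⟩ := l.exists_form
  obtain ⟨P, s, e, hPd, hs, he, hP⟩ := sylvester T hTt hTd
  have hPu : IsUnit P.det := isUnit_iff_ne_zero.mpr hPd
  have hPQ : P * P⁻¹ = 1 := mul_nonsing_inv _ hPu
  have hQP : P⁻¹ * P = 1 := nonsing_inv_mul _ hPu
  set Q := P⁻¹ with hQ
  clear_value Q
  let S : G →* M3 :=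
    { toFun := fun g => Q * c.L g * P
      map_one' := by rw [map_one, mul_one, hQP]
      map_mul' := fun g h => by
        rw [map_mul]
        calc Q * (c.L g * c.L h) * P = Q * c.L g * 1 * c.L h * P := by simp only [mul_assoc, one_mul]
          _ = _ := by rw [← hPQ]; simp only [mul_assoc] }
  have hSd : ∀ g, S g = Q * c.L g * P := fun g => rfl
  have hLS : ∀ g, c.L g = P * S g * Q := by
    intro g
    rw [hSd]
    calc c.L g = (P * Q) * c.L g * (P * Q) := by rw [hPQ, one_mul, mul_one]
      _ = _ := by simp only [mul_assoc]
  have hdisc : ∀ R, {γ | ∀ i j, |S γ i j| ≤ R}.Finite := by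
    intro R
    obtain ⟨B1, hB1⟩ : ∃ B, ∀ i j, |P i j| ≤ B :=
      ⟨∑ i, ∑ j, |P i j|, fun i j => (Finset.single_le_sum (f := fun j => |P i j|) (fun _ _ => abs_nonneg _) (Finset.mem_univ j)).trans
        (Finset.single_le_sum (f := fun i => ∑ j, |P i j|) (fun _ _ => Finset.sum_nonneg fun _ _ => abs_nonneg _) (Finset.mem_univ i))⟩
    obtain ⟨B2, hB2⟩ : ∃ B, ∀ i j, |Q i j| ≤ B :=
      ⟨∑ i, ∑ j, |Q i j|, fun i j => (Finset.single_le_sum (f := fun j => |Q i j|) (fun _ _ => abs_nonneg _) (Finset.mem_univ j)).trans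
        (Finset.single_le_sum (f := fun i => ∑ j, |Q i j|) (fun _ _ => Finset.sum_nonneg fun _ _ => abs_nonneg _) (Finset.mem_univ i))⟩
    refine (l.disc (∑ k : Fin 3, (∑ k' : Fin 3, B1 * R) * B2)).subset ?_
    intro γ hγ i j
    rw [hLS, Matrix.mul_apply]
    have hB10 : 0 ≤ B1 := (abs_nonneg _).trans (hB1 0 0)
    have hR0 : 0 ≤ R := (abs_nonneg _).trans (hγ 0 0)
    refine (Finset.abs_sum_le_sum_abs _ _).trans (Finset.sum_le_sum fun k _ => ?_)
    rw [abs_mul, Matrix.mul_apply]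
    refine mul_le_mul ?_ (hB2 _ _) (abs_nonneg _) (by positivity)
    refine (Finset.abs_sum_le_sum_abs _ _).trans (Finset.sum_le_sum fun k' _ => ?_)
    rw [abs_mul]
    exact mul_le_mul (hB1 _ _) (hγ _ _) (abs_nonneg _) hB10
  set E : M3 := diagonal ![1, 1, e] with hE
  have hSE : ∀ g, (S g)ᵀ * E * S g = E := by
    intro g
    have h1 : (S g)ᵀ * (s • E) * S g = s • E := by
      rw [← hP, hSd, transpose_mul, transpose_mul]
      calc Pᵀ * ((c.L g)ᵀ * Qᵀ) * (Pᵀ * T * P) * (Q * c.L g * P)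
          = Pᵀ * (c.L g)ᵀ * (Qᵀ * Pᵀ) * T * (P * Q) * c.L g * P := by simp only [mul_assoc]
        _ = Pᵀ * ((c.L g)ᵀ * T * c.L g) * P := by
            have hQt : Qᵀ * Pᵀ = 1 := by rw [← transpose_mul, hPQ, transpose_one]
            rw [hPQ, hQt]; simp only [mul_assoc, one_mul, mul_one]
        _ = _ := by rw [hT]
    rw [Matrix.mul_smul, Matrix.smul_mul] at h1
    exact smul_right_injective _ hs h1
  have ent : ∀ g i j, S g 0 i * S g 0 j + S g 1 i * S g 1 j + e * (S g 2 i * S g 2 j) = E i j := by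
    intro g i j
    have := congrFun (congrFun (hSE g) i) j
    rw [← this, hE]
    simp [Matrix.mul_apply, Fin.sum_univ_three]; ring
  rcases he with he | he
  · -- definite
    exfalso
    subst he
    have : ∀ γ, ∀ i j, |S γ i j| ≤ 1 := by
      intro γ i j
      have h1 := ent γ j j
      have h2 : E j j = 1 := by rw [hE]; fin_cases j <;> simp
      rw [h2] at h1
      rw [← sq_le_one_iff_abs_le_one]
      have q0 := mul_self_nonneg (S γ 0 j); have q1 := mul_self_nonneg (S γ 1 j); have q2 := mul_self_nonneg (S γ 2 j)
      fin_cases i <;> simp only [Fin.zero_eta, Fin.mk_one, Fin.reduceFinMk] <;> nlinarith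
    exact l.not_finite_L _ (hdisc 1) (fun g => ⟨g, this g, rfl⟩)
  subst he
  have hEE : E * E = 1 := by
    rw [hE, diagonal_mul_diagonal, ← diagonal_one]; congr 1; funext i; fin_cases i <;> simp
  have hSE' : ∀ g, S g * E * (S g)ᵀ = E := by
    intro g
    have h1 : (E * (S g)ᵀ * E) * S g = 1 := by
      rw [mul_assoc, mul_assoc, ← mul_assoc (S g)ᵀ, hSE, hEE]
    have h2 := mul_eq_one_comm.mp h1
    calc S g * E * (S g)ᵀ = S g * (E * (S g)ᵀ * E) * E := by
          simp only [mul_assoc, hEE, mul_one]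
      _ = E := by rw [h2, one_mul]
  have row : ∀ g, S g 2 0 ^ 2 + S g 2 1 ^ 2 = S g 2 2 ^ 2 - 1 := by
    intro g
    have := congrFun (congrFun (hSE' g) 2) 2
    rw [hE] at this
    simp [Matrix.mul_apply, Fin.sum_univ_three] at this
    nlinarith
  have e00 : E 0 0 = 1 := by rw [hE]; simp
  have e11 : E 1 1 = 1 := by rw [hE]; simp
  have e22 : E 2 2 = -1 := by rw [hE]; simp
  have q_inv : ∀ g (x y : V3), (S g *ᵥ x) 0 * (S g *ᵥ y) 0 + (S g *ᵥ x) 1 * (S g *ᵥ y) 1 - (S g *ᵥ x) 2 * (S g *ᵥ y) 2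
      = x 0 * y 0 + x 1 * y 1 - x 2 * y 2 := by
    intro g x y
    have h : ∀ u v : V3, u 0 * v 0 + u 1 * v 1 - u 2 * v 2 = u ⬝ᵥ (E *ᵥ v) := by
      intro u v; rw [hE]; simp [dotProduct, Fin.sum_univ_three, mulVec_diagonal]; ring
    rw [h, h, dotProduct_mulVec, ← vecMul_transpose, vecMul_vecMul, dotProduct_mulVec, vecMul_vecMul, hSE,
      ← dotProduct_mulVec]
  -- sign
  have hS22 : ∀ g, 1 ≤ S g 2 2 ^ 2 := fun g => by nlinarith [row g, sq_nonneg (S g 2 0), sq_nonneg (S g 2 1)]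
  have hne : ∀ g, S g 2 2 ≠ 0 := fun g h => by have := hS22 g; rw [h] at this; norm_num at this
  have hsgn : ∀ g, ∀ x ∈ lor, 0 < S g 2 2 * (S g *ᵥ x) 2 := by
    intro g x ⟨hx1, hx2⟩
    have h1 : (S g *ᵥ x) 2 = S g 2 0 * x 0 + S g 2 1 * x 1 + S g 2 2 * x 2 := by
      simp [mulVec, dotProduct, Fin.sum_univ_three]
    rw [h1]
    have h2 := row g
    have h3 := hS22 g
    have h4 := lor_pair (a := -(S g 2 0)) (b := -(S g 2 1)) (u := |S g 2 2|) hx1 hx2 (abs_pos.mpr (hne g))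
      (by rw [sq_abs]; nlinarith)
    have h5 := lor_pair (a := (S g 2 0)) (b := (S g 2 1)) (u := |S g 2 2|) hx1 hx2 (abs_pos.mpr (hne g))
      (by rw [sq_abs]; nlinarith)
    have h6 : 0 < |S g 2 2| * (x 2 ^ 2 - x 0 ^ 2 - x 1 ^ 2) :=
      mul_pos (abs_pos.mpr (hne g)) (by linarith)
    have h7 := (mul_pos_iff_of_pos_left (by positivity)).mp (h6.trans_le h4)
    have h8 := (mul_pos_iff_of_pos_left (by positivity)).mp (h6.trans_le h5)
    rcases lt_or_gt_of_ne (hne g) with hh | hh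
    · rw [abs_of_neg hh] at h8
      exact mul_pos_of_neg_of_neg hh (by linarith)
    · rw [abs_of_pos hh] at h7
      exact mul_pos hh (by linarith)
  have hsgn_eq : ∀ a b : ℝ, 0 < a * b → SignType.sign a = SignType.sign b := by
    intro a b h
    rcases pos_and_pos_or_neg_and_neg_of_mul_pos h with ⟨h1, h2⟩ | ⟨h1, h2⟩
    · rw [sign_pos h1, sign_pos h2]
    · rw [sign_neg h1, sign_neg h2]
  let sg : G → ℝ := fun g => (SignType.sign (S g 2 2) : ℝ)
  have hsg : ∀ g, (0 < S g 2 2 ∧ sg g = 1) ∨ (S g 2 2 < 0 ∧ sg g = -1) := by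
    intro g
    rcases lt_or_gt_of_ne (hne g) with hh | hh
    · right; exact ⟨hh, by simp [sg, sign_neg hh]⟩
    · left; exact ⟨hh, by simp [sg, sign_pos hh]⟩
  have hsg2 : ∀ g, sg g * sg g = 1 := fun g => by rcases hsg g with ⟨_, h⟩ | ⟨_, h⟩ <;> rw [h] <;> norm_num
  have hmap : ∀ g, ∀ x ∈ lor, (sg g • S g) *ᵥ x ∈ lor := by
    intro g x hx
    have h1 := hsgn g x hx
    have h2 := q_inv g x x
    rw [smul_mulVec]
    constructor
    · simp only [Pi.smul_apply, smul_eq_mul]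
      rcases hsg g with ⟨h, h'⟩ | ⟨h, h'⟩ <;> rw [h'] <;> nlinarith
    · simp only [Pi.smul_apply, smul_eq_mul]
      have := hx.2
      nlinarith [hsg2 g]
  have he2 : (Pi.single 2 1 : V3) ∈ lor := by simp [lor]
  have hsgm : ∀ g h, sg (g * h) = sg g * sg h := by
    intro g h
    have h1 := hsgn g _ (hmap h _ he2)
    rw [smul_mulVec, mulVec_smul, mulVec_mulVec, ← map_mul, mulVec_single_one] at h1
    simp only [Pi.smul_apply, smul_eq_mul, col_apply] at h1
    rcases hsg g with ⟨h2, h3⟩ | ⟨h2, h3⟩ <;> rcases hsg h with ⟨h4, h5⟩ | ⟨h4, h5⟩ <;>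
      rcases hsg (g * h) with ⟨h6, h7⟩ | ⟨h6, h7⟩ <;> rw [h5] at h1 <;> rw [h3, h5, h7] <;> first | (norm_num; done) | (exfalso; nlinarith)
  refine ⟨{ σ := { toFun := fun g => sg g • S g, map_one' := ?_, map_mul' := ?_ }
            C := lor
            isOpen := ?_, add := ?_, smul := ?_, v0 := Pi.single 2 1, hv0 := he2, w := Pi.single 2 1
            pos := ?_, map := hmap, disc := ?_ }⟩
  · have : sg 1 = 1 := by simp [sg]
    rw [this, map_one, one_smul]
  · intro g h
    rw [hsgm, map_mul, smul_mul_smul_comm]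
  · have h1 : IsOpen {x : V3 | 0 < x 2} := isOpen_lt continuous_const (by fun_prop)
    have h2 : IsOpen {x : V3 | x 0 ^ 2 + x 1 ^ 2 < x 2 ^ 2} := isOpen_lt (by fun_prop) (by fun_prop)
    exact h1.inter h2
  · intro x hx y hy
    have h1 := lor_pair (a := -(x 0)) (b := -(x 1)) (u := x 2) hy.1 hy.2 hx.1 (by simpa using hx.2)
    have h2 := lor_pair (a := (x 0)) (b := (x 1)) (u := x 2) hy.1 hy.2 hx.1 (by simpa using hx.2)
    obtain ⟨hx1, hx2⟩ := hx
    obtain ⟨hy1, hy2⟩ := hy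
    refine ⟨by simpa using add_pos hx1 hy1, ?_⟩
    simp only [Pi.add_apply]
    have h6 : 0 < x 2 * (y 2 ^ 2 - y 0 ^ 2 - y 1 ^ 2) := mul_pos hx1 (by linarith)
    have h8 := (mul_pos_iff_of_pos_left (by positivity)).mp (h6.trans_le h2)
    nlinarith
  · intro t ht x ⟨h1, h2⟩
    refine ⟨by simpa using mul_pos ht h1, ?_⟩
    simp only [Pi.smul_apply, smul_eq_mul]
    have := mul_pos (mul_pos ht ht) (sub_pos.mpr h2)
    nlinarith
  · intro x hx
    rw [single_dotProduct, one_mul]; exact hx.1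
  · intro K hK hKC
    obtain ⟨m, hm, hmK⟩ := cpt_lower hK (f := fun x => x 2 ^ 2 - x 0 ^ 2 - x 1 ^ 2) (by fun_prop)
      (fun x hx => by have := (hKC hx).2; linarith)
    obtain ⟨M, hM, hMK⟩ := cpt_upper hK (f := fun x => x 2) (by fun_prop)
    refine (hdisc (1 + 4 * M ^ 4 / m ^ 2)).subset ?_
    rintro g ⟨x, hx, t, ht, hy⟩
    have hy' : t • ((sg g • S g) *ᵥ x) ∈ K := hy
    have hxC := hKC hx
    have hyC := hmap g x hxC
    have huC := hmap g _ he2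
    have hp := lor_pair hyC.1 hyC.2 huC.1 huC.2
    have hdx := hmK _ hx
    have hdy := hmK _ hy'
    have hMx := hMK _ hx
    have hMy := hMK _ hy'
    have hq := q_inv g x x
    have hq2 := q_inv g (Pi.single 2 1) x
    rw [smul_mulVec] at hyC huC hp hdy hMy
    rw [smul_mulVec] at hp
    rw [mulVec_single_one] at hp hq2 huC
    simp only [Pi.smul_apply, smul_eq_mul, col_apply] at hp hq2 hdy hMy hyC huC
    simp [-mulVec_single_one] at hq2
    have hu : (sg g * S g 2 2) ^ 2 = S g 2 2 ^ 2 := by rw [mul_pow, sq (sg g), hsg2, one_mul]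
    set u := sg g * S g 2 2 with hu'
    set y2 := sg g * (S g *ᵥ x) 2 with hy2
    have hu0 : 0 < u := huC.1
    have hy0 : 0 < y2 := hyC.1
    set q := x 2 ^ 2 - x 0 ^ 2 - x 1 ^ 2 with hqd
    have hx0 : 0 < x 2 := hxC.1
    have hq0 : 0 ≤ q := by have := hxC.2; rw [hqd]; linarith
    have f1 : u * q ≤ 2 * y2 * x 2 := by
      have e1 : y2 ^ 2 - (sg g * (S g *ᵥ x) 0) ^ 2 - (sg g * (S g *ᵥ x) 1) ^ 2 = q := by
        rw [hy2, hqd]; linear_combination ((S g *ᵥ x) 2^2 - (S g *ᵥ x) 0^2 - (S g *ᵥ x) 1^2) * hsg2 g - hq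
      have e2 : u * y2 - sg g * S g 0 2 * (sg g * (S g *ᵥ x) 0) - sg g * S g 1 2 * (sg g * (S g *ᵥ x) 1) = x 2 := by
        rw [hy2, hu']; linear_combination (S g 2 2 * (S g *ᵥ x) 2 - S g 0 2 * (S g *ᵥ x) 0 - S g 1 2 * (S g *ᵥ x) 1) * hsg2 g - hq2
      rw [e1, e2] at hp; exact hp
    have f2 : m ≤ t ^ 2 * q := by
      have e1 : (t * y2) ^ 2 - (t * (sg g * (S g *ᵥ x) 0)) ^ 2 - (t * (sg g * (S g *ᵥ x) 1)) ^ 2 = t ^ 2 * q := by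
        rw [hy2, hqd]; linear_combination t^2*((S g *ᵥ x) 2^2 - (S g *ᵥ x) 0^2 - (S g *ᵥ x) 1^2) * hsg2 g - t^2*hq
      rw [e1] at hdy; exact hdy
    have f3 : t * y2 ≤ M := hMy
    have f4 : u ^ 2 * m ^ 2 ≤ 4 * M ^ 4 := by
      calc u ^ 2 * m ^ 2 = u ^ 2 * (m * m) := by ring
        _ ≤ u ^ 2 * (q * (t ^ 2 * q)) := by gcongr
        _ = t ^ 2 * (u * q) ^ 2 := by ring
        _ ≤ t ^ 2 * (2 * y2 * x 2) ^ 2 := by gcongr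
        _ = 4 * (t * y2) ^ 2 * x 2 ^ 2 := by ring
        _ ≤ 4 * M ^ 2 * M ^ 2 := by gcongr
        _ = _ := by ring
    have f5 : S g 2 2 ^ 2 ≤ 4 * M ^ 4 / m ^ 2 := by
      rw [← hu, le_div_iff₀ (by positivity)]; exact f4
    have hr := row g
    have c0 := ent g 0 0; have c1 := ent g 1 1; have c2 := ent g 2 2
    rw [e00] at c0; rw [e11] at c1; rw [e22] at c2
    intro i j
    have q20 := sq_nonneg (S g 2 0); have q21 := sq_nonneg (S g 2 1)
    have q00 := sq_nonneg (S g 0 0); have q01 := sq_nonneg (S g 0 1); have q02 := sq_nonneg (S g 0 2)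
    have q10 := sq_nonneg (S g 1 0); have q11 := sq_nonneg (S g 1 1); have q12 := sq_nonneg (S g 1 2)
    simp only [← sq] at c0 c1 c2
    have hsq : S g i j ^ 2 ≤ 1 + 4 * M ^ 4 / m ^ 2 := by
      fin_cases i <;> fin_cases j <;> simp only [Fin.zero_eta, Fin.mk_one, Fin.reduceFinMk] <;> linarith
    have hX : 1 ≤ 1 + 4 * M ^ 4 / m ^ 2 := by
      have : 0 ≤ 4 * M ^ 4 / m ^ 2 := by positivity
      linarith
    apply abs_le_of_sq_le_sq _ (by linarith)
    nlinarith

end Crys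
end FG3
end Part13

section Part14
open Matrix
set_option linter.all false
namespace FG3
open scoped ContDiff
open MeasureTheory

/-- partial derivative -/
noncomputable def pd (j : Fin 3) (f : V3 → ℝ) : V3 → ℝ := fun x => fderiv ℝ f x (Pi.single j 1)

/-- smooth functions -/
abbrev Sm (f : V3 → ℝ) : Prop := ContDiff ℝ ∞ f

theorem Sm.pd {f : V3 → ℝ} (hf : Sm f) (j : Fin 3) : Sm (pd j f) := by
  have h : ContDiff ℝ ∞ (fderiv ℝ f) := hf.fderiv_right (m := ∞) (by simp)
  exact h.clm_apply contDiff_const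

theorem Sm.dif {f : V3 → ℝ} (hf : Sm f) : Differentiable ℝ f := hf.differentiable (by simp)

theorem pd_add {f g : V3 → ℝ} (hf : Sm f) (hg : Sm g) (j : Fin 3) (x : V3) :
    pd j (fun x => f x + g x) x = pd j f x + pd j g x := by
  have : fderiv ℝ (fun x => f x + g x) x = fderiv ℝ f x + fderiv ℝ g x :=
    fderiv_add (hf.dif x) (hg.dif x)
  rw [pd, this]; rfl

theorem pd_sub {f g : V3 → ℝ} (hf : Sm f) (hg : Sm g) (j : Fin 3) (x : V3) :
    pd j (fun x => f x - g x) x = pd j f x - pd j g x := by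
  have : fderiv ℝ (fun x => f x - g x) x = fderiv ℝ f x - fderiv ℝ g x :=
    fderiv_sub (hf.dif x) (hg.dif x)
  rw [pd, this]; rfl

theorem pd_mul {f g : V3 → ℝ} (hf : Sm f) (hg : Sm g) (j : Fin 3) (x : V3) :
    pd j (fun x => f x * g x) x = f x * pd j g x + g x * pd j f x := by
  have : fderiv ℝ (fun x => f x * g x) x = f x • fderiv ℝ g x + g x • fderiv ℝ f x :=
    fderiv_mul (hf.dif x) (hg.dif x)
  rw [pd, this]; rfl

theorem pd_const (a : ℝ) (j : Fin 3) (x : V3) : pd j (fun _ => a) x = 0 := by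
  simp [pd]

theorem pd_comm {f : V3 → ℝ} (hf : Sm f) (j k : Fin 3) (x : V3) : pd j (pd k f) x = pd k (pd j f) x := by
  have h : ContDiff ℝ ∞ (fderiv ℝ f) := hf.fderiv_right (m := ∞) (by simp)
  have h1 : ∀ k j, pd j (pd k f) x = fderiv ℝ (fderiv ℝ f) x (Pi.single j 1) (Pi.single k 1) := by
    intro k j
    have h2 : DifferentiableAt ℝ (fderiv ℝ f) x := h.differentiable (by simp) x
    have h3 := h2.hasFDerivAt.clm_apply (hasFDerivAt_const (Pi.single k 1 : V3) x)
    have h4 : fderiv ℝ (pd k f) x = _ := h3.fderiv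
    show fderiv ℝ (pd k f) x _ = _
    rw [h4]; simp
  rw [h1, h1]
  have := (hf.contDiffAt (x := x)).isSymmSndFDerivAt (by simp; exact WithTop.coe_le_coe.2 le_top)
  exact this _ _

theorem fderiv_eq_pd {f : V3 → ℝ} (x v : V3) : fderiv ℝ f x v = ∑ j, pd j f x * v j := by
  conv_lhs => rw [← Finset.univ_sum_single v]
  rw [map_sum]
  refine Finset.sum_congr rfl fun j _ => ?_
  have : (Pi.single j (v j) : V3) = v j • Pi.single j 1 := by
    ext i; by_cases h : i = j
    · subst h; simp
    · simp [h]
  rw [this, map_smul, pd, smul_eq_mul, mul_comm]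

/-- derivative of the straight-line homotopy composed with a function -/
theorem pd_comp {ρ : V3 → ℝ} (hρ : Sm ρ) {u : V3 → V3} (hu : ContDiff ℝ ∞ u) (t : ℝ) (j : Fin 3) (x : V3) :
    pd j (fun x => ρ (x + t • u x)) x =
      pd j ρ (x + t • u x) + t * ∑ k, pd k ρ (x + t • u x) * pd j (fun y => u y k) x := by
  have hud : DifferentiableAt ℝ u x := hu.differentiable (by simp) x
  have h1 : HasFDerivAt (fun x => x + t • u x) (ContinuousLinearMap.id ℝ V3 + t • fderiv ℝ u x) x :=
    (hasFDerivAt_id x).add (hud.hasFDerivAt.const_smul t)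
  have h2 := (hρ.dif (x + t • u x)).hasFDerivAt.comp x h1
  have h3 : fderiv ℝ (fun x => ρ (x + t • u x)) x = _ := h2.fderiv
  have h4 : ∀ k, (fderiv ℝ u x (Pi.single j 1)) k = pd j (fun y => u y k) x := by
    intro k
    have := (hasFDerivAt_pi'.mp hud.hasFDerivAt k).fderiv
    rw [pd, this]; rfl
  rw [pd, h3]
  simp only [ContinuousLinearMap.comp_apply, ContinuousLinearMap.add_apply, ContinuousLinearMap.id_apply, map_add,
    ContinuousLinearMap.smul_apply, map_smul, smul_eq_mul]
  rw [fderiv_eq_pd _ (fderiv ℝ u x (Pi.single j 1))]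
  simp only [h4]; rfl

theorem hasDerivAt_comp {ρ : V3 → ℝ} (hρ : Sm ρ) (x v : V3) (t : ℝ) :
    HasDerivAt (fun t : ℝ => ρ (x + t • v)) (∑ k, pd k ρ (x + t • v) * v k) t := by
  have h1 : HasDerivAt (fun t : ℝ => x + t • v) v t := by
    simpa using ((hasDerivAt_id t).smul_const v).const_add x
  have := (hρ.dif (x + t • v)).hasFDerivAt.comp_hasDerivAt t h1
  rw [fderiv_eq_pd] at this; exact this

/-- Jacobian -/
noncomputable def Jac (u : V3 → V3) (x : V3) : M3 := Matrix.of fun i j => pd j (fun y => u y i) x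

noncomputable def XX (ρ : V3 → ℝ) (u : V3 → V3) (t : ℝ) (x : V3) : V3 :=
  ρ (x + t • u x) • (adjugate (1 + t • Jac u x) *ᵥ u x)

theorem Sm.comp_line {ρ : V3 → ℝ} (hρ : Sm ρ) {u : V3 → V3} (hu : ContDiff ℝ ∞ u) (t : ℝ) :
    Sm (fun x => ρ (x + t • u x)) := hρ.comp (contDiff_id.add (hu.const_smul t))

theorem pdT {p q r s v : V3 → ℝ} (hp : Sm p) (hq : Sm q) (hr : Sm r) (hs : Sm s) (hv : Sm v) (k : Fin 3) (x : V3) :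
    pd k (fun y => (p y * q y - r y * s y) * v y) x = (p x * q x - r x * s x) * pd k v x +
      v x * (p x * pd k q x + q x * pd k p x - (r x * pd k s x + s x * pd k r x)) := by
  rw [pd_mul ((hp.mul hq).sub (hr.mul hs)) hv, pd_sub (hp.mul hq) (hr.mul hs), pd_mul hp hq, pd_mul hr hs]

theorem pdX {R f0 f1 f2 : V3 → ℝ} (hR : Sm R) (h0 : Sm f0) (h1 : Sm f1) (h2 : Sm f2) (k : Fin 3) (x : V3) :
    pd k (fun y => R y * (f0 y + f1 y + f2 y)) x = R x * (pd k f0 x + pd k f1 x + pd k f2 x) +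
      (f0 x + f1 x + f2 x) * pd k R x := by
  rw [pd_mul hR ((h0.add h1).add h2), pd_add (h0.add h1) h2, pd_add h0 h1]

/-- explicit time derivative -/
noncomputable def DD (ρ : V3 → ℝ) (u : V3 → V3) (t : ℝ) (x : V3) : ℝ :=
  (∑ k, pd k ρ (x + t • u x) * u x k) * (1 + t • Jac u x).det
    + ρ (x + t • u x) * (adjugate (1 + t • Jac u x) * Jac u x).trace

theorem hasDerivAt_J {ρ : V3 → ℝ} (hρ : Sm ρ) (u : V3 → V3) (x : V3) (t : ℝ) :
    HasDerivAt (fun t : ℝ => ρ (x + t • u x) * (1 + t • Jac u x).det) (DD ρ u t x) t := by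
  have hdet : HasDerivAt (fun t : ℝ => (1 + t • Jac u x).det) ((adjugate (1 + t • Jac u x) * Jac u x).trace) t := by
    have e : (fun t : ℝ => (1 + t • Jac u x).det) = fun t => 1 + t * (Jac u x).trace + t ^ 2 *
      (adjugate (Jac u x)).trace + t ^ 3 * (Jac u x).det := by
      funext t
      simp [det_fin_three, adjugate_fin_three, trace_fin_three]; ring
    rw [e]
    have h1 : HasDerivAt (fun t : ℝ => 1 + t * (Jac u x).trace + t ^ 2 *
      (adjugate (Jac u x)).trace + t ^ 3 * (Jac u x).det) ((Jac u x).trace + 2 * t * (adjugate (Jac u x)).trace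
        + 3 * t ^ 2 * (Jac u x).det) t := by
      have q1 := ((hasDerivAt_id t).mul_const (Jac u x).trace).const_add 1
      have q2 := (hasDerivAt_pow 2 t).mul_const (adjugate (Jac u x)).trace
      have q3 := (hasDerivAt_pow 3 t).mul_const (Jac u x).det
      refine ((q1.add q2).add q3).congr_deriv ?_
      simp
    refine h1.congr_deriv ?_
    simp [det_fin_three, adjugate_fin_three, trace_fin_three, Matrix.mul_apply, Fin.sum_univ_three, vecMul, dotProduct]; ring
  exact (hasDerivAt_comp hρ x (u x) t).mul hdet

set_option maxHeartbeats 4000000 in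
theorem piola {ρ : V3 → ℝ} (hρ : Sm ρ) {u : V3 → V3} (hu : ContDiff ℝ ∞ u) (x : V3) (t : ℝ) :
    DD ρ u t x = ∑ j, pd j (fun y => XX ρ u t y j) x := by
  have hui : ∀ i, Sm (fun y => u y i) := fun i => contDiff_pi.mp hu i
  have hR : Sm (fun y => ρ (y + t • u y)) := hρ.comp_line hu t
  have ha : ∀ i j, Sm (pd j (fun y => u y i)) := fun i j => (hui i).pd j
  have hm : ∀ i j, ∃ m : V3 → ℝ, Sm m ∧ (∀ y, m y = (1 + t • Jac u y) i j) ∧ ∀ k, pd k m x = t * pd k (pd j (fun y => u y i)) x := by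
    intro i j
    refine ⟨fun y => (1 : M3) i j + t * pd j (fun y => u y i) y, contDiff_const.add (contDiff_const.mul (ha i j)), fun y => rfl, ?_⟩
    intro k
    rw [pd_add contDiff_const (contDiff_const.mul (ha i j)), pd_const, pd_mul contDiff_const (ha i j), pd_const]
    ring
  choose m hm1 hm2 hm3 using hm
  have hT : ∀ (p q r s v : V3 → ℝ), Sm p → Sm q → Sm r → Sm s → Sm v → Sm (fun y => (p y * q y - r y * s y) * v y) :=
    fun p q r s v hp hq hr hs hv => ((hp.mul hq).sub (hr.mul hs)).mul hv
  have key : ∀ (j i1 j1 i2 j2 i3 j3 i4 j4 k1 l1 k2 l2 k3 l3 k4 l4 n1 o1 n2 o2 n3 o3 n4 o4 : Fin 3),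
    (∀ y, XX ρ u t y j = ρ (y + t • u y) * ((m i1 j1 y * m i2 j2 y - m i3 j3 y * m i4 j4 y) * u y 0
      + (m k1 l1 y * m k2 l2 y - m k3 l3 y * m k4 l4 y) * u y 1 + (m n1 o1 y * m n2 o2 y - m n3 o3 y * m n4 o4 y) * u y 2)) →
    pd j (fun y => XX ρ u t y j) x = ρ (x + t • u x) * (((m i1 j1 x * m i2 j2 x - m i3 j3 x * m i4 j4 x) * pd j (fun y => u y 0) x +
      u x 0 * (m i1 j1 x * pd j (m i2 j2) x + m i2 j2 x * pd j (m i1 j1) x - (m i3 j3 x * pd j (m i4 j4) x + m i4 j4 x * pd j (m i3 j3) x)))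
      + ((m k1 l1 x * m k2 l2 x - m k3 l3 x * m k4 l4 x) * pd j (fun y => u y 1) x +
      u x 1 * (m k1 l1 x * pd j (m k2 l2) x + m k2 l2 x * pd j (m k1 l1) x - (m k3 l3 x * pd j (m k4 l4) x + m k4 l4 x * pd j (m k3 l3) x)))
      + ((m n1 o1 x * m n2 o2 x - m n3 o3 x * m n4 o4 x) * pd j (fun y => u y 2) x +
      u x 2 * (m n1 o1 x * pd j (m n2 o2) x + m n2 o2 x * pd j (m n1 o1) x - (m n3 o3 x * pd j (m n4 o4) x + m n4 o4 x * pd j (m n3 o3) x))))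
     + ((m i1 j1 x * m i2 j2 x - m i3 j3 x * m i4 j4 x) * u x 0
      + (m k1 l1 x * m k2 l2 x - m k3 l3 x * m k4 l4 x) * u x 1 + (m n1 o1 x * m n2 o2 x - m n3 o3 x * m n4 o4 x) * u x 2)
      * pd j (fun y => ρ (y + t • u y)) x := by
    intro j i1 j1 i2 j2 i3 j3 i4 j4 k1 l1 k2 l2 k3 l3 k4 l4 n1 o1 n2 o2 n3 o3 n4 o4 h
    rw [funext h, pdX hR (hT _ _ _ _ _ (hm1 _ _) (hm1 _ _) (hm1 _ _) (hm1 _ _) (hui 0)) (hT _ _ _ _ _ (hm1 _ _) (hm1 _ _) (hm1 _ _) (hm1 _ _) (hui 1))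
      (hT _ _ _ _ _ (hm1 _ _) (hm1 _ _) (hm1 _ _) (hm1 _ _) (hui 2)), pdT (hm1 _ _) (hm1 _ _) (hm1 _ _) (hm1 _ _) (hui _),
      pdT (hm1 _ _) (hm1 _ _) (hm1 _ _) (hm1 _ _) (hui _), pdT (hm1 _ _) (hm1 _ _) (hm1 _ _) (hm1 _ _) (hui _)]
  have hX : ∀ y j, XX ρ u t y j = ρ (y + t • u y) * (adjugate (1 + t • Jac u y) j 0 * u y 0 + adjugate (1 + t • Jac u y) j 1 * u y 1
      + adjugate (1 + t • Jac u y) j 2 * u y 2) := by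
    intro y j
    simp [XX, mulVec, dotProduct, Fin.sum_univ_three]
  have s0 := key 0 1 1 2 2 1 2 2 1 0 2 2 1 0 1 2 2 0 1 1 2 0 2 1 1 (by
    intro y; rw [hX, adjugate_fin_three]; simp only [hm2]; simp only [Matrix.of_apply, Matrix.cons_val]; ring)
  have s1 := key 1 1 2 2 0 1 0 2 2 0 0 2 2 0 2 2 0 0 2 1 0 0 0 1 2 (by
    intro y; rw [hX, adjugate_fin_three]; simp only [hm2]; simp only [Matrix.of_apply, Matrix.cons_val]; ring)
  have s2 := key 2 1 0 2 1 1 1 2 0 0 1 2 0 0 0 2 1 0 0 1 1 0 1 1 0 (by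
    intro y; rw [hX, adjugate_fin_three]; simp only [hm2]; simp only [Matrix.of_apply, Matrix.cons_val]; ring)
  rw [DD, Fin.sum_univ_three, Fin.sum_univ_three, s0, s1, s2]
  simp only [pd_comp hρ hu, hm3, hm2, Fin.sum_univ_three]
  rw [pd_comm (hui 0) 1 0, pd_comm (hui 0) 2 0, pd_comm (hui 0) 2 1, pd_comm (hui 1) 1 0, pd_comm (hui 1) 2 0, pd_comm (hui 1) 2 1,
    pd_comm (hui 2) 1 0, pd_comm (hui 2) 2 0, pd_comm (hui 2) 2 1]
  have o00 : (1 : M3) 0 0 = 1 := by simp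
  have o01 : (1 : M3) 0 1 = 0 := by simp
  have o02 : (1 : M3) 0 2 = 0 := by simp
  have o10 : (1 : M3) 1 0 = 0 := by simp
  have o11 : (1 : M3) 1 1 = 1 := by simp
  have o12 : (1 : M3) 1 2 = 0 := by simp
  have o20 : (1 : M3) 2 0 = 0 := by simp
  have o21 : (1 : M3) 2 1 = 0 := by simp
  have o22 : (1 : M3) 2 2 = 1 := by simp
  simp only [Matrix.add_apply, Matrix.smul_apply, Jac, Matrix.of_apply, smul_eq_mul, trace_fin_three, Matrix.mul_apply, Fin.sum_univ_three,
    adjugate_fin_three, det_fin_three, o00, o01, o02, o10, o11, o12, o20, o21, o22, Matrix.cons_val]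
  ring

end FG3
end Part14

section Part15
open Matrix
set_option linter.all false
namespace FG3
open scoped ContDiff Topology
open MeasureTheory

theorem contDiffAt_finsum_loc {G : Type} {F : Type*} [NormedAddCommGroup F] [NormedSpace ℝ F] (k : G → V3 → F) (v : V3)
    (S : Finset G) (hS : ∀ᶠ y in 𝓝 v, ∀ g, k g y ≠ 0 → g ∈ S) (hk : ∀ g, ContDiffAt ℝ ∞ (k g) v) :
    ContDiffAt ℝ ∞ (fun y => ∑ᶠ g, k g y) v := by
  have h1 : ContDiffAt ℝ ∞ (fun y => ∑ g ∈ S, k g y) v := ContDiffAt.sum fun g _ => hk g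
  refine h1.congr_of_eventuallyEq ?_
  filter_upwards [hS] with y hy
  exact finsum_eq_sum_of_support_subset _ (fun g hg => hy g hg)

namespace Crys
variable {G : Type} [Group G] (c : Crys G)

theorem hasFDerivAt_act (g : G) (x : V3) :
    HasFDerivAt (c.act g) (LinearMap.toContinuousLinearMap (Matrix.mulVecLin (c.L g))) x := by
  have h := (LinearMap.toContinuousLinearMap (Matrix.mulVecLin (c.L g))).hasFDerivAt (x := x)
  exact h.add_const (c.b g)

theorem contDiff_act (g : G) : ContDiff ℝ ∞ (c.act g) := by
  have h := (LinearMap.toContinuousLinearMap (Matrix.mulVecLin (c.L g))).contDiff (n := ∞)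
  exact h.add contDiff_const

theorem integral_act (g : G) (f : V3 → ℝ) : ∫ x, f (c.act g x) = |(c.L g).det|⁻¹ * ∫ x, f x := by
  let e : V3 ≃ₜ V3 := 
    { toFun := c.act g, invFun := c.act g⁻¹, left_inv := c.act_inv_act g, right_inv := c.act_act_inv g
      continuous_toFun := c.continuous_act g, continuous_invFun := c.continuous_act g⁻¹ }
  have h1 : Measure.map (c.act g) (volume : Measure V3) = ENNReal.ofReal |((c.L g).det)⁻¹| • volume := by
    have h2 : c.act g = (fun y => y + c.b g) ∘ (toLin' (c.L g)) := by
      funext x; simp [act]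
    rw [h2, ← Measure.map_map (by fun_prop) (LinearMap.continuous_of_finiteDimensional _).measurable,
      Real.map_matrix_volume_pi_eq_smul_volume_pi (c.det_ne g), Measure.map_smul, map_add_right_eq_self]
  have h3 := e.measurableEmbedding.integral_map (μ := volume) f
  have h4 : Measure.map e (volume : Measure V3) = ENNReal.ofReal |((c.L g).det)⁻¹| • volume := h1
  rw [h4, integral_smul_measure, ENNReal.toReal_ofReal (abs_nonneg _), abs_inv] at h3
  exact h3.symm

/-- finite set of elements moving the ball to itself -/
noncomputable def Fin' (R : ℝ) : Finset G := (c.proper R).toFinset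

theorem mem_Fin' {R : ℝ} {g : G} (x : V3) (h1 : ‖x‖ ≤ R) (h2 : ‖c.act g x‖ ≤ R) : g ∈ c.Fin' R := by
  rw [Fin', Set.Finite.mem_toFinset]; exact ⟨x, h1, h2⟩

theorem stokes0 {χ : V3 → ℝ} (hχ : Sm χ) {R : ℝ} (hR : ∀ x, χ x ≠ 0 → ‖x‖ ≤ R)
    (hsum : ∀ x, ∑ᶠ g, χ (c.act g x) = 1) {X : V3 → V3} (hX : Continuous X)
    (heq : ∀ g x, X (c.act g x) = |(c.L g).det|⁻¹ • (c.L g *ᵥ X x)) : ∫ x, fderiv ℝ χ x (X x) = 0 := by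
  have hts : tsupport χ ⊆ Metric.closedBall 0 R :=
    closure_minimal (fun x hx => by simpa using hR x hx) Metric.isClosed_closedBall
  have hcs : HasCompactSupport χ := HasCompactSupport.of_support_subset_isCompact (isCompact_closedBall (0 : V3) R)
    (fun x hx => by simpa using hR x hx)
  have hfd : Continuous (fderiv ℝ χ) := (hχ.fderiv_right (m := ∞) (by simp)).continuous
  have hΦc : Continuous fun x => fderiv ℝ χ x (X x) := hfd.clm_apply hX
  have hΦ0 : ∀ x, fderiv ℝ χ x (X x) ≠ 0 → ‖x‖ ≤ R := by
    intro x hx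
    have : x ∈ tsupport χ := by
      by_contra h
      exact hx (by rw [fderiv_of_notMem_tsupport ℝ h]; rfl)
    simpa using hts this
  have hintg : ∀ f : V3 → ℝ, Continuous f → (∀ x, f x ≠ 0 → ‖x‖ ≤ R) → Integrable f := by
    intro f hf h
    exact hf.integrable_of_hasCompactSupport (HasCompactSupport.of_support_subset_isCompact (isCompact_closedBall (0 : V3) R)
      (fun x hx => by simpa using h x hx))
  have s1 : ∀ x, ‖x‖ ≤ R → ∑ g ∈ c.Fin' R, χ (c.act g x) = 1 := by
    intro x hx
    rw [← hsum x]
    exact (finsum_eq_sum_of_support_subset _ (fun g hg => c.mem_Fin' x hx (hR _ hg))).symm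
  have s2 : ∀ x, ‖x‖ ≤ R → ∑ g ∈ c.Fin' R, χ (c.act g⁻¹ x) = 1 := by
    intro x hx
    rw [← hsum x, ← finsum_comp_equiv (Equiv.inv G)]
    refine (finsum_eq_sum_of_support_subset _ (fun g hg => ?_)).symm
    refine c.mem_Fin' (c.act g⁻¹ x) (hR _ hg) ?_
    rw [c.act_act_inv]; exact hx
  have e1 : ∫ x, fderiv ℝ χ x (X x) = ∫ x, ∑ g ∈ c.Fin' R, χ (c.act g x) * fderiv ℝ χ x (X x) := by
    congr 1; funext x
    by_cases h : fderiv ℝ χ x (X x) = 0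
    · simp [h]
    · rw [← Finset.sum_mul, s1 x (hΦ0 x h), one_mul]
  have hχc : Continuous χ := hχ.continuous
  rw [e1, integral_finset_sum]
  swap
  · intro g _
    refine hintg _ ((hχc.comp (c.continuous_act g)).mul hΦc) (fun x hx => hΦ0 x (right_ne_zero_of_mul hx))
  have e2 : ∀ g, ∫ x, χ (c.act g x) * fderiv ℝ χ x (X x) = ∫ y, χ y * fderiv ℝ (fun z => χ (c.act g⁻¹ z)) y (X y) := by
    intro g
    have h1 := c.integral_act g (fun y => χ y * fderiv ℝ χ (c.act g⁻¹ y) (X (c.act g⁻¹ y)))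
    simp only [c.act_inv_act] at h1
    rw [h1, ← integral_const_mul]
    congr 1; funext y
    have h2 : fderiv ℝ (fun z => χ (c.act g⁻¹ z)) y = _ :=
      ((hχ.dif (c.act g⁻¹ y)).hasFDerivAt.comp y (c.hasFDerivAt_act g⁻¹ y)).fderiv
    rw [h2, heq]
    have hd : |(c.L g).det|⁻¹ * |(c.L g⁻¹).det|⁻¹ = 1 := by
      rw [← _root_.mul_inv_rev, ← abs_mul, ← det_mul, ← map_mul, inv_mul_cancel, map_one, det_one, abs_one, inv_one]
    rw [map_smul, smul_eq_mul]
    simp only [ContinuousLinearMap.comp_apply, LinearMap.coe_toContinuousLinearMap', mulVecLin_apply]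
    linear_combination (χ y * fderiv ℝ χ (c.act g⁻¹ y) (c.L g⁻¹ *ᵥ X y)) * hd
  have hsm : ∀ g, Sm (fun z => χ (c.act g⁻¹ z)) := fun g => hχ.comp (c.contDiff_act g⁻¹)
  simp only [e2]
  rw [← integral_finset_sum]
  swap
  · intro g _
    have : Continuous (fderiv ℝ (fun z => χ (c.act g⁻¹ z))) := ((hsm g).fderiv_right (m := ∞) (by simp)).continuous
    exact hintg _ (hχc.mul (this.clm_apply hX)) (fun x hx => hR x (left_ne_zero_of_mul hx))
  rw [← integral_zero V3 ℝ]
  congr 1; funext y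
  by_cases hy : χ y = 0
  · simp [hy]
  have h5 : (fun z => ∑ g ∈ c.Fin' R, χ (c.act g⁻¹ z)) =ᶠ[𝓝 y] fun _ => 1 := by
    filter_upwards [(isOpen_ne_fun hχc continuous_const).mem_nhds hy] with z hz
    exact s2 z (hR z hz)
  have h6 := h5.fderiv_eq (𝕜 := ℝ)
  rw [fderiv_fun_sum (fun g _ => (hsm g).dif y), fderiv_fun_const] at h6
  rw [← Finset.mul_sum]
  have h7 := congrArg (fun T => T (X y)) h6
  simp only [ContinuousLinearMap.sum_apply] at h7
  rw [h7]; simp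

end Crys
end FG3
end Part15

section Part16
open Matrix
set_option linter.all false
namespace FG3
open scoped ContDiff Topology
open MeasureTheory

namespace Crys
variable {G : Type} [Group G] (c : Crys G)

/-- a bump function whose translates cover -/
structure Bmp (φ : V3 → ℝ) (R : ℝ) : Prop where
  sm : Sm φ
  nonneg : ∀ x, 0 ≤ φ x
  supp : ∀ x, φ x ≠ 0 → ‖x‖ ≤ R
  cov : ∀ x, ∃ g, 0 < φ (c.act g x)

theorem exists_bmp : ∃ φ R, c.Bmp φ R := by
  obtain ⟨R, hR⟩ := c.cocompact
  let f : ContDiffBump (0 : V3) := ⟨|R| + 1, |R| + 2, by positivity, by linarith⟩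
  refine ⟨f, |R| + 2, f.contDiff, fun x => f.nonneg, ?_, ?_⟩
  · intro x hx
    have : x ∈ Function.support f := hx
    rw [f.support_eq] at this
    have := (mem_ball_zero_iff.mp this).le
    exact this
  · intro x
    obtain ⟨g, hg⟩ := hR x
    refine ⟨g, f.pos_of_mem_ball ?_⟩
    rw [mem_ball_zero_iff]
    have : ‖c.act g x‖ ≤ R := hg
    have h2 : f.rOut = |R| + 2 := rfl
    rw [h2]
    linarith [le_abs_self R]

variable {c} {F : Type*} [NormedAddCommGroup F] [NormedSpace ℝ F] {φ : V3 → ℝ} {R : ℝ}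

/-- weighted sum over the orbit -/
noncomputable def avg (c : Crys G) (φ : V3 → ℝ) (w : G → F) (x : V3) : F := ∑ᶠ g, φ (c.act g x) • w g

theorem Bmp.mem (hb : c.Bmp φ R) {R' : ℝ} {x : V3} (hx : ‖x‖ ≤ R') {g : G} (h : φ (c.act g x) ≠ 0) :
    g ∈ c.Fin' (max R R') := 
  c.mem_Fin' x (hx.trans (le_max_right _ _)) ((hb.supp _ h).trans (le_max_left _ _))

theorem Bmp.avg_eq (hb : c.Bmp φ R) (w : G → F) {R' : ℝ} {x : V3} (hx : ‖x‖ ≤ R') :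
    c.avg φ w x = ∑ g ∈ c.Fin' (max R R'), φ (c.act g x) • w g := 
  finsum_eq_sum_of_support_subset _ (fun g hg => hb.mem hx (left_ne_zero_of_smul hg))

theorem Bmp.avg_sm (hb : c.Bmp φ R) (w : G → F) : ContDiff ℝ ∞ (c.avg φ w) := by
  rw [contDiff_iff_contDiffAt]
  intro x
  refine contDiffAt_finsum_loc _ x (c.Fin' (max R (‖x‖ + 1))) ?_ ?_
  · have h1 : IsOpen {y : V3 | ‖y‖ < ‖x‖ + 1} := isOpen_lt continuous_norm continuous_const
    filter_upwards [h1.mem_nhds (by simp : ‖x‖ < ‖x‖ + 1)] with y hy g hg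
    exact hb.mem (le_of_lt hy) (left_ne_zero_of_smul hg)
  · intro g
    exact ((hb.sm.comp (c.contDiff_act g)).smul contDiff_const).contDiffAt

theorem avg_act (w : G → F) (γ : G) (x : V3) : c.avg φ w (c.act γ x) = c.avg φ (fun g => w (g * γ⁻¹)) x := by
  unfold avg
  rw [← finsum_comp_equiv (Equiv.mulRight γ⁻¹)]
  simp only [Equiv.coe_mulRight, ← c.act_mul]
  simp [-map_mul]

theorem Bmp.avg_map (hb : c.Bmp φ R) {F' : Type*} [NormedAddCommGroup F'] [NormedSpace ℝ F'] (T : F →ₗ[ℝ] F') (w : G → F) (x : V3) :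
    T (c.avg φ w x) = c.avg φ (fun g => T (w g)) x := by
  rw [hb.avg_eq w le_rfl, hb.avg_eq _ le_rfl, map_sum]
  simp only [map_smul]

theorem Bmp.avg_pos (hb : c.Bmp φ R) (w : G → ℝ) (hw : ∀ g, 0 < w g) (x : V3) : 0 < c.avg φ w x := by
  rw [hb.avg_eq w le_rfl]
  obtain ⟨g, hg⟩ := hb.cov x
  refine Finset.sum_pos' (fun g _ => mul_nonneg (hb.nonneg _) (hw g).le) ⟨g, hb.mem le_rfl hg.ne', mul_pos hg (hw g)⟩

/-- partition of unity -/
theorem exists_chi (hb : c.Bmp φ R) : ∃ χ : V3 → ℝ, Sm χ ∧ (∀ x, 0 ≤ χ x) ∧ (∀ x, χ x ≠ 0 → ‖x‖ ≤ R) ∧ (∃ x, χ x ≠ 0) ∧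
    ∀ x, ∑ᶠ g, χ (c.act g x) = 1 := by
  have hp : ∀ x, 0 < c.avg φ (fun _ => (1 : ℝ)) x := hb.avg_pos _ (fun _ => one_pos)
  refine ⟨fun x => φ x / c.avg φ (fun _ => (1 : ℝ)) x, hb.sm.div (hb.avg_sm _) (fun x => (hp x).ne'), 
    fun x => div_nonneg (hb.nonneg x) (hp x).le, ?_, ?_, ?_⟩
  · intro x hx
    exact hb.supp x (fun h => hx (by simp [h]))
  · obtain ⟨g, hg⟩ := hb.cov 0
    exact ⟨_, (div_pos hg (hp _)).ne'⟩
  · intro x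
    have h1 : ∀ g, φ (c.act g x) / c.avg φ (fun _ => (1 : ℝ)) (c.act g x) = 
        φ (c.act g x) * (c.avg φ (fun _ => (1 : ℝ)) x)⁻¹ := by
      intro g; rw [avg_act]; rfl
    simp only [h1]
    rw [← finsum_mul]
    have h2 : ∑ᶠ g, φ (c.act g x) = c.avg φ (fun _ => (1 : ℝ)) x := by simp [avg]
    rw [h2, mul_inv_cancel₀ (hp x).ne']

theorem Jac_act {u : V3 → V3} (hu : ContDiff ℝ ∞ u) (g : G) (h : ∀ x, u (c.act g x) = c.L g *ᵥ u x) (x : V3) :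
    Jac u (c.act g x) * c.L g = c.L g * Jac u x := by
  have hd : ∀ x, DifferentiableAt ℝ u x := fun x => hu.differentiable (by simp) x
  have hJ : ∀ x v, fderiv ℝ u x v = Jac u x *ᵥ v := by
    intro x v
    ext i
    have h1 := (hasFDerivAt_pi'.mp (hd x).hasFDerivAt i).fderiv
    have h2 := fderiv_eq_pd (f := fun y => u y i) x v
    rw [h1] at h2
    exact h2
  have h1 := (hd (c.act g x)).hasFDerivAt.comp x (c.hasFDerivAt_act g x)
  have h2 := (LinearMap.toContinuousLinearMap (Matrix.mulVecLin (c.L g))).hasFDerivAt.comp x (hd x).hasFDerivAt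
  have h3 : u ∘ c.act g = (LinearMap.toContinuousLinearMap (Matrix.mulVecLin (c.L g))) ∘ u := by
    funext y; exact h y
  rw [h3] at h1
  have h4 := h1.unique h2
  refine Matrix.ext_of_mulVec_single fun i => ?_
  have h5 := congrArg (fun T => T (Pi.single i 1)) h4
  simp only [ContinuousLinearMap.comp_apply, LinearMap.coe_toContinuousLinearMap', mulVecLin_apply, hJ] at h5
  rw [← mulVec_mulVec, ← mulVec_mulVec]; exact h5

theorem adj_comm {M M' L : M3} (hL : L.det ≠ 0) (h : M' * L = L * M) : adjugate M' * L = L * adjugate M := by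
  have h1 := congrArg adjugate h
  rw [adjugate_mul_distrib, adjugate_mul_distrib] at h1
  have h2 : L * (adjugate L * adjugate M') * L = L * (adjugate M * adjugate L) * L := by rw [h1]
  rw [← mul_assoc L, mul_adjugate, ← mul_assoc L, mul_assoc (L * adjugate M), adjugate_mul] at h2
  simp only [Matrix.smul_mul, one_mul, Matrix.mul_smul, mul_one] at h2
  exact smul_right_injective _ hL h2

theorem XX_act {ρ : V3 → ℝ} (hρ : ∀ g x, ρ (c.act g x) = |(c.L g).det|⁻¹ * ρ x) {u : V3 → V3} (hu : ContDiff ℝ ∞ u)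
    (h : ∀ g x, u (c.act g x) = c.L g *ᵥ u x) (t : ℝ) (g : G) (x : V3) :
    XX ρ u t (c.act g x) = |(c.L g).det|⁻¹ • (c.L g *ᵥ XX ρ u t x) := by
  unfold XX
  have h1 : c.act g x + t • u (c.act g x) = c.act g (x + t • u x) := by
    rw [h, act, act, mulVec_add, mulVec_smul]; abel
  have h2 : (1 + t • Jac u (c.act g x)) * c.L g = c.L g * (1 + t • Jac u x) := by
    rw [add_mul, mul_add, Matrix.smul_mul, Matrix.mul_smul, Jac_act hu g (h g), one_mul, mul_one]
  rw [h1, hρ, h, mulVec_mulVec, adj_comm (c.det_ne g) h2, ← mulVec_mulVec, mulVec_smul, smul_smul]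

theorem continuous_Jac {u : V3 → V3} (hu : ContDiff ℝ ∞ u) : Continuous (Jac u) := by
  refine continuous_matrix fun i j => ?_
  have h : Sm (fun y => u y i) := contDiff_pi.mp hu i
  exact (h.pd j).continuous

theorem sm_XX {ρ : V3 → ℝ} (hρ : Sm ρ) {u : V3 → V3} (hu : ContDiff ℝ ∞ u) (t : ℝ) (j : Fin 3) :
    Sm (fun y => XX ρ u t y j) := by
  have hui : ∀ i, Sm (fun y => u y i) := fun i => contDiff_pi.mp hu i
  have hm : ∀ i j, Sm (fun y => (1 + t • Jac u y) i j) := fun i j =>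
    contDiff_const.add (contDiff_const.mul ((hui i).pd j))
  have : ∀ i, Sm (fun y => adjugate (1 + t • Jac u y) j i) := by
    intro i
    simp only [adjugate_fin_three]
    fin_cases i <;> fin_cases j <;> simp only [Fin.zero_eta, Fin.mk_one, Fin.reduceFinMk, Matrix.of_apply, Matrix.cons_val] <;>
      first
      | exact ((hm _ _).mul (hm _ _)).sub ((hm _ _).mul (hm _ _))
      | exact (((hm _ _).mul (hm _ _)).neg).add ((hm _ _).mul (hm _ _))
  refine (hρ.comp_line hu t).mul ?_
  have e : Sm (fun y => ∑ i : Fin 3, adjugate (1 + t • Jac u y) j i * u y i) := ContDiff.sum fun i _ => (this i).mul (hui i)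
  exact e

theorem continuous_DD {ρ : V3 → ℝ} (hρ : Sm ρ) {u : V3 → V3} (hu : ContDiff ℝ ∞ u) :
    Continuous (fun p : ℝ × V3 => DD ρ u p.1 p.2) := by
  have hJ := continuous_Jac hu
  have huc := hu.continuous
  have hl : Continuous (fun p : ℝ × V3 => p.2 + p.1 • u p.2) := by fun_prop
  have hm : Continuous (fun p : ℝ × V3 => 1 + p.1 • Jac u p.2) := by fun_prop
  unfold DD
  refine Continuous.add (Continuous.mul (continuous_finset_sum _ fun k _ => ?_) hm.matrix_det)
    (Continuous.mul (hρ.continuous.comp hl) ?_)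
  · exact Continuous.mul ((hρ.pd k).continuous.comp hl) ((continuous_apply k).comp (huc.comp continuous_snd))
  · exact (hm.matrix_adjugate.matrix_mul (hJ.comp continuous_snd)).matrix_trace

theorem div_zero {χ : V3 → ℝ} (hχ : Sm χ) {R : ℝ} (hR : ∀ x, χ x ≠ 0 → ‖x‖ ≤ R)
    (hsum : ∀ x, ∑ᶠ g, χ (c.act g x) = 1) {X : V3 → V3} (hX : ∀ j, Sm (fun y => X y j))
    (heq : ∀ g x, X (c.act g x) = |(c.L g).det|⁻¹ • (c.L g *ᵥ X x)) :
    ∫ x, χ x * ∑ j, pd j (fun y => X y j) x = 0 := by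
  have hcs : HasCompactSupport χ := HasCompactSupport.of_support_subset_isCompact (isCompact_closedBall (0 : V3) R)
    (fun x hx => by simpa using hR x hx)
  have hXc : Continuous X := continuous_pi fun j => (hX j).continuous
  have h0 := c.stokes0 hχ hR hsum hXc heq
  have i1 : ∀ j, Integrable (fun x => χ x * pd j (fun y => X y j) x) := fun j =>
    (hχ.continuous.mul ((hX j).pd j).continuous).integrable_of_hasCompactSupport hcs.mul_right
  have hcd : ∀ j, HasCompactSupport (pd j χ) := by
    intro j
    refine hcs.mono' ?_
    intro x hx
    by_contra h
    exact hx (by rw [pd, fderiv_of_notMem_tsupport ℝ h]; rfl)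
  have i2 : ∀ j, Integrable (fun x => pd j χ x * X x j) := fun j =>
    ((hχ.pd j).continuous.mul (hX j).continuous).integrable_of_hasCompactSupport (hcd j).mul_right
  have i3 : ∀ j, Integrable (fun x => χ x * X x j) := fun j =>
    (hχ.continuous.mul (hX j).continuous).integrable_of_hasCompactSupport hcs.mul_right
  simp only [Finset.mul_sum]
  rw [integral_finset_sum _ (fun j _ => i1 j)]
  have h1 : ∀ j, ∫ x, χ x * pd j (fun y => X y j) x = - ∫ x, pd j χ x * X x j := fun j =>
    integral_mul_fderiv_eq_neg_fderiv_mul_of_integrable (i2 j) (i1 j) (i3 j) (fun x _ => hχ.dif x) (fun x _ => (hX j).dif x)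
  simp only [h1, Finset.sum_neg_distrib]
  rw [← integral_finset_sum _ (fun j _ => i2 j)]
  simp only [← fderiv_eq_pd]
  rw [h0, neg_zero]

/-- Lemma D -/
theorem no_degenerate {h : V3 → V3} (hh : ContDiff ℝ ∞ h) (heq : ∀ g x, h (c.act g x) = c.act g (h x))
    (hdet : ∀ x, (Jac h x).det = 0) : False := by
  obtain ⟨φ, R, hb⟩ := c.exists_bmp
  obtain ⟨χ, hχ, hχ0, hχR, ⟨x0, hx0⟩, hsum⟩ := exists_chi hb
  have hcs : HasCompactSupport χ := HasCompactSupport.of_support_subset_isCompact (isCompact_closedBall (0 : V3) R)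
    (fun x hx => by simpa using hχR x hx)
  obtain ⟨ρ, hρd⟩ : ∃ ρ, ρ = c.avg φ (fun g => |(c.L g).det|) := ⟨_, rfl⟩
  have hρ : Sm ρ := by rw [hρd]; exact hb.avg_sm _
  have hρ0 : ∀ x, 0 < ρ x := by rw [hρd]; exact hb.avg_pos _ (fun g => abs_pos.mpr (c.det_ne g))
  have hρe : ∀ g x, ρ (c.act g x) = |(c.L g).det|⁻¹ * ρ x := by
    intro γ x
    have h1 := hb.avg_map (LinearMap.mulLeft ℝ (|(c.L γ).det|⁻¹)) (fun g => |(c.L g).det|) x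
    rw [hρd, avg_act]
    simp only [LinearMap.mulLeft_apply] at h1
    rw [h1]
    congr 1; funext g
    have h2 : c.L (g * γ⁻¹) * c.L γ = c.L g := by rw [← map_mul]; simp [-map_mul]
    rw [← h2, det_mul, abs_mul]
    have := abs_pos.mpr (c.det_ne γ)
    field_simp
  let u : V3 → V3 := fun x => h x - x
  have hu : ContDiff ℝ ∞ u := hh.sub contDiff_id
  have hue : ∀ g x, u (c.act g x) = c.L g *ᵥ u x := by
    intro g x
    show h (c.act g x) - c.act g x = c.L g *ᵥ (h x - x)
    rw [heq, act, act, mulVec_sub]; abel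
  let I : ℝ → ℝ := fun t => ∫ x, χ x * (ρ (x + t • u x) * (1 + t • Jac u x).det)
  have hJ := continuous_Jac hu
  have huc := hu.continuous
  have hcont : ∀ t : ℝ, Continuous (fun x => χ x * (ρ (x + t • u x) * (1 + t • Jac u x).det)) := by
    intro t
    have hm : Continuous (fun x : V3 => 1 + t • Jac u x) := by fun_prop
    exact hχ.continuous.mul ((hρ.continuous.comp (by fun_prop)).mul hm.matrix_det)
  have hDc := continuous_DD hρ hu
  have hder : ∀ t, HasDerivAt I 0 t := by
    intro t
    have hF'c : Continuous (fun p : ℝ × V3 => χ p.2 * DD ρ u p.1 p.2) :=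
      (hχ.continuous.comp continuous_snd).mul hDc
    have hcpt : IsCompact (Metric.closedBall t 1 ×ˢ Metric.closedBall (0 : V3) R) :=
      (isCompact_closedBall t 1).prod (isCompact_closedBall 0 R)
    obtain ⟨B, hB⟩ := hcpt.exists_bound_of_continuousOn hF'c.continuousOn
    have key := (hasDerivAt_integral_of_dominated_loc_of_deriv_le (μ := volume) (𝕜 := ℝ)
      (F := fun t x => χ x * (ρ (x + t • u x) * (1 + t • Jac u x).det)) (x₀ := t)
      (F' := fun t x => χ x * DD ρ u t x) (bound := (Metric.closedBall (0 : V3) R).indicator fun _ => B)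
      (Metric.ball_mem_nhds t one_pos)
      (Filter.Eventually.of_forall fun s => (hcont s).aestronglyMeasurable)
      ((hcont t).integrable_of_hasCompactSupport hcs.mul_right)
      (hF'c.comp (Continuous.prodMk_right t)).aestronglyMeasurable
      (Filter.Eventually.of_forall fun x s hs => ?_)
      ?_
      (Filter.Eventually.of_forall fun x s hs => (hasDerivAt_J hρ u x s).const_mul (χ x))).2
    · have e : ∫ x, χ x * DD ρ u t x = 0 := by
        simp only [piola hρ hu]
        exact div_zero hχ hχR hsum (sm_XX hρ hu t) (XX_act hρe hu hue t)
      rw [e] at key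
      exact key
    · by_cases hx : x ∈ Metric.closedBall (0 : V3) R
      · rw [Set.indicator_of_mem hx]
        exact hB (s, x) ⟨Metric.ball_subset_closedBall hs, hx⟩
      · rw [Set.indicator_of_notMem hx]
        have : χ x = 0 := by
          by_contra h
          exact hx (by simpa using hχR x h)
        simp [this]
    · exact (integrableOn_const (isCompact_closedBall (0 : V3) R).measure_lt_top.ne).integrable_indicator measurableSet_closedBall
  have hconst : I 1 = I 0 := by
    refine is_const_of_deriv_eq_zero (fun t => (hder t).differentiableAt) (fun t => (hder t).deriv) 1 0
  have hI1 : I 1 = 0 := by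
    have : ∀ x, (1 + (1 : ℝ) • Jac u x).det = 0 := by
      intro x
      rw [← hdet x, one_smul]
      congr 1
      ext i j
      have hhi : Sm (fun y => h y i) := contDiff_pi.mp hh i
      have hxi : Sm (fun y : V3 => y i) := contDiff_apply ℝ ℝ i
      have e1 : Jac u x i j = pd j (fun y => h y i) x - pd j (fun y : V3 => y i) x := pd_sub hhi hxi j x
      have e2 : pd j (fun y : V3 => y i) x = (1 : M3) i j := by
        have : fderiv ℝ (fun y : V3 => y i) x = ContinuousLinearMap.proj i := 
          (ContinuousLinearMap.proj (R := ℝ) (φ := fun _ : Fin 3 => ℝ) i).hasFDerivAt.fderiv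
        rw [pd, this, Matrix.one_apply]
        simp [Pi.single_apply]
      rw [Matrix.add_apply, e1, e2, Jac, Matrix.of_apply]; ring
    simp only [I, this, mul_zero, integral_zero]
  have hI0 : 0 < I 0 := by
    have e : I 0 = ∫ x, χ x * ρ x := by simp [I]
    rw [e]
    refine (hχ.continuous.mul hρ.continuous).integral_pos_of_hasCompactSupport_nonneg_nonzero hcs.mul_right
      (fun x => mul_nonneg (hχ0 x) (hρ0 x).le) (x := x0) (mul_ne_zero hx0 (hρ0 x0).ne')
  linarith

end Crys
end FG3
end Part16

section Part17
open Matrix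
set_option linter.all false
namespace FG3
open scoped ContDiff Topology

theorem fderiv_eq_Jac {u : V3 → V3} {x : V3} (hd : DifferentiableAt ℝ u x) (v : V3) :
    fderiv ℝ u x v = Jac u x *ᵥ v := by
  ext i
  have h1 := (hasFDerivAt_pi'.mp hd.hasFDerivAt i).fderiv
  have h2 := fderiv_eq_pd (f := fun y => u y i) x v
  rw [h1] at h2
  exact h2

theorem exists_bump_compact {K C : Set V3} (hK : IsCompact K) (hC : IsOpen C) (hKC : K ⊆ C) :
    ∃ ψ : V3 → ℝ, Sm ψ ∧ (∀ x, 0 ≤ ψ x) ∧ (∀ x ∈ K, 0 < ψ x) ∧ ∃ T : Set V3, IsCompact T ∧ T ⊆ C ∧ ∀ x, ψ x ≠ 0 → x ∈ T := by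
  have h1 : ∀ x : V3, ∃ f : V3 → ℝ, x ∈ K → tsupport f ⊆ C ∧ HasCompactSupport f ∧ Sm f ∧ (∀ y, 0 ≤ f y) ∧ 0 < f x := by
    intro x
    by_cases hx : x ∈ K
    · obtain ⟨f, h1, h2, h3, h4, h5⟩ := exists_contDiff_tsupport_subset (n := ⊤) (hC.mem_nhds (hKC hx))
      exact ⟨f, fun _ => ⟨h1, h2, h3, fun y => (h4 ⟨y, rfl⟩).1, by rw [h5]; exact one_pos⟩⟩
    · exact ⟨0, fun h => absurd h hx⟩
  choose f hf using h1
  obtain ⟨S, hS⟩ := hK.elim_nhds_subcover' (fun x _ => {y | 0 < f x y}) (fun x hx =>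
    (isOpen_lt continuous_const (hf x hx).2.2.1.continuous).mem_nhds (hf x hx).2.2.2.2)
  refine ⟨fun y => ∑ x ∈ S, f x y, ContDiff.sum fun x _ => (hf x x.2).2.2.1, fun y => Finset.sum_nonneg fun x _ => (hf x x.2).2.2.2.1 y,
    ?_, ⋃ x ∈ S, tsupport (f x), ?_, ?_, ?_⟩
  · intro y hy
    have := hS hy
    simp only [Set.mem_iUnion] at this
    obtain ⟨x, hx, hxy⟩ := this
    exact Finset.sum_pos' (fun x _ => (hf x x.2).2.2.2.1 y) ⟨x, hx, hxy⟩
  · exact S.isCompact_biUnion fun x _ => (hf x x.2).2.1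
  · exact Set.iUnion₂_subset fun x _ => (hf x x.2).1
  · intro y hy
    obtain ⟨x, hx, hxy⟩ := Finset.exists_ne_zero_of_sum_ne_zero hy
    simp only [Set.mem_iUnion]
    exact ⟨x, hx, subset_tsupport _ hxy⟩

namespace Cone
variable {G : Type} [Group G] {c : Crys G} (k : Cone c)

theorem sum_mem {ι : Type*} (S : Finset ι) (a : ι → ℝ) (x : ι → V3) (ha : ∀ i, 0 ≤ a i) (hx : ∀ i, x i ∈ k.C)
    (h : ∃ i ∈ S, 0 < a i) : ∑ i ∈ S, a i • x i ∈ k.C := by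
  classical
  have h1 : ∑ i ∈ S, a i • x i = ∑ i ∈ S.filter (fun i => 0 < a i), a i • x i := by
    rw [Finset.sum_filter_of_ne]
    intro i _ hi
    exact lt_of_le_of_ne (ha i) (fun h => hi (by rw [← h, zero_smul]))
  rw [h1]
  refine Finset.sum_induction_nonempty _ (· ∈ k.C) (fun x y hx hy => k.add x hx y hy) ?_ ?_
  · obtain ⟨i, hi, h⟩ := h
    exact ⟨i, Finset.mem_filter.mpr ⟨hi, h⟩⟩
  · intro i hi
    exact k.smul _ (Finset.mem_filter.mp hi).2 _ (hx i)

/-- degree zero normalisation -/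
noncomputable def nrm (v : V3) : V3 := (k.w ⬝ᵥ v)⁻¹ • v

theorem nrm_smul {s : ℝ} (hs : 0 < s) (v : V3) : k.nrm (s • v) = k.nrm v := by
  rw [nrm, nrm, dotProduct_smul, smul_smul, smul_eq_mul, _root_.mul_inv_rev, mul_assoc, inv_mul_cancel₀ hs.ne', mul_one]

theorem nrm_cd {v : V3} (hv : v ∈ k.C) : ContDiffAt ℝ ∞ k.nrm v := by
  have h : ContDiff ℝ ∞ (fun v : V3 => k.w ⬝ᵥ v) := by
    unfold dotProduct; fun_prop
  exact (h.contDiffAt.inv (k.pos v hv).ne').smul contDiffAt_id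

theorem nrm_mem {v : V3} (hv : v ∈ k.C) : k.nrm v ∈ k.C := k.smul _ (inv_pos.mpr (k.pos v hv)) v hv

theorem w_nrm {v : V3} (hv : v ∈ k.C) : k.w ⬝ᵥ k.nrm v = 1 := by
  rw [nrm, dotProduct_smul, smul_eq_mul, inv_mul_cancel₀ (k.pos v hv).ne']

theorem false {G : Type} [Group G] {c : Crys G} (k : Cone c) : False := by
  obtain ⟨φ, R, hb⟩ := c.exists_bmp
  obtain ⟨f, hfd⟩ : ∃ f, f = c.avg φ (fun g => k.σ g⁻¹ *ᵥ k.v0) := ⟨_, rfl⟩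
  have hf : ContDiff ℝ ∞ f := by rw [hfd]; exact hb.avg_sm _
  have hfC : ∀ x, f x ∈ k.C := by
    intro x
    rw [hfd, hb.avg_eq _ le_rfl]
    refine k.sum_mem _ _ _ (fun g => hb.nonneg _) (fun g => k.map _ _ k.hv0) ?_
    obtain ⟨g, hg⟩ := hb.cov x
    exact ⟨g, hb.mem le_rfl hg.ne', hg⟩
  have hfe : ∀ γ x, f (c.act γ x) = k.σ γ *ᵥ f x := by
    intro γ x
    have h1 := hb.avg_map (mulVecLin (k.σ γ)) (fun g => k.σ g⁻¹ *ᵥ k.v0) x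
    simp only [mulVecLin_apply, mulVec_mulVec, ← map_mul] at h1
    rw [hfd, h1, Crys.avg_act]
    simp only [_root_.mul_inv_rev, inv_inv]
  have hf1 : ContDiff ℝ ∞ (fun x => k.nrm (f x)) := by
    rw [contDiff_iff_contDiffAt]
    intro x
    exact (k.nrm_cd (hfC x)).comp x hf.contDiffAt
  have hK0 : IsCompact ((fun x => k.nrm (f x)) '' Metric.closedBall 0 R) := (isCompact_closedBall 0 R).image hf1.continuous
  obtain ⟨ψ, hψ, hψ0, hψK, T, hT, hTC, hψT⟩ := exists_bump_compact hK0 k.isOpen (by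
    rintro _ ⟨x, _, rfl⟩; exact k.nrm_mem (hfC x))
  let Ps : G → V3 → ℝ := fun g v => ψ (k.nrm (k.σ g *ᵥ v))
  have hPs : ∀ g v, v ∈ k.C → ContDiffAt ℝ ∞ (Ps g) v := by
    intro g v hv
    have h1 : ContDiff ℝ ∞ (fun v => k.σ g *ᵥ v) :=
      (LinearMap.toContinuousLinearMap (Matrix.mulVecLin (k.σ g))).contDiff
    exact hψ.contDiffAt.comp v ((k.nrm_cd (k.map g v hv)).comp v h1.contDiffAt)
  have hfin : ∀ v ∈ k.C, ∃ S : Finset G, ∀ᶠ y in 𝓝 v, ∀ g, Ps g y ≠ 0 → g ∈ S := by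
    intro v hv
    obtain ⟨K, hK, hvK, hKC⟩ := exists_compact_subset k.isOpen hv
    refine ⟨(k.disc (K ∪ T) (hK.union hT) (Set.union_subset hKC hTC)).toFinset, ?_⟩
    filter_upwards [isOpen_interior.mem_nhds hvK] with y hy g hg
    rw [Set.Finite.mem_toFinset]
    have hyK := interior_subset hy
    exact ⟨y, Or.inl hyK, _, inv_pos.mpr (k.pos _ (k.map g y (hKC hyK))), Or.inr (hψT _ hg)⟩
  have hfin' : ∀ v ∈ k.C, ∃ S : Finset G, ∀ g, Ps g v ≠ 0 → g ∈ S := by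
    intro v hv
    obtain ⟨S, hS⟩ := hfin v hv
    exact ⟨S, hS.self_of_nhds⟩
  let P : V3 → ℝ := fun v => ∑ᶠ g, Ps g v
  let Q : V3 → V3 := fun v => ∑ᶠ g, Ps g v • c.act g⁻¹ 0
  let H : V3 → V3 := fun v => (P v)⁻¹ • Q v
  have hPsm : ∀ g v γ, Ps g (k.σ γ *ᵥ v) = Ps (g * γ) v := by
    intro g v γ
    simp only [Ps, mulVec_mulVec, ← map_mul]
  have hPsh : ∀ g v (s : ℝ), 0 < s → Ps g (s • v) = Ps g v := by
    intro g v s hs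
    simp only [Ps, mulVec_smul, k.nrm_smul hs]
  have hHh : ∀ v (s : ℝ), 0 < s → H (s • v) = H v := by
    intro v s hs
    simp only [H, P, Q, hPsh _ _ s hs]
  have hPe : ∀ γ v, P (k.σ γ *ᵥ v) = P v := by
    intro γ v
    simp only [P, hPsm]
    exact finsum_comp_equiv (Equiv.mulRight γ) (f := fun g => Ps g v)
  have hQe : ∀ γ, ∀ v ∈ k.C, Q (k.σ γ *ᵥ v) = c.L γ *ᵥ Q v + P v • c.b γ := by
    intro γ v hv
    obtain ⟨S, hS⟩ := hfin' v hv
    have h1 : Q (k.σ γ *ᵥ v) = ∑ᶠ g, Ps g v • c.act γ (c.act g⁻¹ 0) := by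
      rw [← finsum_comp_equiv (Equiv.mulRight γ)]
      simp only [Q, hPsm, Equiv.coe_mulRight, ← c.act_mul]
      simp
    have h2 : P v = ∑ g ∈ S, Ps g v := finsum_eq_sum_of_support_subset _ (fun g hg => hS g hg)
    have h3 : Q v = ∑ g ∈ S, Ps g v • c.act g⁻¹ 0 :=
      finsum_eq_sum_of_support_subset _ (fun g hg => hS g (left_ne_zero_of_smul hg))
    rw [h1, h2, h3, finsum_eq_sum_of_support_subset _ (fun g hg => hS g (left_ne_zero_of_smul hg)), mulVec_sum, Finset.sum_smul,
      ← Finset.sum_add_distrib]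
    refine Finset.sum_congr rfl fun g _ => ?_
    rw [mulVec_smul, ← smul_add]; rfl
  have hPpos : ∀ x, 0 < P (k.nrm (f x)) := by
    intro x
    obtain ⟨S, hS⟩ := hfin' _ (k.nrm_mem (hfC x))
    have h2 : P (k.nrm (f x)) = ∑ g ∈ S, Ps g (k.nrm (f x)) := finsum_eq_sum_of_support_subset _ (fun g hg => hS g hg)
    rw [h2]
    obtain ⟨γ, hγ⟩ := hb.cov x
    have h3 : 0 < Ps γ (k.nrm (f x)) := by
      show 0 < ψ (k.nrm (k.σ γ *ᵥ ((k.w ⬝ᵥ f x)⁻¹ • f x)))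
      rw [mulVec_smul, k.nrm_smul (inv_pos.mpr (k.pos _ (hfC x))), ← hfe]
      exact hψK _ ⟨c.act γ x, by simpa using hb.supp _ hγ.ne', rfl⟩
    exact Finset.sum_pos' (fun g _ => hψ0 _) ⟨γ, hS _ h3.ne', h3⟩
  have hHc : ∀ x, ContDiffAt ℝ ∞ H (k.nrm (f x)) := by
    intro x
    have hv := k.nrm_mem (hfC x)
    obtain ⟨S, hS⟩ := hfin _ hv
    have h1 : ContDiffAt ℝ ∞ P (k.nrm (f x)) := contDiffAt_finsum_loc _ _ S hS (fun g => hPs g _ hv)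
    have h2 : ContDiffAt ℝ ∞ Q (k.nrm (f x)) := contDiffAt_finsum_loc _ _ S
      (hS.mono fun y hy g hg => hy g (left_ne_zero_of_smul hg)) (fun g => (hPs g _ hv).smul contDiffAt_const)
    exact (h1.inv (hPpos x).ne').smul h2
  have hHe : ∀ γ x, H (k.σ γ *ᵥ k.nrm (f x)) = c.act γ (H (k.nrm (f x))) := by
    intro γ x
    have hv := k.nrm_mem (hfC x)
    show (P (k.σ γ *ᵥ k.nrm (f x)))⁻¹ • Q (k.σ γ *ᵥ k.nrm (f x)) = c.act γ ((P (k.nrm (f x)))⁻¹ • Q (k.nrm (f x)))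
    rw [hPe, hQe _ _ hv, Crys.act, smul_add, smul_smul, inv_mul_cancel₀ (hPpos x).ne', one_smul, mulVec_smul]
  have hh : ContDiff ℝ ∞ (fun x => H (k.nrm (f x))) := by
    rw [contDiff_iff_contDiffAt]
    intro x
    exact (hHc x).comp x hf1.contDiffAt
  refine Crys.no_degenerate (c := c) hh ?_ ?_
  · intro γ x
    rw [← hHe, hfe]
    have h1 : k.nrm (k.σ γ *ᵥ f x) = (k.w ⬝ᵥ (k.σ γ *ᵥ f x))⁻¹ • (k.σ γ *ᵥ f x) := rfl
    have h2 : k.σ γ *ᵥ k.nrm (f x) = (k.w ⬝ᵥ f x)⁻¹ • (k.σ γ *ᵥ f x) := by rw [nrm, mulVec_smul]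
    rw [h1, h2, hHh _ _ (inv_pos.mpr (k.pos _ (k.map γ _ (hfC x)))), hHh _ _ (inv_pos.mpr (k.pos _ (hfC x)))]
  · intro x
    have hw : k.w ≠ 0 := by
      intro h
      have := k.pos _ k.hv0
      rw [h, zero_dotProduct] at this
      exact lt_irrefl _ this
    have hd1 : DifferentiableAt ℝ (fun x => k.nrm (f x)) x := hf1.differentiable (by simp) x
    have hdH : DifferentiableAt ℝ H (k.nrm (f x)) := (hHc x).differentiableAt (by simp)
    have hdh : DifferentiableAt ℝ (fun x => H (k.nrm (f x))) x := hh.differentiable (by simp) x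
    have h1 : k.w ᵥ* Jac (fun x => k.nrm (f x)) x = 0 := by
      refine funext fun j => ?_
      have e1 : (k.w ᵥ* Jac (fun x => k.nrm (f x)) x) j = k.w ⬝ᵥ (Jac (fun x => k.nrm (f x)) x *ᵥ Pi.single j 1) := by
        rw [dotProduct_mulVec, dotProduct_single_one]
      rw [e1, ← fderiv_eq_Jac hd1]
      let W : V3 →L[ℝ] ℝ := LinearMap.toContinuousLinearMap (dotProductBilin ℝ ℝ k.w)
      have e2 := (W.hasFDerivAt (x := k.nrm (f x))).comp x hd1.hasFDerivAt
      have e3 : W ∘ (fun x => k.nrm (f x)) = fun _ => (1 : ℝ) := by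
        funext y; exact k.w_nrm (hfC y)
      rw [e3] at e2
      have e4 := congrArg (fun T => T (Pi.single j 1)) (e2.unique (hasFDerivAt_const _ _))
      exact e4
    have h2 : (Jac (fun x => k.nrm (f x)) x).det = 0 := exists_vecMul_eq_zero_iff.mp ⟨k.w, hw, h1⟩
    obtain ⟨ξ, hξ, h3⟩ := exists_mulVec_eq_zero_iff.mpr h2
    refine exists_mulVec_eq_zero_iff.mp ⟨ξ, hξ, ?_⟩
    rw [← fderiv_eq_Jac hdh]
    have h4 : fderiv ℝ (fun x => H (k.nrm (f x))) x = (fderiv ℝ H (k.nrm (f x))).comp (fderiv ℝ (fun x => k.nrm (f x)) x) :=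
      (HasFDerivAt.comp (g := H) (f := fun x => k.nrm (f x)) x hdH.hasFDerivAt hd1.hasFDerivAt).fderiv
    rw [h4, ContinuousLinearMap.comp_apply, fderiv_eq_Jac hd1, h3, map_zero]

end Cone
end FG3
end Part17

section Part18
open Matrix
set_option linter.all false
namespace FG3
namespace Crys
variable {G : Type} [Group G] (c : Crys G)

theorem line_case (hI : c.Irr) (h0 : ∀ g, c.L g 1 0 = 0) (h1 : ∀ g, c.L g 2 0 = 0) :
    Group.IsSolvable G ∧ NoethG G := by
  apply c.solv_line_of_not_ns h0 h1
  by_contra hNS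
  push Not at hNS
  obtain ⟨α, β, hαβ⟩ := hNS
  set A := c.lineA h0 h1 with hA
  have htr : ∀ g, (c.L g).trace = c.L g 0 0 + (A g).trace := by
    intro g; simp [hA, lineA, trace_fin_three, trace_fin_two]; ring
  have hlam : ∀ g, c.L g 0 0 = 1 := by
    have hdet : ∀ g, (A g - 1).det * (c.L g 0 0 - 1) = 0 := by
      intro g
      rw [← c.eig_one hI g, det_fin_three, det_fin_two]
      simp [hA, lineA, h0, h1]
      ring
    have hp : (fun g => (A g - 1).det) ∈ c.Pol := by
      have : (fun g => (A g - 1).det) = fun g =>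
          (c.L g 1 1 - 1) * (c.L g 2 2 - 1) - c.L g 1 2 * c.L g 2 1 := by
        ext g; rw [det_fin_two]; simp [hA, lineA]
      rw [this]
      exact c.pol_sub (c.pol_mul (c.pol_sub (c.pol_L _ _) (c.pol_const _))
        (c.pol_sub (c.pol_L _ _) (c.pol_const _))) (c.pol_mul (c.pol_L _ _) (c.pol_L _ _))
    rcases hI _ hp _ (c.pol_sub (c.pol_L 0 0) (c.pol_const 1)) hdet with h | h
    · exfalso
      have := h (α * β * α⁻¹ * β⁻¹)
      rw [det_sub_one2, det_comm] at this
      apply hαβ; linarith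
    · intro g; exact sub_eq_zero.mp (h g)
  have l : c.Line := ⟨hI, h0, h1, hlam, α, β, by
    rw [htr, hlam]; intro h; apply hαβ; linarith⟩
  obtain ⟨k⟩ := l.cone
  exact k.false

theorem core (hI : c.Irr) : Group.IsSolvable G ∧ NoethG G := by
  by_cases hev : ∃ v : V3, v ≠ 0 ∧ ∀ g, ∃ r : ℝ, c.L g *ᵥ v = r • v
  · obtain ⟨v, hv, h⟩ := hev
    obtain ⟨P, Q, hPQ, hQ⟩ := exists_basis_vec 0 hv
    have key : ∀ g, ∃ r : ℝ, (c.conj P Q hPQ).L g *ᵥ Pi.single 0 1 = r • (Pi.single 0 1 : V3) := by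
      intro g
      obtain ⟨r, hr⟩ := h g
      refine ⟨r, ?_⟩
      rw [conj_L, ← mulVec_mulVec, hQ, ← mulVec_mulVec, hr, mulVec_smul, ← hQ, mulVec_mulVec, hPQ, one_mulVec]
    refine (c.conj P Q hPQ).line_case (c.conj_irr P Q hPQ hI) ?_ ?_
    · intro g
      obtain ⟨r, hr⟩ := key g
      have := congrFun hr 1
      simpa using this
    · intro g
      obtain ⟨r, hr⟩ := key g
      have := congrFun hr 2
      simpa using this
  by_cases hel : ∃ w : V3, w ≠ 0 ∧ ∀ g, ∃ r : ℝ, w ᵥ* c.L g = r • w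
  · obtain ⟨w, hw, h⟩ := hel
    obtain ⟨P, Q, hPQ, hQ⟩ := exists_basis_vec 2 hw
    have hT : Qᵀ * Pᵀ = 1 := by rw [← transpose_mul, hPQ, transpose_one]
    have hw1 : (Pi.single 2 1 : V3) ᵥ* Qᵀ = w := by rw [vecMul_transpose, hQ]
    have key : ∀ g, ∃ r : ℝ, (Pi.single 2 1 : V3) ᵥ* (c.conj Qᵀ Pᵀ hT).L g = r • (Pi.single 2 1 : V3) := by
      intro g
      obtain ⟨r, hr⟩ := h g
      refine ⟨r, ?_⟩
      rw [conj_L, ← vecMul_vecMul, ← vecMul_vecMul, hw1, hr, smul_vecMul, ← hw1, vecMul_vecMul, hT, vecMul_one]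
    refine (c.conj Qᵀ Pᵀ hT).plane_case (c.conj_irr _ _ hT hI) ?_ ?_
    · intro g
      obtain ⟨r, hr⟩ := key g
      have := congrFun hr 0
      simpa using this
    · intro g
      obtain ⟨r, hr⟩ := key g
      have := congrFun hr 1
      simpa using this
  push Not at hev hel
  have l : c.Irred := ⟨hI, hev, hel⟩
  obtain ⟨k⟩ := l.cone
  exact k.false.elim

end Crys
end FG3
end Part18

section Part19
set_option linter.all false
namespace FG3
open Matrix

theorem affine_apply (γ : (Fin 3 → ℝ) ≃ᵃ[ℝ] (Fin 3 → ℝ)) (x : V3) :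
    LinearMap.toMatrix' (γ.linear : V3 →ₗ[ℝ] V3) *ᵥ x + γ 0 = γ x := by
  rw [LinearMap.toMatrix'_mulVec]
  have h := γ.map_vadd 0 x
  simp only [vadd_eq_add, add_zero] at h
  exact h.symm

theorem exists_crys (Γ : Subgroup ((Fin 3 → ℝ) ≃ᵃ[ℝ] (Fin 3 → ℝ)))
    (hproper : ∀ K L : Set (Fin 3 → ℝ), IsCompact K → IsCompact L →
      {γ : (Fin 3 → ℝ) ≃ᵃ[ℝ] (Fin 3 → ℝ) | γ ∈ Γ ∧ ∃ x ∈ K, γ x ∈ L}.Finite)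
    (hcompact : CompactSpace (Quotient (affineOrbitSetoid Γ))) : Nonempty (Crys Γ) := by
  refine ⟨{
    L := { toFun := fun γ => LinearMap.toMatrix' (γ.1.linear : V3 →ₗ[ℝ] V3)
           map_one' := by
             have : ((1 : Γ).1.linear : V3 →ₗ[ℝ] V3) = LinearMap.id := rfl
             rw [this, LinearMap.toMatrix'_id]
           map_mul' := fun g h => by
             have : ((g * h).1.linear : V3 →ₗ[ℝ] V3) = (g.1.linear : V3 →ₗ[ℝ] V3).comp (h.1.linear : V3 →ₗ[ℝ] V3) := rfl
             rw [this, LinearMap.toMatrix'_comp] }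
    b := fun γ => γ.1 0
    b_mul := fun g h => (affine_apply g.1 (h.1 0)).symm
    faithful := fun g h1 h2 => ?_
    proper := fun R => ?_
    cocompact := ?_ }⟩
  · apply Subtype.ext
    apply AffineEquiv.ext
    intro x
    have h3 : LinearMap.toMatrix' (g.1.linear : V3 →ₗ[ℝ] V3) = 1 := h1
    rw [← affine_apply, h3, h2, one_mulVec, add_zero]
    rfl
  · have h := (hproper (Metric.closedBall 0 R) (Metric.closedBall 0 R) (isCompact_closedBall 0 R)
      (isCompact_closedBall 0 R)).preimage (f := fun γ : Γ => γ.1) Subtype.val_injective.injOn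
    refine h.subset ?_
    rintro g ⟨x, hx, hy⟩
    refine ⟨g.2, x, by simpa using hx, ?_⟩
    have hy' : ‖LinearMap.toMatrix' (g.1.linear : V3 →ₗ[ℝ] V3) *ᵥ x + g.1 0‖ ≤ R := hy
    rw [affine_apply] at hy'
    simpa using hy'
  · let π : V3 → Quotient (affineOrbitSetoid Γ) := Quotient.mk (affineOrbitSetoid Γ)
    have hπ : ∀ n : ℕ, IsOpen (π '' Metric.ball 0 n) := by
      intro n
      refine isQuotientMap_quotient_mk'.isOpen_preimage.mp ?_
      have : (Quotient.mk (affineOrbitSetoid Γ)) ⁻¹' (π '' Metric.ball 0 n) = ⋃ γ : Γ, (fun x => γ.1 x) ⁻¹' Metric.ball 0 n := by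
        ext x
        simp only [Set.mem_preimage, Set.mem_image, Set.mem_iUnion]
        constructor
        · rintro ⟨y, hy, hxy⟩
          obtain ⟨γ, hγ, h⟩ := Quotient.exact hxy.symm
          exact ⟨⟨γ, hγ⟩, by rw [h]; exact hy⟩
        · rintro ⟨γ, hγ⟩
          exact ⟨γ.1 x, hγ, (Quotient.sound (s := affineOrbitSetoid Γ) ⟨γ.1, γ.2, rfl⟩).symm⟩
      change IsOpen ((Quotient.mk (affineOrbitSetoid Γ)) ⁻¹' (π '' Metric.ball 0 n))
      rw [this]
      exact isOpen_iUnion fun γ => Metric.isOpen_ball.preimage (γ.1.toAffineMap.continuous_of_finiteDimensional)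
    obtain ⟨n, hn⟩ := isCompact_univ.elim_directed_cover (fun n : ℕ => π '' Metric.ball 0 n) hπ (by
      intro q _
      obtain ⟨x, rfl⟩ := Quotient.exists_rep q
      obtain ⟨n, hn⟩ := exists_nat_gt ‖x‖
      exact Set.mem_iUnion.mpr ⟨n, x, by simpa using hn, rfl⟩) (by
      refine Monotone.directed_le ?_
      intro m n hmn
      exact Set.image_mono (Metric.ball_subset_ball (by exact_mod_cast hmn)))
    refine ⟨n, fun x => ?_⟩
    obtain ⟨y, hy, hxy⟩ := hn (Set.mem_univ (π x))
    obtain ⟨γ, hγ, h⟩ := Quotient.exact hxy.symm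
    refine ⟨⟨γ, hγ⟩, ?_⟩
    change ‖LinearMap.toMatrix' (γ.linear : V3 →ₗ[ℝ] V3) *ᵥ x + γ 0‖ ≤ n
    rw [affine_apply, h]
    exact le_of_lt (by simpa using hy)

end FG3
end Part19

/-- Fried–Goldman: the Auslander conjecture in dimension three.  If a subgroup
`Γ` of `Aff(ℝ³)` acts properly discontinuously on `ℝ³` with compact quotient
`Γ \ ℝ³`, then `Γ` is virtually polycyclic. -/
theorem fried_goldman_auslander_dim_three
    (Γ : Subgroup ((Fin 3 → ℝ) ≃ᵃ[ℝ] (Fin 3 → ℝ)))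
    (hproper : ∀ K L : Set (Fin 3 → ℝ), IsCompact K → IsCompact L →
      {γ : (Fin 3 → ℝ) ≃ᵃ[ℝ] (Fin 3 → ℝ) | γ ∈ Γ ∧ ∃ x ∈ K, γ x ∈ L}.Finite)
    (hcompact : CompactSpace (Quotient (affineOrbitSetoid Γ))) :
    IsVirtuallyPolycyclic Γ := by
  obtain ⟨c⟩ := FG3.exists_crys Γ hproper hcompact
  obtain ⟨H, hH, hI⟩ := c.exists_irr_restrict
  obtain ⟨h1, h2⟩ := (c.restrict H).core hI
  exact ⟨H, hH.index_ne_zero, h1, h2⟩
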